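/- arXiv:2601.09094 — 2 statements merged into one kernel-verified Lean document; each statement's English description precedes it below -/
import Mathlib

section
/- Let $k\in\mathbb{N}$ and $p,q\in[1,\infty)$ satisfy $n(\frac{1}{p}-\frac{1}{q})<k$. Then there exists a constant $C>0$, depending only on $n,k,p,q$, such that for any $f\in C^\infty(\mathbb{R}^n)$, $r\in(0,\infty)$, and $x\in\mathbb{R}^n$, $\left(\fint_{B(\mathbf{0},r)}|\Delta_h^k f(x)|^q\,dh\right)^{1/q} \le C\, r^k \left(\int_0^{k+1}\fint_{B(x,tr)}|\nabla^k f(y)|^p\,dy\,dt\right)^{1/p}$. -/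
open MeasureTheory Real Set
open scoped Classical ENNReal

noncomputable section

namespace Paper

variable {n : ℕ}

/-- The `k`-th order difference `Δ_h^k f (x)`. -/
def kdiff (k : ℕ) (f : EuclideanSpace ℝ (Fin n) → ℝ)
    (h x : EuclideanSpace ℝ (Fin n)) : ℝ :=
  ∑ j ∈ Finset.range (k + 1), (-1 : ℝ) ^ (k - j) * (k.choose j : ℝ) * f (x + j • h)

/-- Axis-parallel cubes. -/
def IsCube (Q : Set (EuclideanSpace ℝ (Fin n))) : Prop :=
  ∃ (a : EuclideanSpace ℝ (Fin n)) (l : ℝ), 0 < l ∧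
    Q = {x | ∀ i, x i ∈ Set.Ico (a i) (a i + l)}

/-- `ω` satisfies the `A₁` condition with constant `C`. -/
def MemA1 (ω : EuclideanSpace ℝ (Fin n) → ℝ) (C : ℝ) : Prop :=
  ∀ Q : Set (EuclideanSpace ℝ (Fin n)), IsCube Q →
    ∀ᵐ y ∂(volume.restrict Q), (⨍ x in Q, ω x) ≤ C * ω y

/-- `ω` satisfies the `A_p` condition (`p > 1`) with constant `C`. -/
def MemApGt (p : ℝ) (ω : EuclideanSpace ℝ (Fin n) → ℝ) (C : ℝ) : Prop :=
  ∀ Q : Set (EuclideanSpace ℝ (Fin n)), IsCube Q →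
    IntegrableOn (fun x => ω x ^ (-1 / (p - 1))) Q volume ∧
    (⨍ x in Q, ω x) * (⨍ x in Q, ω x ^ (-1 / (p - 1))) ^ (p - 1) ≤ C

/-- `A_p` condition for `p ∈ [1, ∞)`. -/
def MemAp (p : ℝ) (ω : EuclideanSpace ℝ (Fin n) → ℝ) (C : ℝ) : Prop :=
  if p = 1 then MemA1 ω C else MemApGt p ω C

/-- The Muckenhoupt constant `[ω]_{A_p}`. -/
def ApConst (p : ℝ) (ω : EuclideanSpace ℝ (Fin n) → ℝ) : ℝ :=
  sInf {C : ℝ | 0 ≤ C ∧ MemAp p ω C}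

/-- `ω ∈ A_p`: nonnegative, locally integrable, satisfying the `A_p` condition. -/
def IsAp (p : ℝ) (ω : EuclideanSpace ℝ (Fin n) → ℝ) : Prop :=
  (∀ x, 0 ≤ ω x) ∧ LocallyIntegrable ω volume ∧ ∃ C : ℝ, MemAp p ω C

/-- The `A₁` constant. -/
abbrev A1const (ω : EuclideanSpace ℝ (Fin n) → ℝ) : ℝ := ApConst 1 ω

/-- `ω ∈ A₁`. -/
abbrev IsA1 (ω : EuclideanSpace ℝ (Fin n) → ℝ) : Prop := IsAp 1 ω

/-- The critical exponent `p_ω := inf {r ∈ [1,∞) : ω ∈ A_r}`. -/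
def pExp (ω : EuclideanSpace ℝ (Fin n) → ℝ) : ℝ :=
  sInf {r : ℝ | 1 ≤ r ∧ IsAp r ω}

/-- Classical partial derivative in the `i`-th coordinate direction. -/
def pd (i : Fin n) (φ : EuclideanSpace ℝ (Fin n) → ℝ) :
    EuclideanSpace ℝ (Fin n) → ℝ :=
  fun x => fderiv ℝ φ x (EuclideanSpace.single i 1)

/-- The classical partial derivative `∂^α φ` for a multi-index `α`. -/
def pdMulti (α : Fin n → ℕ) (φ : EuclideanSpace ℝ (Fin n) → ℝ) :
    EuclideanSpace ℝ (Fin n) → ℝ :=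
  (List.finRange n).foldr (fun i ψ => (pd i)^[α i] ψ) φ

/-- `g` is the weak `α`-th partial derivative of `f`. -/
def HasWeakPD (α : Fin n → ℕ) (f g : EuclideanSpace ℝ (Fin n) → ℝ) : Prop :=
  ∀ φ : EuclideanSpace ℝ (Fin n) → ℝ, ContDiff ℝ (⊤ : ℕ∞) φ → HasCompactSupport φ →
    ∫ x, f x * pdMulti α φ x = (-1 : ℝ) ^ (∑ i, α i) * ∫ x, g x * φ x

/-- The multi-indices of order exactly `k`. -/
def multiIdx (n k : ℕ) : Finset (Fin n → ℕ) :=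
  ((Finset.univ : Finset (Fin n → Fin (k + 1))).image fun a i => (a i : ℕ)).filter
    fun α => ∑ i, α i = k

/-- The multi-indices of order at most `k`. -/
def multiIdxLE (n k : ℕ) : Finset (Fin n → ℕ) :=
  ((Finset.univ : Finset (Fin n → Fin (k + 1))).image fun a i => (a i : ℕ)).filter
    fun α => ∑ i, α i ≤ k

/-- `|∇^k f|` built from a family `g` of the `k`-th order (weak) partial derivatives. -/
def gradNorm (n k : ℕ) (g : (Fin n → ℕ) → EuclideanSpace ℝ (Fin n) → ℝ)
    (x : EuclideanSpace ℝ (Fin n)) : ℝ :=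
  Real.sqrt (∑ α ∈ multiIdx n k, g α x ^ 2)

end Paper

open Paper

/-- The `k`-th difference of a polynomial map of degree `m < k` vanishes. -/
lemma sum_choose_mul_multilinear_eq_zero {E : Type*} [NormedAddCommGroup E] [NormedSpace ℝ E]
    {m k : ℕ} (hmk : m < k) (M : E [×m]→L[ℝ] ℝ) (a b : E) :
    ∑ j ∈ Finset.range (k + 1), (-1 : ℝ) ^ (k - j) * (k.choose j : ℝ) *
      M (fun _ => a + j • b) = 0 := by
  have expand (j : ℕ) : M (fun _ => a + j • b) = ∑ s : Finset (Fin m),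
      (j : ℝ) ^ s.card * M (s.piecewise (fun _ => b) (fun _ => a)) := by
    have h1 : (fun _ : Fin m => a + j • b) = (fun _ => (j : ℝ) • b) + fun _ => a := by
      ext i; simp [add_comm, Nat.cast_smul_eq_nsmul]
    rw [h1, M.map_add_univ]
    refine Finset.sum_congr rfl fun s _ => ?_
    have h2 : s.piecewise (fun _ : Fin m => (j : ℝ) • b) (fun _ => a) =
        s.piecewise (fun i => (j : ℝ) • (s.piecewise (fun _ => b) (fun _ => a) : Fin m → E) i)
          (s.piecewise (fun _ => b) (fun _ => a)) := by
      ext i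
      by_cases hi : i ∈ s <;> simp [hi]
    rw [h2, M.map_piecewise_smul]
    simp
  have key (d : ℕ) (hd : d < k) :
      ∑ j ∈ Finset.range (k + 1), (-1 : ℝ) ^ (k - j) * (k.choose j : ℝ) * (j : ℝ) ^ d = 0 := by
    have h := congrFun (fwdDiff_iter_pow_eq_zero_of_lt (R := ℝ) hd) 0
    rw [fwdDiff_iter_eq_sum_shift] at h
    simpa using h
  simp_rw [expand, Finset.mul_sum]
  rw [Finset.sum_comm]
  refine Finset.sum_eq_zero fun s _ => ?_
  have hs : s.card < k := lt_of_le_of_lt (by simpa using s.card_le_univ) hmk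
  simp_rw [← mul_assoc, ← Finset.sum_mul]
  rw [key _ hs, zero_mul]

/-- Pointwise control of a difference by a Taylor remainder based at an arbitrary point. -/
lemma abs_kdiff_le {n m : ℕ} {f : EuclideanSpace ℝ (Fin n) → ℝ} (hf : ContDiff ℝ (⊤ : ℕ∞) f)
    (h x z : EuclideanSpace ℝ (Fin n)) :
    |kdiff (m + 1) f h x| ≤ ∑ j ∈ Finset.range (m + 1 + 1), ((m + 1).choose j : ℝ) *
      ∫ u in (0 : ℝ)..1, u ^ m * (‖iteratedFDeriv ℝ (m + 1) f (z + (1 - u) • (x + j • h - z))‖ *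
        ‖x + j • h - z‖ ^ (m + 1)) := by
  have taylor (y : EuclideanSpace ℝ (Fin n)) := map_add_eq_sum_add_integral_iteratedFDeriv
    (f := f) (x := z) (y := y - z) (n := m)
    (fun t _ => (hf.of_le (by exact_mod_cast le_top)).contDiffAt)
  simp only [add_sub_cancel] at taylor
  have h0 : kdiff (m + 1) f h x = ∑ j ∈ Finset.range (m + 1 + 1),
      (-1 : ℝ) ^ (m + 1 - j) * ((m + 1).choose j : ℝ) *
        ((m.factorial : ℝ)⁻¹ • ∫ t in (0:ℝ)..1, (1 - t) ^ m •
          iteratedFDeriv ℝ (m + 1) f (z + t • (x + j • h - z)) (fun _ => x + j • h - z)) := by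
    unfold kdiff
    simp_rw [taylor, mul_add, Finset.sum_add_distrib, Finset.mul_sum]
    rw [Finset.sum_comm, Finset.sum_eq_zero, zero_add]
    intro i hi
    have := sum_choose_mul_multilinear_eq_zero (Finset.mem_range.1 hi)
      (iteratedFDeriv ℝ i f z) (x - z) h
    simp_rw [smul_eq_mul, mul_left_comm _ ((i.factorial : ℝ)⁻¹), ← Finset.mul_sum]
    simp_rw [sub_add_eq_add_sub] at this
    rw [this, mul_zero]
  rw [h0]
  refine (Finset.abs_sum_le_sum_abs _ _).trans (Finset.sum_le_sum fun j _ => ?_)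
  rw [abs_mul, abs_mul, abs_pow, abs_neg, abs_one, one_pow, one_mul, Nat.abs_cast]
  refine mul_le_mul_of_nonneg_left ?_ (by positivity)
  rw [smul_eq_mul, abs_mul]
  refine (mul_le_of_le_one_left (abs_nonneg _) ?_).trans ?_
  · rw [abs_of_nonneg (by positivity)]
    exact inv_le_one_of_one_le₀ (by exact_mod_cast Nat.factorial_pos m)
  rw [← Real.norm_eq_abs]
  have hsub := intervalIntegral.integral_comp_sub_left (a := 0) (b := 1)
    (fun t : ℝ => (1 - t) ^ m • iteratedFDeriv ℝ (m + 1) f (z + t • (x + j • h - z))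
      (fun _ => x + j • h - z)) 1
  simp only [sub_self, sub_zero] at hsub
  rw [← hsub]
  have hc : Continuous (iteratedFDeriv ℝ (m + 1) f) :=
    hf.continuous_iteratedFDeriv (by exact_mod_cast le_top)
  refine intervalIntegral.norm_integral_le_of_norm_le zero_le_one (.of_forall fun u hu => ?_)
    (Continuous.intervalIntegrable (by fun_prop) _ _)
  rw [sub_sub_cancel, norm_smul, norm_pow, Real.norm_of_nonneg hu.1.le]
  refine mul_le_mul_of_nonneg_left ?_ (pow_nonneg hu.1.le _)
  refine (ContinuousMultilinearMap.le_opNorm _ _).trans ?_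
  simp

/-- Hölder's inequality for the Lebesgue integral against the constant function `1`. -/
lemma lintegral_rpow_le {α : Type*} [MeasurableSpace α] (μ : Measure α) {F : α → ℝ≥0∞}
    (hF : Measurable F) {q : ℝ} (hq : 1 ≤ q) :
    (∫⁻ a, F a ∂μ) ^ q ≤ μ univ ^ (q - 1) * ∫⁻ a, F a ^ q ∂μ := by
  have hq0 : 0 < q := by linarith
  have h := eLpNorm'_le_eLpNorm'_mul_rpow_measure_univ (μ := μ) one_pos hq
    hF.aestronglyMeasurable
  have h2 := ENNReal.rpow_le_rpow h hq0.le
  simp only [eLpNorm', enorm_eq_self, ENNReal.rpow_one, div_one] at h2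
  rw [ENNReal.mul_rpow_of_nonneg _ _ hq0.le, ← ENNReal.rpow_mul, ← ENNReal.rpow_mul,
    one_div_mul_cancel hq0.ne', ENNReal.rpow_one, sub_mul, one_div_mul_cancel hq0.ne', one_mul]
    at h2
  rwa [mul_comm]

/-- Weighted Jensen inequality. -/
lemma lintegral_mul_rpow_le {α : Type*} [MeasurableSpace α] (μ : Measure α) {w F : α → ℝ≥0∞}
    (hw : Measurable w) (hF : Measurable F) {q : ℝ} (hq : 1 ≤ q) :
    (∫⁻ a, w a * F a ∂μ) ^ q ≤ (∫⁻ a, w a ∂μ) ^ (q - 1) * ∫⁻ a, w a * F a ^ q ∂μ := by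
  have h := lintegral_rpow_le (μ.withDensity w) hF hq
  rwa [lintegral_withDensity_eq_lintegral_mul _ hw hF,
    lintegral_withDensity_eq_lintegral_mul _ hw (hF.pow_const q),
    withDensity_apply _ MeasurableSet.univ, Measure.restrict_univ] at h

lemma lintegral_comp_smul_add {n : ℕ} {F : EuclideanSpace ℝ (Fin n) → ℝ≥0∞} (hF : Measurable F)
    {a : ℝ} (ha : 0 < a) (c : EuclideanSpace ℝ (Fin n)) :
    ∫⁻ z, F (a • z + c) = (ENNReal.ofReal a ^ n)⁻¹ * ∫⁻ z, F z := by
  have h1 := lintegral_map (μ := (volume : Measure (EuclideanSpace ℝ (Fin n))))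
    (hF.comp (measurable_add_const c)) (measurable_const_smul a)
  rw [Measure.map_addHaar_smul _ ha.ne', lintegral_smul_measure] at h1
  simp only [Function.comp_apply] at h1
  rw [← h1, lintegral_add_right_eq_self (μ := volume) F c, finrank_euclideanSpace_fin,
    abs_of_pos (by positivity), ENNReal.ofReal_inv_of_pos (by positivity),
    ENNReal.ofReal_pow ha.le, smul_eq_mul]

/-- The normalized Lebesgue measure on the unit ball. -/
def unitBallMeasure (n : ℕ) : Measure (EuclideanSpace ℝ (Fin n)) :=
  (volume (Metric.ball (0 : EuclideanSpace ℝ (Fin n)) 1))⁻¹ •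
    volume.restrict (Metric.ball (0 : EuclideanSpace ℝ (Fin n)) 1)

lemma unitBall_volume_ne_zero (n : ℕ) :
    volume (Metric.ball (0 : EuclideanSpace ℝ (Fin n)) 1) ≠ 0 :=
  (Metric.measure_ball_pos _ _ one_pos).ne'

lemma unitBall_volume_ne_top (n : ℕ) :
    volume (Metric.ball (0 : EuclideanSpace ℝ (Fin n)) 1) ≠ ∞ :=
  measure_ball_lt_top.ne

instance isProbabilityMeasure_unitBallMeasure (n : ℕ) :
    IsProbabilityMeasure (unitBallMeasure n) := by
  constructor
  simp [unitBallMeasure,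
    ENNReal.inv_mul_cancel (unitBall_volume_ne_zero n) (unitBall_volume_ne_top n)]

lemma ae_unitBallMeasure (n : ℕ) :
    ∀ᵐ z ∂(unitBallMeasure n), z ∈ Metric.ball (0 : EuclideanSpace ℝ (Fin n)) 1 :=
  Measure.ae_smul_measure (ae_restrict_mem measurableSet_ball) _

lemma lintegral_unitBallMeasure_comp_smul_add_le {n : ℕ}
    {F : EuclideanSpace ℝ (Fin n) → ℝ≥0∞} (hF : Measurable F)
    {a : ℝ} (ha : 0 < a) (c : EuclideanSpace ℝ (Fin n)) :
    ∫⁻ z, F (a • z + c) ∂(unitBallMeasure n) ≤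
      (volume (Metric.ball (0 : EuclideanSpace ℝ (Fin n)) 1))⁻¹ *
        ((ENNReal.ofReal a ^ n)⁻¹ * ∫⁻ z, F z) := by
  rw [unitBallMeasure, lintegral_smul_measure, smul_eq_mul, ← lintegral_comp_smul_add hF ha c]
  gcongr
  exact Measure.restrict_le_self

lemma inv_ofReal_pow_le {a : ℝ} (ha : 1 / 2 ≤ a) (n : ℕ) :
    (ENNReal.ofReal a ^ n)⁻¹ ≤ 2 ^ n := by
  rw [ENNReal.inv_pow]
  gcongr
  rw [ENNReal.inv_le_iff_inv_le, ← ENNReal.ofReal_ofNat 2, ← ENNReal.ofReal_inv_of_pos two_pos]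
  exact ENNReal.ofReal_le_ofReal (by linarith)

/-- Averaging a function over convex combinations of points of two balls is bounded on `L¹`,
uniformly in the combination. -/
lemma lintegral_lintegral_unitBallMeasure_le {n j : ℕ} (hj : 1 ≤ j)
    {F : EuclideanSpace ℝ (Fin n) → ℝ≥0∞} (hF : Measurable F)
    {u : ℝ} (hu : u ∈ Ioc (0 : ℝ) 1) :
    ∫⁻ h, ∫⁻ z, F (u • z + (1 - u) • (j : ℝ) • h) ∂(unitBallMeasure n) ∂(unitBallMeasure n) ≤
      (volume (Metric.ball (0 : EuclideanSpace ℝ (Fin n)) 1))⁻¹ * (2 ^ n * ∫⁻ z, F z) := by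
  rcases le_total (1 / 2) u with h2 | h2
  · calc _ ≤ ∫⁻ _, (volume (Metric.ball (0 : EuclideanSpace ℝ (Fin n)) 1))⁻¹ *
            (2 ^ n * ∫⁻ z, F z) ∂(unitBallMeasure n) := by
          refine lintegral_mono fun h => ?_
          refine (lintegral_unitBallMeasure_comp_smul_add_le hF hu.1 _).trans ?_
          gcongr
          exact inv_ofReal_pow_le h2 n
      _ = _ := by simp
  · have hj' : (1 : ℝ) ≤ j := by exact_mod_cast hj
    have hv : 1 / 2 ≤ (1 - u) * j := by nlinarith
    rw [lintegral_lintegral_swap (by fun_prop)]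
    calc _ ≤ ∫⁻ _, (volume (Metric.ball (0 : EuclideanSpace ℝ (Fin n)) 1))⁻¹ *
            (2 ^ n * ∫⁻ z, F z) ∂(unitBallMeasure n) := by
          refine lintegral_mono fun z => ?_
          simp_rw [add_comm (u • z), smul_smul]
          refine (lintegral_unitBallMeasure_comp_smul_add_le hF (by linarith) _).trans ?_
          gcongr
          exact inv_ofReal_pow_le hv n
      _ = _ := by simp

lemma lintegral_rpow_le_of_le {α : Type*} [MeasurableSpace α] (μ : Measure α) {A : α → ℝ≥0∞}
    {p q : ℝ} (hp : 0 < p) (hpq : p ≤ q) {D : ℝ≥0∞} (hA : ∀ a, A a ^ p ≤ D) (hAm : Measurable A) :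
    ∫⁻ a, A a ^ q ∂μ ≤ D ^ (q / p - 1) * ∫⁻ a, A a ^ p ∂μ := by
  rw [← lintegral_const_mul _ (by fun_prop)]
  refine lintegral_mono fun a => ?_
  have h1 : 0 ≤ q / p - 1 := by rw [sub_nonneg, one_le_div hp]; exact hpq
  calc A a ^ q = (A a ^ p) ^ (q / p - 1) * A a ^ p := by
        rw [← ENNReal.rpow_mul, ← ENNReal.rpow_add_of_nonneg _ _ (by positivity) hp.le]
        congr 1
        field_simp
        ring
    _ ≤ _ := by gcongr; exact hA a

/-- The `L^p → L^q` bound for averages over convex combinations. -/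
lemma lintegral_average_rpow_le {n j : ℕ} (hj : 1 ≤ j) {p q : ℝ} (hp : 1 ≤ p) (hpq : p ≤ q)
    {g : EuclideanSpace ℝ (Fin n) → ℝ≥0∞} (hg : Measurable g) {u : ℝ} (hu : u ∈ Ioc (0 : ℝ) 1) :
    ∫⁻ h, (∫⁻ z, g (u • z + (1 - u) • (j : ℝ) • h) ∂(unitBallMeasure n)) ^ q
        ∂(unitBallMeasure n) ≤
      (volume (Metric.ball (0 : EuclideanSpace ℝ (Fin n)) 1))⁻¹ ^ (q / p) * 2 ^ n *
        ENNReal.ofReal u ^ (-((n : ℝ) * (1 / p - 1 / q)) * q) * (∫⁻ z, g z ^ p) ^ (q / p) := by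
  have hp0 : 0 < p := by linarith
  have hq0 : 0 < q := by linarith
  have hqp : 0 ≤ q / p - 1 := by rw [sub_nonneg, one_le_div hp0]; exact hpq
  have hgp : Measurable fun z => g z ^ p := hg.pow_const p
  set N := ∫⁻ z, g z ^ p
  set V := (volume (Metric.ball (0 : EuclideanSpace ℝ (Fin n)) 1))⁻¹
  have jensen (h : EuclideanSpace ℝ (Fin n)) :
      (∫⁻ z, g (u • z + (1 - u) • (j : ℝ) • h) ∂(unitBallMeasure n)) ^ p ≤
        ∫⁻ z, g (u • z + (1 - u) • (j : ℝ) • h) ^ p ∂(unitBallMeasure n) := by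
    simpa using lintegral_rpow_le (unitBallMeasure n)
      (F := fun z => g (u • z + (1 - u) • (j : ℝ) • h)) (by fun_prop) hp
  have hD (h : EuclideanSpace ℝ (Fin n)) :
      (∫⁻ z, g (u • z + (1 - u) • (j : ℝ) • h) ∂(unitBallMeasure n)) ^ p ≤
        V * ((ENNReal.ofReal u ^ n)⁻¹ * N) :=
    (jensen h).trans (lintegral_unitBallMeasure_comp_smul_add_le hgp hu.1 _)
  have hm : Measurable fun h : EuclideanSpace ℝ (Fin n) =>
      ∫⁻ z, g (u • z + (1 - u) • (j : ℝ) • h) ∂(unitBallMeasure n) :=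
    Measurable.lintegral_prod_right' (f := fun w : EuclideanSpace ℝ (Fin n) × _ =>
      g (u • w.2 + (1 - u) • (j : ℝ) • w.1)) (by fun_prop)
  refine (lintegral_rpow_le_of_le _ hp0 hpq hD hm).trans ?_
  calc _ ≤ (V * ((ENNReal.ofReal u ^ n)⁻¹ * N)) ^ (q / p - 1) * (V * (2 ^ n * N)) := by
        gcongr
        exact (lintegral_mono jensen).trans (lintegral_lintegral_unitBallMeasure_le hj hgp hu)
    _ = (V ^ (q / p - 1) * V) * 2 ^ n * ((ENNReal.ofReal u ^ n)⁻¹) ^ (q / p - 1) *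
          (N ^ (q / p - 1) * N) := by
        rw [ENNReal.mul_rpow_of_nonneg _ _ hqp, ENNReal.mul_rpow_of_nonneg _ _ hqp]
        ring
    _ = _ := by
        have e (a : ℝ≥0∞) : a ^ (q / p - 1) * a = a ^ (q / p) := by
          conv_lhs => rw [← ENNReal.rpow_one a, ← ENNReal.rpow_mul, one_mul]
          rw [← ENNReal.rpow_add_of_nonneg _ _ hqp zero_le_one, sub_add_cancel]
        rw [e, e, ← ENNReal.rpow_natCast (ENNReal.ofReal u), ← ENNReal.rpow_neg, ← ENNReal.rpow_mul]
        congr 3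
        field_simp

lemma lintegral_ofReal_rpow_lt_top {b : ℝ} (hb : -1 < b) :
    ∫⁻ u in Ioc (0 : ℝ) 1, ENNReal.ofReal u ^ b < ∞ := by
  have h := (intervalIntegral.intervalIntegrable_rpow' (a := 0) (b := 1) hb).1
  have h2 := h.lintegral_lt_top
  refine lt_of_le_of_lt (le_of_eq ?_) h2
  refine setLIntegral_congr_fun measurableSet_Ioc fun u hu => ?_
  exact ENNReal.ofReal_rpow_of_pos hu.1

/-- Subcritical `L^p → L^q` bound for the averaged Taylor remainder. -/
lemma lintegral_remainder_rpow_le {n m j : ℕ} (hj : 1 ≤ j) {p q : ℝ} (hp : 1 ≤ p) (hpq : p ≤ q)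
    {g : EuclideanSpace ℝ (Fin n) → ℝ≥0∞} (hg : Measurable g) :
    ∫⁻ h, (∫⁻ u in Ioc (0 : ℝ) 1, ENNReal.ofReal u ^ m *
        ∫⁻ z, g (u • z + (1 - u) • (j : ℝ) • h) ∂(unitBallMeasure n)) ^ q
        ∂(unitBallMeasure n) ≤
      (∫⁻ u in Ioc (0 : ℝ) 1, ENNReal.ofReal u ^ ((m : ℝ) - n * (1 / p - 1 / q))) ^ q *
      ((volume (Metric.ball (0 : EuclideanSpace ℝ (Fin n)) 1))⁻¹ ^ (q / p) * 2 ^ n) *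
        (∫⁻ z, g z ^ p) ^ (q / p) := by
  have hp0 : 0 < p := by linarith
  have hq0 : 0 < q := by linarith
  set θ := (n : ℝ) * (1 / p - 1 / q) with hθ
  set V := (volume (Metric.ball (0 : EuclideanSpace ℝ (Fin n)) 1))⁻¹
  set N := ∫⁻ z, g z ^ p
  set M := ∫⁻ u in Ioc (0 : ℝ) 1, ENNReal.ofReal u ^ ((m : ℝ) - θ) with hM
  have hθ0 : 0 ≤ θ := by
    refine mul_nonneg (by positivity) (sub_nonneg.2 ?_)
    exact one_div_le_one_div_of_le hp0 hpq
  set A : EuclideanSpace ℝ (Fin n) → ℝ → ℝ≥0∞ := fun h u =>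
    ∫⁻ z, g (u • z + (1 - u) • (j : ℝ) • h) ∂(unitBallMeasure n) with hA
  have hAm : Measurable (Function.uncurry A) :=
    Measurable.lintegral_prod_right' (f := fun w : (EuclideanSpace ℝ (Fin n) × ℝ) × _ =>
      g (w.1.2 • w.2 + (1 - w.1.2) • (j : ℝ) • w.1.1)) (by fun_prop)
  have hAm' (h) : Measurable (A h) := hAm.comp (by fun_prop : Measurable fun u => (h, u))
  have step (h : EuclideanSpace ℝ (Fin n)) :
      (∫⁻ u in Ioc (0 : ℝ) 1, ENNReal.ofReal u ^ m * A h u) ^ q ≤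
      M ^ (q - 1) * ∫⁻ u in Ioc (0 : ℝ) 1, ENNReal.ofReal u ^ ((m : ℝ) - θ) *
        (ENNReal.ofReal u ^ θ * A h u) ^ q := by
    refine le_trans (le_of_eq ?_) (lintegral_mul_rpow_le (volume.restrict (Ioc (0 : ℝ) 1))
      (w := fun u => ENNReal.ofReal u ^ ((m : ℝ) - θ))
      (F := fun u => ENNReal.ofReal u ^ θ * A h u) (by fun_prop) (by fun_prop) (by linarith))
    congr 1
    refine setLIntegral_congr_fun measurableSet_Ioc fun u hu => ?_
    rw [← mul_assoc, ← ENNReal.rpow_add _ _ (by simpa using hu.1) ENNReal.ofReal_ne_top,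
      sub_add_cancel, ENNReal.rpow_natCast]
  calc _ ≤ ∫⁻ h, (M ^ (q - 1) * ∫⁻ u in Ioc (0 : ℝ) 1, ENNReal.ofReal u ^ ((m : ℝ) - θ) *
        (ENNReal.ofReal u ^ θ * A h u) ^ q) ∂(unitBallMeasure n) := lintegral_mono step
    _ = M ^ (q - 1) * ∫⁻ u in Ioc (0 : ℝ) 1, ENNReal.ofReal u ^ ((m : ℝ) - θ) *
        (ENNReal.ofReal u ^ (θ * q) * ∫⁻ h, A h u ^ q ∂(unitBallMeasure n)) := by
      rw [lintegral_const_mul, lintegral_lintegral_swap]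
      · congr 1
        refine lintegral_congr fun u => ?_
        have hAu : Measurable fun h => A h u := hAm.comp (by fun_prop : Measurable fun h => (h, u))
        rw [lintegral_const_mul _ (by fun_prop)]
        simp_rw [ENNReal.mul_rpow_of_nonneg _ _ hq0.le]
        rw [lintegral_const_mul _ (by fun_prop), ← ENNReal.rpow_mul]
      · have : Measurable fun w : EuclideanSpace ℝ (Fin n) × ℝ => A w.1 w.2 := hAm
        exact Measurable.aemeasurable (by
          change Measurable fun w : EuclideanSpace ℝ (Fin n) × ℝ =>
            ENNReal.ofReal w.2 ^ ((m : ℝ) - θ) * (ENNReal.ofReal w.2 ^ θ * A w.1 w.2) ^ q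
          fun_prop)
      · have : Measurable fun w : EuclideanSpace ℝ (Fin n) × ℝ => A w.1 w.2 := hAm
        exact Measurable.lintegral_prod_right' (f := fun w : EuclideanSpace ℝ (Fin n) × ℝ =>
            ENNReal.ofReal w.2 ^ ((m : ℝ) - θ) * (ENNReal.ofReal w.2 ^ θ * A w.1 w.2) ^ q)
          (by fun_prop)
    _ ≤ M ^ (q - 1) * ∫⁻ u in Ioc (0 : ℝ) 1, ENNReal.ofReal u ^ ((m : ℝ) - θ) *
        (V ^ (q / p) * 2 ^ n * N ^ (q / p)) := by
      gcongr M ^ (q - 1) * ?_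
      refine setLIntegral_mono' measurableSet_Ioc fun u hu => ?_
      refine mul_le_mul_right ?_ _
      refine (mul_le_mul_right (lintegral_average_rpow_le hj hp hpq hg hu) _).trans
        (le_of_eq ?_)
      rw [← hθ]
      have e : ENNReal.ofReal u ^ (θ * q) * ENNReal.ofReal u ^ (-θ * q) = 1 := by
        rw [← ENNReal.rpow_add _ _ (by simpa using hu.1) ENNReal.ofReal_ne_top]
        simp
      calc _ = (ENNReal.ofReal u ^ (θ * q) * ENNReal.ofReal u ^ (-θ * q)) *
            (V ^ (q / p) * 2 ^ n * N ^ (q / p)) := by ring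
        _ = _ := by rw [e, one_mul]
    _ = _ := by
      rw [lintegral_mul_const _ (by fun_prop), ← hM]
      have e : M ^ (q - 1) * M = M ^ q := by
        conv_lhs => rw [← ENNReal.rpow_one M, ← ENNReal.rpow_mul, one_mul]
        rw [← ENNReal.rpow_add_of_nonneg _ _ (by linarith) zero_le_one, sub_add_cancel]
      rw [← e]
      ring

lemma setAverage_ball_eq {n : ℕ} (G : EuclideanSpace ℝ (Fin n) → ℝ)
    (x : EuclideanSpace ℝ (Fin n)) {ρ : ℝ} (hρ : 0 < ρ) :
    ⨍ y in Metric.ball x ρ, G y = ∫ z, G (x + ρ • z) ∂(unitBallMeasure n) := by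
  have h1 := Measure.setIntegral_comp_smul_of_pos volume (fun y => G (x + y))
    (Metric.ball (0 : EuclideanSpace ℝ (Fin n)) 1) hρ
  have h2 : ∫ y in Metric.ball (0 : EuclideanSpace ℝ (Fin n)) ρ, G (x + y) =
      ∫ y in Metric.ball x ρ, G y := by
    rw [← (measurePreserving_add_left volume x).setIntegral_preimage_emb
      (measurableEmbedding_addLeft x) G (Metric.ball x ρ)]
    simp
  rw [smul_unitBall_of_pos hρ, h2, finrank_euclideanSpace_fin] at h1
  rw [setAverage_eq, unitBallMeasure, integral_smul_measure, h1, measureReal_def,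
    Measure.addHaar_ball_of_pos _ _ hρ, finrank_euclideanSpace_fin, smul_smul,
    ENNReal.toReal_mul, ENNReal.toReal_ofReal (by positivity), mul_inv, ENNReal.toReal_inv,
    mul_comm]

lemma exists_lintegral_indicator_rpow_le (n m : ℕ) {p : ℝ} (hp : 1 ≤ p) :
    ∃ W : ℝ≥0∞, W ≠ ∞ ∧ ∀ g : EuclideanSpace ℝ (Fin n) → ℝ≥0∞, Measurable g →
      ∫⁻ z, ((Metric.ball 0 ((m : ℝ) + 1)).indicator g z) ^ p ≤
        W * ∫⁻ t in Ioc (0 : ℝ) ((m : ℝ) + 2), ∫⁻ z, g (t • z) ^ p ∂(unitBallMeasure n) := by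
  refine ⟨volume (Metric.ball (0 : EuclideanSpace ℝ (Fin n)) 1) *
    ENNReal.ofReal ((m : ℝ) + 2) ^ n,
    ENNReal.mul_ne_top (unitBall_volume_ne_top n) (by simp), fun g hg => ?_⟩
  have hp0 : 0 < p := by linarith
  set F : EuclideanSpace ℝ (Fin n) → ℝ≥0∞ :=
    fun z => ((Metric.ball 0 ((m : ℝ) + 1)).indicator g z) ^ p
  have hF : Measurable F := (hg.indicator measurableSet_ball).pow_const p
  set V := volume (Metric.ball (0 : EuclideanSpace ℝ (Fin n)) 1)
  set T := ENNReal.ofReal ((m : ℝ) + 2) ^ n with hT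
  have hT0 : T ≠ 0 := pow_ne_zero _ (by simp; positivity)
  have hTt : T ≠ ∞ := by simp [hT]
  have lower : ∀ t ∈ Ioc ((m : ℝ) + 1) ((m : ℝ) + 2), V⁻¹ * (T⁻¹ * ∫⁻ z, F z) ≤
      ∫⁻ z, g (t • z) ^ p ∂(unitBallMeasure n) := by
    intro t ht
    have ht0 : 0 < t := lt_of_le_of_lt (by positivity) ht.1
    rw [unitBallMeasure, lintegral_smul_measure, smul_eq_mul]
    refine mul_le_mul_right ?_ _
    calc T⁻¹ * ∫⁻ z, F z ≤ (ENNReal.ofReal t ^ n)⁻¹ * ∫⁻ z, F z := by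
          gcongr
          exact pow_le_pow_left' (ENNReal.ofReal_le_ofReal ht.2) n
      _ = ∫⁻ z, F (t • z) := by simpa using (lintegral_comp_smul_add hF ht0 0).symm
      _ ≤ ∫⁻ z, (Metric.ball 0 1).indicator (fun z => g (t • z) ^ p) z := by
          refine lintegral_mono fun z => ?_
          by_cases hz : t • z ∈ Metric.ball (0 : EuclideanSpace ℝ (Fin n)) ((m : ℝ) + 1)
          · have hz1 : z ∈ Metric.ball (0 : EuclideanSpace ℝ (Fin n)) 1 := by
              rw [mem_ball_zero_iff, norm_smul, Real.norm_of_nonneg ht0.le] at hz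
              rw [mem_ball_zero_iff]
              by_contra! h
              nlinarith [ht.1]
            simp [F, hz, hz1]
          · simp [F, hz, hp0]
      _ = _ := lintegral_indicator measurableSet_ball _
  have hI : V⁻¹ * (T⁻¹ * ∫⁻ z, F z) ≤
      ∫⁻ t in Ioc (0 : ℝ) ((m : ℝ) + 2), ∫⁻ z, g (t • z) ^ p ∂(unitBallMeasure n) := by
    calc V⁻¹ * (T⁻¹ * ∫⁻ z, F z)
        = ∫⁻ _ in Ioc ((m : ℝ) + 1) ((m : ℝ) + 2), V⁻¹ * (T⁻¹ * ∫⁻ z, F z) := by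
          rw [setLIntegral_const, Real.volume_Ioc]
          norm_num
      _ ≤ ∫⁻ t in Ioc ((m : ℝ) + 1) ((m : ℝ) + 2),
            ∫⁻ z, g (t • z) ^ p ∂(unitBallMeasure n) := setLIntegral_mono' measurableSet_Ioc lower
      _ ≤ _ := lintegral_mono_set (Ioc_subset_Ioc_left (by positivity))
  calc ∫⁻ z, F z = (V * V⁻¹) * (T * T⁻¹) * ∫⁻ z, F z := by
        rw [ENNReal.mul_inv_cancel (unitBall_volume_ne_zero n) (unitBall_volume_ne_top n),
          ENNReal.mul_inv_cancel hT0 hTt, one_mul, one_mul]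
    _ = V * T * (V⁻¹ * (T⁻¹ * ∫⁻ z, F z)) := by ring
    _ ≤ _ := mul_le_mul_right hI _

/-- Bound for every term of the averaged Taylor remainder, including the one at the centre. -/
lemma exists_remainder_bound (n m : ℕ) {p q : ℝ} (hp : 1 ≤ p) (hpq : p ≤ q)
    (hθ : (n : ℝ) * (1 / p - 1 / q) < m + 1) :
    ∃ K : ℝ≥0∞, K ≠ ∞ ∧ ∀ g : EuclideanSpace ℝ (Fin n) → ℝ≥0∞, Measurable g → ∀ j ≤ m + 1,
      ∫⁻ h, (∫⁻ u in Ioc (0 : ℝ) 1, ENNReal.ofReal u ^ m *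
        ∫⁻ z, g (u • z + (1 - u) • (j : ℝ) • h) ∂(unitBallMeasure n)) ^ q
        ∂(unitBallMeasure n) ≤
      K * (∫⁻ t in Ioc (0 : ℝ) ((m : ℝ) + 2), ∫⁻ z, g (t • z) ^ p ∂(unitBallMeasure n)) ^ (q / p)
      := by
  have hp0 : 0 < p := by linarith
  have hq0 : 0 < q := by linarith
  have hqp : 0 ≤ q / p := by positivity
  obtain ⟨W, hW, hWg⟩ := exists_lintegral_indicator_rpow_le n m hp
  set K₀ := (∫⁻ u in Ioc (0 : ℝ) 1, ENNReal.ofReal u ^ ((m : ℝ) - n * (1 / p - 1 / q))) ^ q *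
      ((volume (Metric.ball (0 : EuclideanSpace ℝ (Fin n)) 1))⁻¹ ^ (q / p) * 2 ^ n) with hK₀
  have hK₀t : K₀ ≠ ∞ := by
    refine ENNReal.mul_ne_top (ENNReal.rpow_ne_top_of_nonneg hq0.le
      (lintegral_ofReal_rpow_lt_top (by linarith)).ne) (ENNReal.mul_ne_top
        (ENNReal.rpow_ne_top_of_nonneg hqp (ENNReal.inv_ne_top.2 (unitBall_volume_ne_zero n)))
        (by simp))
  refine ⟨1 + K₀ * W ^ (q / p), ENNReal.add_ne_top.2 ⟨ENNReal.one_ne_top,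
    ENNReal.mul_ne_top hK₀t (ENNReal.rpow_ne_top_of_nonneg hqp hW)⟩, fun g hg j hj => ?_⟩
  set I := ∫⁻ t in Ioc (0 : ℝ) ((m : ℝ) + 2), ∫⁻ z, g (t • z) ^ p ∂(unitBallMeasure n)
  rw [add_mul, one_mul]
  rcases Nat.eq_zero_or_pos j with rfl | hj0
  · refine le_trans ?_ (le_add_right le_rfl)
    have hm : Measurable fun u : ℝ => ∫⁻ z, g (u • z) ∂(unitBallMeasure n) :=
      Measurable.lintegral_prod_right' (f := fun w : ℝ × EuclideanSpace ℝ (Fin n) =>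
        g (w.1 • w.2)) (by fun_prop)
    have h1 : (∫⁻ u in Ioc (0 : ℝ) 1, ∫⁻ z, g (u • z) ∂(unitBallMeasure n)) ^ p ≤ I := by
      refine (lintegral_rpow_le _ hm hp).trans ?_
      simp only [Measure.restrict_apply_univ, Real.volume_Ioc, sub_zero, ENNReal.ofReal_one,
        ENNReal.one_rpow, one_mul]
      refine le_trans (lintegral_mono fun u => ?_)
        (lintegral_mono_set (Ioc_subset_Ioc_right (by linarith [(m.cast_nonneg : (0 : ℝ) ≤ m)])))
      simpa using lintegral_rpow_le (unitBallMeasure n) (F := fun z => g (u • z)) (by fun_prop) hp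
    have h2 : (∫⁻ u in Ioc (0 : ℝ) 1, ENNReal.ofReal u ^ m *
        ∫⁻ z, g (u • z) ∂(unitBallMeasure n)) ^ q ≤ I ^ (q / p) := by
      calc _ ≤ (∫⁻ u in Ioc (0 : ℝ) 1, ∫⁻ z, g (u • z) ∂(unitBallMeasure n)) ^ q := by
            refine ENNReal.rpow_le_rpow (setLIntegral_mono' measurableSet_Ioc fun u hu => ?_)
              hq0.le
            exact mul_le_of_le_one_left' (pow_le_one' (ENNReal.ofReal_le_one.2 hu.2) m)
        _ = ((∫⁻ u in Ioc (0 : ℝ) 1, ∫⁻ z, g (u • z) ∂(unitBallMeasure n)) ^ p) ^ (q / p) := by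
            rw [← ENNReal.rpow_mul, mul_div_cancel₀ _ hp0.ne']
        _ ≤ _ := ENNReal.rpow_le_rpow h1 hqp
    simpa using h2
  · refine le_trans ?_ (le_add_left le_rfl)
    have hgi : Measurable ((Metric.ball (0 : EuclideanSpace ℝ (Fin n)) ((m : ℝ) + 1)).indicator g) :=
      hg.indicator measurableSet_ball
    have h1 := lintegral_remainder_rpow_le (m := m) hj0 hp hpq hgi
    rw [← hK₀] at h1
    calc _ ≤ _ := ?_
      _ ≤ _ := h1
      _ ≤ K₀ * (W * I) ^ (q / p) := by gcongr; exact hWg g hg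
      _ = _ := by rw [ENNReal.mul_rpow_of_nonneg _ _ hqp, ← mul_assoc]
    refine lintegral_mono_ae ?_
    filter_upwards [ae_unitBallMeasure n] with h hh
    refine ENNReal.rpow_le_rpow (setLIntegral_mono' measurableSet_Ioc fun u hu => ?_) hq0.le
    refine mul_le_mul_right (lintegral_mono_ae ?_) _
    filter_upwards [ae_unitBallMeasure n] with z hz
    rw [indicator_of_mem]
    rw [mem_ball_zero_iff] at hh hz ⊢
    have hj' : (j : ℝ) ≤ m + 1 := by exact_mod_cast hj
    have hj0' : (1 : ℝ) ≤ j := by exact_mod_cast hj0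
    have hu1 : 0 ≤ 1 - u := by linarith [hu.2]
    calc ‖u • z + (1 - u) • (j : ℝ) • h‖ ≤ u * ‖z‖ + (1 - u) * (j * ‖h‖) := by
          refine (norm_add_le _ _).trans (le_of_eq ?_)
          rw [norm_smul, norm_smul, norm_smul, Real.norm_of_nonneg hu.1.le,
            Real.norm_of_nonneg hu1, Real.norm_of_nonneg (by positivity)]
      _ < u * 1 + (1 - u) * (j * 1) := by
          refine add_lt_add_of_lt_of_le (mul_lt_mul_of_pos_left hz hu.1) ?_
          gcongr
      _ ≤ _ := by nlinarith [hu.1]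

/-- The estimate for any function dominated by Taylor remainders based at arbitrary points of the
unit ball. -/
lemma exists_lintegral_rpow_le_of_remainder_bound (n m : ℕ) {p q : ℝ} (hp : 1 ≤ p) (hpq : p ≤ q)
    (hθ : (n : ℝ) * (1 / p - 1 / q) < m + 1) :
    ∃ K : ℝ≥0∞, K ≠ ∞ ∧ ∀ (g D : EuclideanSpace ℝ (Fin n) → ℝ≥0∞) (c : ℝ≥0∞), Measurable g →
      (∀ h ∈ Metric.ball (0 : EuclideanSpace ℝ (Fin n)) 1,
        ∀ z ∈ Metric.ball (0 : EuclideanSpace ℝ (Fin n)) 1,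
        D h ≤ ∑ j ∈ Finset.range (m + 1 + 1), ((m + 1).choose j : ℝ≥0∞) *
          ∫⁻ u in Ioc (0 : ℝ) 1, ENNReal.ofReal u ^ m *
            (g (u • z + (1 - u) • (j : ℝ) • h) * c)) →
      ∫⁻ h, D h ^ q ∂(unitBallMeasure n) ≤ K * c ^ q *
        (∫⁻ t in Ioc (0 : ℝ) ((m : ℝ) + 2), ∫⁻ z, g (t • z) ^ p ∂(unitBallMeasure n)) ^ (q / p)
      := by
  have hq0 : 0 < q := by linarith
  obtain ⟨K, hK, hKg⟩ := exists_remainder_bound n m hp hpq hθ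
  refine ⟨((m + 1 + 1 : ℕ) : ℝ≥0∞) ^ (q - 1) *
    ∑ j ∈ Finset.range (m + 1 + 1), ((m + 1).choose j : ℝ≥0∞) ^ q * K, ?_, ?_⟩
  · refine ENNReal.mul_ne_top (ENNReal.rpow_ne_top_of_nonneg (by linarith) (by simp)) ?_
    exact ENNReal.sum_ne_top.2 fun j _ => ENNReal.mul_ne_top
      (ENNReal.rpow_ne_top_of_nonneg hq0.le (by simp)) hK
  intro g D c hg hD
  set I := ∫⁻ t in Ioc (0 : ℝ) ((m : ℝ) + 2), ∫⁻ z, g (t • z) ^ p ∂(unitBallMeasure n)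
  set S : ℕ → EuclideanSpace ℝ (Fin n) → ℝ≥0∞ := fun j h =>
    ∫⁻ u in Ioc (0 : ℝ) 1, ENNReal.ofReal u ^ m *
      ∫⁻ z, g (u • z + (1 - u) • (j : ℝ) • h) ∂(unitBallMeasure n) with hS
  have hSm (j : ℕ) : Measurable (S j) := by
    have hA : Measurable fun w : EuclideanSpace ℝ (Fin n) × ℝ =>
        ∫⁻ z, g (w.2 • z + (1 - w.2) • (j : ℝ) • w.1) ∂(unitBallMeasure n) :=
      Measurable.lintegral_prod_right' (f := fun w : (EuclideanSpace ℝ (Fin n) × ℝ) × _ =>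
        g (w.1.2 • w.2 + (1 - w.1.2) • (j : ℝ) • w.1.1)) (by fun_prop)
    exact Measurable.lintegral_prod_right' (f := fun w : EuclideanSpace ℝ (Fin n) × ℝ =>
      ENNReal.ofReal w.2 ^ m *
        ∫⁻ z, g (w.2 • z + (1 - w.2) • (j : ℝ) • w.1) ∂(unitBallMeasure n)) (by fun_prop)
  have averaged : ∀ h ∈ Metric.ball (0 : EuclideanSpace ℝ (Fin n)) 1,
      D h ≤ ∑ j ∈ Finset.range (m + 1 + 1), ((m + 1).choose j : ℝ≥0∞) * (c * S j h) := by
    intro h hh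
    have hm (j : ℕ) : Measurable fun w : EuclideanSpace ℝ (Fin n) × ℝ =>
        ENNReal.ofReal w.2 ^ m * (g (w.2 • w.1 + (1 - w.2) • (j : ℝ) • h) * c) := by fun_prop
    calc D h = ∫⁻ _, D h ∂(unitBallMeasure n) := by simp
      _ ≤ ∫⁻ z, ∑ j ∈ Finset.range (m + 1 + 1), ((m + 1).choose j : ℝ≥0∞) *
          (∫⁻ u in Ioc (0 : ℝ) 1, ENNReal.ofReal u ^ m *
            (g (u • z + (1 - u) • (j : ℝ) • h) * c)) ∂(unitBallMeasure n) := by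
          refine lintegral_mono_ae ?_
          filter_upwards [ae_unitBallMeasure n] with z hz using hD h hh z hz
      _ = _ := by
          rw [lintegral_finsetSum _ fun j _ => (hm j).lintegral_prod_right'.const_mul _]
          refine Finset.sum_congr rfl fun j _ => ?_
          rw [lintegral_const_mul _ (hm j).lintegral_prod_right',
            lintegral_lintegral_swap (hm j).aemeasurable]
          congr 1
          have hA : Measurable fun u : ℝ =>
              ∫⁻ z, g (u • z + (1 - u) • (j : ℝ) • h) ∂(unitBallMeasure n) :=
            Measurable.lintegral_prod_right' (f := fun w : ℝ × EuclideanSpace ℝ (Fin n) =>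
              g (w.1 • w.2 + (1 - w.1) • (j : ℝ) • h)) (by fun_prop)
          rw [hS, ← lintegral_const_mul _ (by fun_prop)]
          refine lintegral_congr fun u => ?_
          dsimp only
          rw [lintegral_const_mul _ (by fun_prop), lintegral_mul_const _ (by fun_prop)]
          ring
  have powered : ∀ h ∈ Metric.ball (0 : EuclideanSpace ℝ (Fin n)) 1,
      D h ^ q ≤ ((m + 1 + 1 : ℕ) : ℝ≥0∞) ^ (q - 1) * ∑ j ∈ Finset.range (m + 1 + 1),
        ((m + 1).choose j : ℝ≥0∞) ^ q * (c ^ q * S j h ^ q) := by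
    intro h hh
    refine (ENNReal.rpow_le_rpow (averaged h hh) hq0.le).trans ?_
    refine (ENNReal.rpow_sum_le_const_mul_sum_rpow _ _ (by linarith)).trans (le_of_eq ?_)
    simp only [Finset.card_range, ENNReal.mul_rpow_of_nonneg _ _ hq0.le]
  calc _ ≤ ∫⁻ h, (((m + 1 + 1 : ℕ) : ℝ≥0∞) ^ (q - 1) * ∑ j ∈ Finset.range (m + 1 + 1),
        ((m + 1).choose j : ℝ≥0∞) ^ q * (c ^ q * S j h ^ q)) ∂(unitBallMeasure n) := by
        refine lintegral_mono_ae ?_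
        filter_upwards [ae_unitBallMeasure n] with h hh using powered h hh
    _ = ((m + 1 + 1 : ℕ) : ℝ≥0∞) ^ (q - 1) * ∑ j ∈ Finset.range (m + 1 + 1),
        ((m + 1).choose j : ℝ≥0∞) ^ q * (c ^ q * ∫⁻ h, S j h ^ q ∂(unitBallMeasure n)) := by
        have (j : ℕ) := hSm j
        rw [lintegral_const_mul _ (by fun_prop), lintegral_finsetSum _ fun j _ => by fun_prop]
        congr 1
        refine Finset.sum_congr rfl fun j _ => ?_
        rw [lintegral_const_mul _ (by fun_prop), lintegral_const_mul _ (by fun_prop)]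
    _ ≤ ((m + 1 + 1 : ℕ) : ℝ≥0∞) ^ (q - 1) * ∑ j ∈ Finset.range (m + 1 + 1),
        ((m + 1).choose j : ℝ≥0∞) ^ q * (c ^ q * (K * I ^ (q / p))) := by
        refine mul_le_mul_right (Finset.sum_le_sum fun j hj => ?_) _
        refine mul_le_mul_right (mul_le_mul_right (hKg g hg j ?_) _) _
        exact Nat.lt_succ_iff.1 (Finset.mem_range.1 hj)
    _ = _ := by
        rw [mul_assoc, mul_assoc, Finset.sum_mul]
        congr 1
        refine Finset.sum_congr rfl fun j _ => by ring

/-- The same estimate in norm form, for arbitrary subcritical exponents. -/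
lemma exists_lintegral_rpow_one_div_le (n m : ℕ) {p q : ℝ} (hp : 1 ≤ p) (hq : 1 ≤ q)
    (hθ : (n : ℝ) * (1 / p - 1 / q) < m + 1) :
    ∃ K : ℝ≥0∞, K ≠ ∞ ∧ ∀ (g D : EuclideanSpace ℝ (Fin n) → ℝ≥0∞) (c : ℝ≥0∞), Measurable g →
      Measurable D →
      (∀ h ∈ Metric.ball (0 : EuclideanSpace ℝ (Fin n)) 1,
        ∀ z ∈ Metric.ball (0 : EuclideanSpace ℝ (Fin n)) 1,
        D h ≤ ∑ j ∈ Finset.range (m + 1 + 1), ((m + 1).choose j : ℝ≥0∞) *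
          ∫⁻ u in Ioc (0 : ℝ) 1, ENNReal.ofReal u ^ m *
            (g (u • z + (1 - u) • (j : ℝ) • h) * c)) →
      (∫⁻ h, D h ^ q ∂(unitBallMeasure n)) ^ (1 / q) ≤ K * c *
        (∫⁻ t in Ioc (0 : ℝ) ((m : ℝ) + 2), ∫⁻ z, g (t • z) ^ p ∂(unitBallMeasure n)) ^ (1 / p)
      := by
  have hp0 : 0 < p := by linarith
  set Q := max p q with hQ
  have hQ0 : 0 < Q := lt_max_of_lt_left hp0
  have hθQ : (n : ℝ) * (1 / p - 1 / Q) < m + 1 := by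
    rcases le_total p q with h | h
    · rwa [hQ, max_eq_right h]
    · rw [hQ, max_eq_left h, sub_self, mul_zero]
      positivity
  obtain ⟨K, hK, hKg⟩ :=
    exists_lintegral_rpow_le_of_remainder_bound n m hp (le_max_left p q) hθQ
  refine ⟨K ^ (1 / Q), ENNReal.rpow_ne_top_of_nonneg (by positivity) hK,
    fun g D c hg hDm hD => ?_⟩
  have h1 := eLpNorm'_le_eLpNorm'_of_exponent_le (by linarith) (le_max_right p q)
    (unitBallMeasure n) hDm.aestronglyMeasurable
  simp only [eLpNorm', enorm_eq_self] at h1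
  refine h1.trans ((ENNReal.rpow_le_rpow (hKg g D c hg hD) (by positivity)).trans (le_of_eq ?_))
  rw [ENNReal.mul_rpow_of_nonneg _ _ (by positivity), ENNReal.mul_rpow_of_nonneg _ _ (by positivity),
    ← ENNReal.rpow_mul, ← ENNReal.rpow_mul, ← hQ, mul_one_div_cancel hQ0.ne', ENNReal.rpow_one]
  congr 2
  field_simp

lemma integrable_unitBallMeasure {n : ℕ} {G : EuclideanSpace ℝ (Fin n) → ℝ}
    (hG : Continuous G) : Integrable G (unitBallMeasure n) := by
  refine Integrable.smul_measure ?_ (ENNReal.inv_ne_top.2 (unitBall_volume_ne_zero n))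
  exact (hG.continuousOn.integrableOn_compact (isCompact_closedBall 0 1)).mono_set
    Metric.ball_subset_closedBall

lemma ofReal_integral_integral_unitBallMeasure {n : ℕ} {G : EuclideanSpace ℝ (Fin n) → ℝ}
    (hG : Continuous G) (hG0 : ∀ w, 0 ≤ G w) {T : ℝ} (hT : 0 ≤ T) :
    ENNReal.ofReal (∫ t in (0 : ℝ)..T, ∫ z, G (t • z) ∂(unitBallMeasure n)) =
      ∫⁻ t in Ioc (0 : ℝ) T, ∫⁻ z, ENNReal.ofReal (G (t • z)) ∂(unitBallMeasure n) := by
  obtain ⟨B, hB⟩ := (isCompact_closedBall (0 : EuclideanSpace ℝ (Fin n)) T).exists_bound_of_continuousOn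
    hG.continuousOn
  have hm : StronglyMeasurable fun t : ℝ => ∫ z, G (t • z) ∂(unitBallMeasure n) :=
    StronglyMeasurable.integral_prod_right' (f := fun w : ℝ × EuclideanSpace ℝ (Fin n) =>
      G (w.1 • w.2)) (by fun_prop : Continuous _).stronglyMeasurable
  rw [intervalIntegral.integral_of_le hT, ofReal_integral_eq_lintegral_ofReal]
  · refine lintegral_congr fun t => ?_
    exact ofReal_integral_eq_lintegral_ofReal (integrable_unitBallMeasure (by fun_prop))
      (.of_forall fun z => hG0 _)
  · refine Integrable.of_bound hm.aestronglyMeasurable B ?_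
    filter_upwards [ae_restrict_mem measurableSet_Ioc] with t ht
    have h := norm_integral_le_of_norm_le_const (μ := unitBallMeasure n)
      (f := fun z => G (t • z)) (C := B) ?_
    · simpa using h
    · filter_upwards [ae_unitBallMeasure n] with z hz
      refine hB _ ?_
      rw [mem_ball_zero_iff] at hz
      rw [mem_closedBall_zero_iff, norm_smul, Real.norm_of_nonneg ht.1.le]
      nlinarith [ht.1, ht.2, norm_nonneg z]
  · exact .of_forall fun t => integral_nonneg fun z => hG0 _

lemma ofReal_abs_kdiff_le {n m : ℕ} {f : EuclideanSpace ℝ (Fin n) → ℝ}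
    (hf : ContDiff ℝ (⊤ : ℕ∞) f) {r : ℝ} (hr : 0 < r) (x : EuclideanSpace ℝ (Fin n))
    {h z : EuclideanSpace ℝ (Fin n)} (hh : h ∈ Metric.ball (0 : EuclideanSpace ℝ (Fin n)) 1)
    (hz : z ∈ Metric.ball (0 : EuclideanSpace ℝ (Fin n)) 1) :
    ENNReal.ofReal |kdiff (m + 1) f (r • h) x| ≤
      ∑ j ∈ Finset.range (m + 1 + 1), ((m + 1).choose j : ℝ≥0∞) *
        ∫⁻ u in Ioc (0 : ℝ) 1, ENNReal.ofReal u ^ m *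
          (ENNReal.ofReal
            ‖iteratedFDeriv ℝ (m + 1) f (x + r • (u • z + (1 - u) • (j : ℝ) • h))‖ *
            ENNReal.ofReal ((r * (m + 2)) ^ (m + 1))) := by
  have hc : Continuous (iteratedFDeriv ℝ (m + 1) f) :=
    hf.continuous_iteratedFDeriv (by exact_mod_cast le_top)
  refine (ENNReal.ofReal_le_ofReal (abs_kdiff_le hf (r • h) x (x + r • z))).trans ?_
  rw [ENNReal.ofReal_sum_of_nonneg fun j _ => mul_nonneg (by positivity)
    (intervalIntegral.integral_nonneg zero_le_one fun u hu =>
      mul_nonneg (pow_nonneg hu.1 _) (by positivity))]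
  refine Finset.sum_le_sum fun j hj => ?_
  rw [ENNReal.ofReal_mul (by positivity), ENNReal.ofReal_natCast]
  refine mul_le_mul_right ?_ _
  rw [intervalIntegral.integral_of_le zero_le_one, ofReal_integral_eq_lintegral_ofReal]
  · refine setLIntegral_mono' measurableSet_Ioc fun u hu => ?_
    rw [ENNReal.ofReal_mul (pow_nonneg hu.1.le _), ENNReal.ofReal_pow hu.1.le,
      ENNReal.ofReal_mul (norm_nonneg _)]
    have e : x + r • z + (1 - u) • (x + j • r • h - (x + r • z)) =
        x + r • (u • z + (1 - u) • (j : ℝ) • h) := by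
      rw [← Nat.cast_smul_eq_nsmul ℝ]
      module
    rw [e]
    gcongr
    have e2 : x + j • r • h - (x + r • z) = r • ((j : ℝ) • h - z) := by
      rw [← Nat.cast_smul_eq_nsmul ℝ]
      module
    rw [e2, norm_smul, Real.norm_of_nonneg hr.le]
    rw [mem_ball_zero_iff] at hh hz
    have hj' : (j : ℝ) ≤ m + 1 := by exact_mod_cast Nat.lt_succ_iff.1 (Finset.mem_range.1 hj)
    gcongr
    refine (norm_sub_le _ _).trans ?_
    rw [norm_smul, Real.norm_natCast]
    nlinarith [norm_nonneg h, (j.cast_nonneg : (0 : ℝ) ≤ j)]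
  · refine (Continuous.intervalIntegrable ?_ 0 1).1
    fun_prop
  · filter_upwards [ae_restrict_mem measurableSet_Ioc] with u hu
    exact mul_nonneg (pow_nonneg hu.1.le _) (by positivity)

/-- Lemma 2.5: pointwise estimate for averages of higher-order differences. -/
theorem statement1 (n k : ℕ) (hn : 0 < n) (hk : 0 < k) (p q : ℝ)
    (hp : 1 ≤ p) (hq : 1 ≤ q) (hpq : (n : ℝ) * (1 / p - 1 / q) < (k : ℝ)) :
    ∃ C : ℝ, 0 < C ∧ ∀ f : EuclideanSpace ℝ (Fin n) → ℝ, ContDiff ℝ (⊤ : ℕ∞) f →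
      ∀ r : ℝ, 0 < r → ∀ x : EuclideanSpace ℝ (Fin n),
        (⨍ h in Metric.ball (0 : EuclideanSpace ℝ (Fin n)) r,
            |kdiff k f h x| ^ q) ^ (1 / q) ≤
          C * r ^ (k : ℝ) *
            (∫ t in (0 : ℝ)..((k : ℝ) + 1),
              ⨍ y in Metric.ball x (t * r), ‖iteratedFDeriv ℝ k f y‖ ^ p) ^ (1 / p) := by
  obtain ⟨m, rfl⟩ : ∃ m, k = m + 1 := ⟨k - 1, by omega⟩
  have hp0 : 0 < p := by linarith
  have hq0 : 0 < q := by linarith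
  obtain ⟨K, hK, hKg⟩ := exists_lintegral_rpow_one_div_le n m hp hq (by simpa using hpq)
  refine ⟨K.toReal * (m + 2) ^ (m + 1) + 1, by positivity, fun f hf r hr x => ?_⟩
  have hc : Continuous (iteratedFDeriv ℝ (m + 1) f) :=
    hf.continuous_iteratedFDeriv (by exact_mod_cast le_top)
  have hkc : Continuous fun h => kdiff (m + 1) f (r • h) x := by
    have := hf.continuous
    unfold kdiff
    fun_prop
  set G : EuclideanSpace ℝ (Fin n) → ℝ := fun w => ‖iteratedFDeriv ℝ (m + 1) f (x + r • w)‖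
  have hG : Continuous G := by fun_prop
  have hG0 (w) : 0 ≤ G w := norm_nonneg _
  have hlhs : (⨍ h in Metric.ball (0 : EuclideanSpace ℝ (Fin n)) r,
      |kdiff (m + 1) f h x| ^ q) = ∫ h, |kdiff (m + 1) f (r • h) x| ^ q ∂(unitBallMeasure n) := by
    rw [setAverage_ball_eq _ _ hr]
    simp
  have hT : (0 : ℝ) ≤ ((m + 1 : ℕ) : ℝ) + 1 := by positivity
  have hrhs : (∫ t in (0 : ℝ)..(((m + 1 : ℕ) : ℝ) + 1),
      ⨍ y in Metric.ball x (t * r), ‖iteratedFDeriv ℝ (m + 1) f y‖ ^ p) =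
      ∫ t in (0 : ℝ)..(((m + 1 : ℕ) : ℝ) + 1), ∫ z, G (t • z) ^ p ∂(unitBallMeasure n) := by
    rw [intervalIntegral.integral_of_le hT, intervalIntegral.integral_of_le hT]
    refine setIntegral_congr_fun measurableSet_Ioc fun t ht => ?_
    rw [setAverage_ball_eq _ _ (mul_pos ht.1 hr)]
    simp only [G, smul_smul, mul_comm]
  rw [hlhs, hrhs]
  set X := ∫ h, |kdiff (m + 1) f (r • h) x| ^ q ∂(unitBallMeasure n)
  set Y := ∫ t in (0 : ℝ)..(((m + 1 : ℕ) : ℝ) + 1), ∫ z, G (t • z) ^ p ∂(unitBallMeasure n)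
  have hX0 : 0 ≤ X := integral_nonneg fun h => by positivity
  have hY0 : 0 ≤ Y := intervalIntegral.integral_nonneg hT fun t _ =>
    integral_nonneg fun z => Real.rpow_nonneg (hG0 _) _
  have hX : ENNReal.ofReal X =
      ∫⁻ h, ENNReal.ofReal |kdiff (m + 1) f (r • h) x| ^ q ∂(unitBallMeasure n) := by
    rw [ofReal_integral_eq_lintegral_ofReal
      (integrable_unitBallMeasure (hkc.abs.rpow_const fun _ => Or.inr hq0.le))
      (.of_forall fun h => by positivity)]
    exact lintegral_congr fun h => (ENNReal.ofReal_rpow_of_nonneg (abs_nonneg _) hq0.le).symm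
  have hY : ENNReal.ofReal Y = ∫⁻ t in Ioc (0 : ℝ) ((m : ℝ) + 2),
      ∫⁻ z, ENNReal.ofReal (G (t • z)) ^ p ∂(unitBallMeasure n) := by
    rw [ofReal_integral_integral_unitBallMeasure (G := fun w => G w ^ p)
      (hG.rpow_const fun _ => Or.inr hp0.le) (fun w => Real.rpow_nonneg (hG0 _) _) hT]
    have : ((m + 1 : ℕ) : ℝ) + 1 = m + 2 := by push_cast; ring
    rw [this]
    simp_rw [ENNReal.ofReal_rpow_of_nonneg (hG0 _) hp0.le]
  have key := hKg (fun w => ENNReal.ofReal (G w))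
    (fun h => ENNReal.ofReal |kdiff (m + 1) f (r • h) x|)
    (ENNReal.ofReal ((r * (m + 2)) ^ (m + 1))) (by fun_prop)
    (hkc.abs.measurable.ennreal_ofReal)
    fun h hh z hz => ofReal_abs_kdiff_le hf hr x hh hz
  rw [← hX, ← hY, ← ENNReal.ofReal_toReal hK,
    ENNReal.ofReal_rpow_of_nonneg hX0 (by positivity),
    ENNReal.ofReal_rpow_of_nonneg hY0 (by positivity),
    ← ENNReal.ofReal_mul (by positivity), ← ENNReal.ofReal_mul (by positivity),
    ENNReal.ofReal_le_ofReal_iff (by positivity)] at key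
  refine key.trans ?_
  rw [Real.rpow_natCast, mul_pow]
  refine mul_le_mul_of_nonneg_right ?_ (by positivity)
  nlinarith [pow_pos hr (m + 1)]

end
end

section
/- Let $k\in\mathbb{N}$, $\omega\in A_1$, $p=1$, and $q\in[1,\infty)$ satisfy $n(1-\frac{1}{q})<k$. Then there exists a constant $C>0$, depending only on $n,k,q$, such that for any $s\in(0,1)$, $r\in(0,\infty)$, and $f\in \dot{W}^{k,1}_\omega(\mathbb{R}^n)$, $(1-s)\int_{\mathbb{R}^n}\left(\int_{B(\mathbf{0},r)}\frac{|\Delta_h^k f(x)|^q}{|h|^{n+skq}}\,dh\right)^{1/q}\omega(x)\,dx \le C\,[\omega]_{A_1}\, r^{(1-s)k}\int_{\mathbb{R}^n}|\nabla^k f(x)|\,\omega(x)\,dx$. -/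
open MeasureTheory Real Set
open scoped Classical ENNReal

noncomputable section

open Paper

namespace Paper

variable {n : ℕ}

/-- The directional derivative `∂_v f`. -/
def dirD (v : EuclideanSpace ℝ (Fin n)) (f : EuclideanSpace ℝ (Fin n) → ℝ) :
    EuclideanSpace ℝ (Fin n) → ℝ :=
  fun x => fderiv ℝ f x v

/-- The iterated partial derivative along a list of coordinate directions. -/
def listD (L : List (Fin n)) (f : EuclideanSpace ℝ (Fin n) → ℝ) :
    EuclideanSpace ℝ (Fin n) → ℝ :=
  L.foldr pd f

lemma contDiff_dirD {f : EuclideanSpace ℝ (Fin n) → ℝ} (hf : ContDiff ℝ (⊤ : ℕ∞) f)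
    (v : EuclideanSpace ℝ (Fin n)) : ContDiff ℝ (⊤ : ℕ∞) (dirD v f) :=
  (hf.fderiv_right (m := (⊤ : ℕ∞)) (by simp)).clm_apply contDiff_const

lemma contDiff_listD {f : EuclideanSpace ℝ (Fin n) → ℝ} (hf : ContDiff ℝ (⊤ : ℕ∞) f)
    (L : List (Fin n)) : ContDiff ℝ (⊤ : ℕ∞) (listD L f) := by
  induction L with
  | nil => exact hf
  | cons i L ih => exact contDiff_dirD ih _

lemma contDiff_iterate_dirD {f : EuclideanSpace ℝ (Fin n) → ℝ} (hf : ContDiff ℝ (⊤ : ℕ∞) f)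
    (v : EuclideanSpace ℝ (Fin n)) (m : ℕ) : ContDiff ℝ (⊤ : ℕ∞) ((dirD v)^[m] f) := by
  induction m with
  | zero => exact hf
  | succ m ih => rw [Function.iterate_succ_apply']; exact contDiff_dirD ih _

lemma listD_append (L M : List (Fin n)) (f : EuclideanSpace ℝ (Fin n) → ℝ) :
    listD (L ++ M) f = listD L (listD M f) := by
  simp [listD, List.foldr_append]

lemma listD_replicate (i : Fin n) (m : ℕ) (f : EuclideanSpace ℝ (Fin n) → ℝ) :
    listD (List.replicate m i) f = (pd i)^[m] f := by
  induction m with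
  | zero => rfl
  | succ m ih =>
    rw [Function.iterate_succ_apply', ← ih]
    rfl

lemma pdMulti_eq_listD (α : Fin n → ℕ) (f : EuclideanSpace ℝ (Fin n) → ℝ) :
    pdMulti α f = listD ((List.finRange n).flatMap fun i => List.replicate (α i) i) f := by
  unfold pdMulti
  induction List.finRange n with
  | nil => rfl
  | cons i L ih =>
    rw [List.foldr_cons, List.flatMap_cons, listD_append, ← ih, listD_replicate]

lemma contDiff_pdMulti {f : EuclideanSpace ℝ (Fin n) → ℝ} (hf : ContDiff ℝ (⊤ : ℕ∞) f)
    (α : Fin n → ℕ) : ContDiff ℝ (⊤ : ℕ∞) (pdMulti α f) := by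
  rw [pdMulti_eq_listD]
  exact contDiff_listD hf _

lemma dirD_comm {f : EuclideanSpace ℝ (Fin n) → ℝ} (hf : ContDiff ℝ (⊤ : ℕ∞) f)
    (v w : EuclideanSpace ℝ (Fin n)) : dirD v (dirD w f) = dirD w (dirD v f) := by
  have key : ∀ u u' x, dirD u (dirD u' f) x = fderiv ℝ (fderiv ℝ f) x u u' := by
    intro u u' x
    have hd : DifferentiableAt ℝ (fderiv ℝ f) x :=
      ((hf.fderiv_right (m := (⊤ : ℕ∞)) (by simp)).differentiable (by simp)) x
    have := (hd.hasFDerivAt.clm_apply (hasFDerivAt_const u' x)).fderiv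
    unfold dirD
    rw [this]
    simp
  funext x
  rw [key, key]
  exact (hf.contDiffAt.isSymmSndFDerivAt (by simp; norm_cast)).eq _ _

lemma listD_perm {f : EuclideanSpace ℝ (Fin n) → ℝ} (hf : ContDiff ℝ (⊤ : ℕ∞) f)
    {L M : List (Fin n)} (h : L.Perm M) : listD L f = listD M f := by
  induction h with
  | nil => rfl
  | cons i _ ih => exact congrArg (pd i) ih
  | swap i j L => exact dirD_comm (contDiff_listD hf L) _ _
  | trans _ _ h₁ h₂ => exact h₁.trans h₂

lemma count_flatMap_replicate (α : Fin n → ℕ) (j : Fin n) :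
    ((List.finRange n).flatMap fun i => List.replicate (α i) i).count j = α j := by
  rw [List.count_flatMap, ← Fin.sum_univ_def]
  simp [List.count_replicate]

/-- The multi-index counting the occurrences of each direction in a word. -/
def wordIdx {m : ℕ} (w : Fin m → Fin n) : Fin n → ℕ := fun i => (List.ofFn w).count i

lemma wordIdx_mem {m : ℕ} (w : Fin m → Fin n) : wordIdx w ∈ multiIdx n m := by
  have hle : ∀ i, wordIdx w i ≤ m := fun i => by
    simpa [wordIdx] using List.count_le_length (l := List.ofFn w) (a := i)
  have hsum : ∑ i, wordIdx w i = m := by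
    have := Multiset.sum_count_eq_card (s := Finset.univ) (m := (List.ofFn w : Multiset (Fin n)))
      (by simp)
    simpa [wordIdx] using this
  simp only [multiIdx, Finset.mem_filter, Finset.mem_image, Finset.mem_univ, true_and]
  exact ⟨⟨fun i => ⟨wordIdx w i, Nat.lt_succ_of_le (hle i)⟩, rfl⟩, hsum⟩

lemma listD_ofFn_eq_pdMulti {f : EuclideanSpace ℝ (Fin n) → ℝ} (hf : ContDiff ℝ (⊤ : ℕ∞) f)
    {m : ℕ} (w : Fin m → Fin n) : listD (List.ofFn w) f = pdMulti (wordIdx w) f := by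
  rw [pdMulti_eq_listD]
  refine listD_perm hf (List.perm_iff_count.2 fun j => ?_)
  rw [count_flatMap_replicate]
  rfl

lemma dirD_eq_sum (v : EuclideanSpace ℝ (Fin n)) (f : EuclideanSpace ℝ (Fin n) → ℝ)
    (x : EuclideanSpace ℝ (Fin n)) : dirD v f x = ∑ i, v i * pd i f x := by
  have hv : v = ∑ i, v i • EuclideanSpace.single i (1 : ℝ) := by
    ext j
    simp [Finset.sum_apply, Pi.single_apply]
  conv_lhs => rw [hv]
  simp [dirD, pd, map_sum]

lemma iterate_dirD_eq_sum {f : EuclideanSpace ℝ (Fin n) → ℝ} (hf : ContDiff ℝ (⊤ : ℕ∞) f)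
    (v : EuclideanSpace ℝ (Fin n)) (m : ℕ) (x : EuclideanSpace ℝ (Fin n)) :
    (dirD v)^[m] f x = ∑ w : Fin m → Fin n, (∏ i, v (w i)) * listD (List.ofFn w) f x := by
  induction m generalizing x with
  | zero => simp [listD]
  | succ m ih =>
    rw [Function.iterate_succ_apply', dirD_eq_sum]
    have hpd : ∀ i, pd i ((dirD v)^[m] f) x =
        ∑ w : Fin m → Fin n, (∏ j, v (w j)) * pd i (listD (List.ofFn w) f) x := by
      intro i
      rw [show (dirD v)^[m] f = fun y => ∑ w : Fin m → Fin n,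
        (∏ j, v (w j)) * listD (List.ofFn w) f y from funext ih]
      unfold pd
      have hd : ∀ w : Fin m → Fin n, DifferentiableAt ℝ (listD (List.ofFn w) f) x :=
        fun w => (contDiff_listD hf _).differentiable (by simp) x
      rw [fderiv_fun_sum fun w _ => (hd w).const_mul _]
      simp [fderiv_const_mul (hd _)]
    simp_rw [hpd, Finset.mul_sum]
    rw [← Fintype.sum_prod_type', ← (Fin.consEquiv fun _ : Fin (m + 1) => Fin n).sum_comp]
    refine Finset.sum_congr rfl fun p _ => ?_
    simp [Fin.consEquiv, Fin.prod_univ_succ, List.ofFn_succ, listD, mul_assoc]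

/-- The sum of the absolute values of the `k`-th order partial derivatives. -/
def derivSum (k : ℕ) (f : EuclideanSpace ℝ (Fin n) → ℝ) (x : EuclideanSpace ℝ (Fin n)) : ℝ≥0∞ :=
  ∑ α ∈ multiIdx n k, ‖pdMulti α f x‖ₑ

lemma measurable_derivSum {f : EuclideanSpace ℝ (Fin n) → ℝ} (hf : ContDiff ℝ (⊤ : ℕ∞) f)
    (k : ℕ) : Measurable (derivSum k f) :=
  Finset.measurable_fun_sum _ fun α _ => (contDiff_pdMulti hf α).continuous.measurable.enorm

lemma enorm_iterate_dirD_le {f : EuclideanSpace ℝ (Fin n) → ℝ} (hf : ContDiff ℝ (⊤ : ℕ∞) f)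
    (v : EuclideanSpace ℝ (Fin n)) (k : ℕ) (x : EuclideanSpace ℝ (Fin n)) :
    ‖(dirD v)^[k] f x‖ₑ ≤ (n : ℝ≥0∞) ^ k * ‖v‖ₑ ^ k * derivSum k f x := by
  rw [iterate_dirD_eq_sum hf]
  calc _ ≤ ∑ w : Fin k → Fin n, ‖(∏ i, v (w i)) * listD (List.ofFn w) f x‖ₑ :=
        enorm_sum_le _ _
    _ ≤ ∑ w : Fin k → Fin n, ‖v‖ₑ ^ k * derivSum k f x := by
        refine Finset.sum_le_sum fun w _ => ?_
        rw [enorm_mul]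
        gcongr
        · have h : ‖∏ i, v (w i)‖ ≤ ‖v‖ ^ k := by
            rw [norm_prod]
            calc _ ≤ ∏ i : Fin k, ‖v‖ :=
                  Finset.prod_le_prod (fun _ _ => norm_nonneg _) fun i _ => PiLp.norm_apply_le v _
              _ = _ := by simp
          rw [← ofReal_norm, ← ofReal_norm, ← ENNReal.ofReal_pow (norm_nonneg _)]
          exact ENNReal.ofReal_le_ofReal h
        · rw [listD_ofFn_eq_pdMulti hf]
          exact Finset.single_le_sum (f := fun α => ‖pdMulti α f x‖ₑ) (fun _ _ => zero_le)
            (wordIdx_mem w)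
    _ = _ := by simp [mul_assoc]

lemma taylor_sum_integral (a : ℕ → ℝ → ℝ) (ha : ∀ m t, HasDerivAt (a m) (a (m + 1) t) t)
    (k : ℕ) :
    a 0 1 - ∑ m ∈ Finset.range (k + 1), a m 0 / m.factorial =
      ∫ t in (0 : ℝ)..1, (1 - t) ^ k / k.factorial * a (k + 1) t := by
  have hcont : ∀ m, Continuous (a m) := fun m =>
    continuous_iff_continuousAt.2 fun t => (ha m t).continuousAt
  have hder : ∀ (j : ℕ) (t : ℝ), HasDerivAt
      (fun t => ∑ m ∈ Finset.range (j + 1), (1 - t) ^ m / m.factorial * a m t)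
      ((1 - t) ^ j / j.factorial * a (j + 1) t) t := by
    intro j t
    induction j with
    | zero => simpa using ha 0 t
    | succ j ih =>
      simp_rw [Finset.sum_range_succ _ (j + 1)]
      have h1 : HasDerivAt (fun t : ℝ => (1 - t) ^ (j + 1) / ((j + 1).factorial : ℝ))
          (-((1 - t) ^ j / (j.factorial : ℝ))) t := by
        have := (((hasDerivAt_id t).const_sub 1).pow (j + 1)).div_const ((j + 1).factorial : ℝ)
        refine this.congr_deriv ?_
        have : (j.factorial : ℝ) ≠ 0 := by positivity
        rw [Nat.factorial_succ]
        push_cast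
        simp
        field_simp
      exact (ih.add (h1.mul (ha (j + 1) t))).congr_deriv (by ring)
  have hFTC := intervalIntegral.integral_eq_sub_of_hasDerivAt (a := (0 : ℝ)) (b := 1)
    (fun t _ => hder k t) (Continuous.intervalIntegrable (by have := hcont (k + 1); fun_prop) _ _)
  rw [hFTC]
  congr 1
  · rw [Finset.sum_eq_single 0]
    · simp
    · intro m _ hm
      simp [hm]
    · simp
  · refine Finset.sum_congr rfl fun m _ => ?_
    simp
    ring

lemma enorm_taylor_remainder_le (a : ℕ → ℝ → ℝ) (ha : ∀ m t, HasDerivAt (a m) (a (m + 1) t) t)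
    {k : ℕ} (hk : 0 < k) :
    ‖a 0 1 - ∑ m ∈ Finset.range k, a m 0 / m.factorial‖ₑ ≤
      ∫⁻ u in Ioo (0 : ℝ) 1, ENNReal.ofReal (u ^ (k - 1)) * ‖a k (1 - u)‖ₑ := by
  obtain ⟨k, rfl⟩ := Nat.exists_eq_succ_of_ne_zero hk.ne'
  rw [Nat.succ_eq_add_one, taylor_sum_integral a ha]
  have hsub : ∫ t in (0 : ℝ)..1, (1 - t) ^ k / k.factorial * a (k + 1) t =
      ∫ u in (0 : ℝ)..1, u ^ k / k.factorial * a (k + 1) (1 - u) := by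
    have := intervalIntegral.integral_comp_sub_left (a := 0) (b := 1)
      (fun u : ℝ => u ^ k / k.factorial * a (k + 1) (1 - u)) 1
    simpa using this
  rw [hsub, intervalIntegral.integral_of_le zero_le_one, integral_Ioc_eq_integral_Ioo]
  refine (enorm_integral_le_lintegral_enorm _).trans ?_
  refine setLIntegral_mono' measurableSet_Ioo fun u hu => ?_
  rw [enorm_mul]
  gcongr
  have h0 : 0 ≤ u ^ k := pow_nonneg hu.1.le _
  rw [Real.enorm_eq_ofReal (by positivity)]
  exact ENNReal.ofReal_le_ofReal (div_le_self h0 (by exact_mod_cast Nat.factorial_pos k))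

lemma sum_choose_mul_eval_eq_zero {P : Polynomial ℝ} {k : ℕ} (hP : P.natDegree < k) :
    ∑ j ∈ Finset.range (k + 1), (-1 : ℝ) ^ (k - j) * (k.choose j : ℝ) * P.eval (j : ℝ) = 0 := by
  have h := congrFun (Polynomial.fwdDiff_iter_eq_zero_of_degree_lt hP) 0
  rw [fwdDiff_iter_eq_sum_shift] at h
  simpa using h

/-- The Taylor polynomial of degree less than `k` of `f` at `y`. -/
def taylorPoly (k : ℕ) (f : EuclideanSpace ℝ (Fin n) → ℝ) (y z : EuclideanSpace ℝ (Fin n)) : ℝ :=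
  ∑ m ∈ Finset.range k, (dirD (z - y))^[m] f y / m.factorial

lemma kdiff_taylorPoly {f : EuclideanSpace ℝ (Fin n) → ℝ} (hf : ContDiff ℝ (⊤ : ℕ∞) f)
    (k : ℕ) (h x y : EuclideanSpace ℝ (Fin n)) : kdiff k (taylorPoly k f y) h x = 0 := by
  unfold kdiff taylorPoly
  simp_rw [iterate_dirD_eq_sum hf, Finset.sum_div, Finset.mul_sum]
  rw [Finset.sum_comm]
  refine Finset.sum_eq_zero fun m hm => ?_
  rw [Finset.sum_comm]
  refine Finset.sum_eq_zero fun w _ => ?_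
  set P : Polynomial ℝ := ∏ i : Fin m,
    (Polynomial.C (h (w i)) * Polynomial.X + Polynomial.C (x (w i) - y (w i))) with hP
  have hdeg : P.natDegree < k := by
    refine lt_of_le_of_lt (Polynomial.natDegree_prod_le _ _) (lt_of_le_of_lt ?_
      (Finset.mem_range.1 hm))
    calc _ ≤ ∑ i : Fin m, 1 := Finset.sum_le_sum fun i _ => Polynomial.natDegree_linear_le
      _ = m := by simp
  have heval : ∀ j : ℕ, ∏ i, (x + j • h - y) (w i) = P.eval (j : ℝ) := by
    intro j
    rw [hP, Polynomial.eval_prod]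
    refine Finset.prod_congr rfl fun i _ => ?_
    simp
    ring
  simp_rw [heval]
  calc _ = (∑ j ∈ Finset.range (k + 1), (-1 : ℝ) ^ (k - j) * (k.choose j : ℝ) *
        P.eval (j : ℝ)) * (listD (List.ofFn w) f y / m.factorial) := by
        rw [Finset.sum_mul]
        exact Finset.sum_congr rfl fun j _ => by ring
    _ = 0 := by rw [sum_choose_mul_eval_eq_zero hdeg, zero_mul]

lemma enorm_sub_taylorPoly_le {f : EuclideanSpace ℝ (Fin n) → ℝ} (hf : ContDiff ℝ (⊤ : ℕ∞) f)
    {k : ℕ} (hk : 0 < k) (y z : EuclideanSpace ℝ (Fin n)) :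
    ‖f z - taylorPoly k f y z‖ₑ ≤ (n : ℝ≥0∞) ^ k * ‖z - y‖ₑ ^ k *
      ∫⁻ u in Ioo (0 : ℝ) 1, ENNReal.ofReal (u ^ (k - 1)) *
        derivSum k f (z + u • (y - z)) := by
  have ha : ∀ (m : ℕ) (t : ℝ), HasDerivAt (fun t => (dirD (z - y))^[m] f (y + t • (z - y)))
      ((dirD (z - y))^[m + 1] f (y + t • (z - y))) t := by
    intro m t
    have h1 : HasDerivAt (fun t : ℝ => y + t • (z - y)) (z - y) t := by
      simpa using ((hasDerivAt_id t).smul_const (z - y)).const_add y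
    have h2 := ((contDiff_iterate_dirD hf (z - y) m).differentiable (by simp)
      (y + t • (z - y))).hasFDerivAt
    have := h2.comp_hasDerivAt t h1
    rw [Function.iterate_succ_apply']
    exact this
  have h := enorm_taylor_remainder_le _ ha hk
  simp only [Function.iterate_zero, id_eq, one_smul, add_sub_cancel, zero_smul, add_zero] at h
  refine h.trans ?_
  have hmeas : Measurable fun u : ℝ => ENNReal.ofReal (u ^ (k - 1)) *
        derivSum k f (z + u • (y - z)) :=
    Measurable.mul (by fun_prop) ((measurable_derivSum hf k).comp (by fun_prop))
  rw [← lintegral_const_mul _ hmeas]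
  refine lintegral_mono fun u => ?_
  have hpt : y + (1 - u) • (z - y) = z + u • (y - z) := by
    rw [sub_smul, one_smul, smul_sub, smul_sub]
    abel
  calc _ ≤ ENNReal.ofReal (u ^ (k - 1)) * ((n : ℝ≥0∞) ^ k * ‖z - y‖ₑ ^ k *
        derivSum k f (y + (1 - u) • (z - y))) := by
        gcongr
        exact enorm_iterate_dirD_le hf _ _ _
    _ = _ := by rw [hpt]; ring

/-- The averaged potential of `G` at scale `ρ` controlling Taylor remainders of order `k`. -/
def scalePotential (k : ℕ) (ρ : ℝ) (G : EuclideanSpace ℝ (Fin n) → ℝ≥0∞)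
    (z : EuclideanSpace ℝ (Fin n)) : ℝ≥0∞ :=
  ∫⁻ u in Ioo (0 : ℝ) 1, ENNReal.ofReal (u ^ (k - 1)) *
    ∫⁻ v in Metric.ball (0 : EuclideanSpace ℝ (Fin n)) ρ, G (z + u • v)

lemma setLIntegral_ball_comp_sub {F : EuclideanSpace ℝ (Fin n) → ℝ≥0∞} (hF : Measurable F)
    (z : EuclideanSpace ℝ (Fin n)) (ρ : ℝ) :
    ∫⁻ y in Metric.ball z ρ, F (y - z) = ∫⁻ v in Metric.ball 0 ρ, F v := by
  have := (measurePreserving_sub_right volume z).setLIntegral_comp_preimage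
    (s := Metric.ball 0 ρ) measurableSet_ball hF
  rw [← this]
  congr 2
  ext y
  simp [dist_eq_norm]

lemma setLIntegral_taylor_le {G : EuclideanSpace ℝ (Fin n) → ℝ≥0∞} (hG : Measurable G) (k : ℕ)
    {x z : EuclideanSpace ℝ (Fin n)} {R ρ : ℝ}
    (hsub : Metric.ball x R ⊆ Metric.ball z ρ) :
    ∫⁻ y in Metric.ball x R, ∫⁻ u in Ioo (0 : ℝ) 1, ENNReal.ofReal (u ^ (k - 1)) *
        G (z + u • (y - z)) ≤ scalePotential k ρ G z := by
  refine (lintegral_mono_set hsub).trans ?_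
  have hm : Measurable fun p : EuclideanSpace ℝ (Fin n) × ℝ =>
      ENNReal.ofReal (p.2 ^ (k - 1)) * G (z + p.2 • (p.1 - z)) :=
    Measurable.mul (by fun_prop) (hG.comp (by fun_prop))
  rw [lintegral_lintegral_swap hm.aemeasurable]
  refine lintegral_mono fun u => ?_
  have hmu : Measurable fun v : EuclideanSpace ℝ (Fin n) => G (z + u • v) :=
    hG.comp (by fun_prop)
  have hmu' : Measurable fun y : EuclideanSpace ℝ (Fin n) => G (z + u • (y - z)) :=
    hG.comp (by fun_prop)
  rw [lintegral_const_mul _ hmu',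
    setLIntegral_ball_comp_sub (F := fun v => G (z + u • v)) hmu z ρ]

lemma enorm_kdiff_le {f : EuclideanSpace ℝ (Fin n) → ℝ} (hf : ContDiff ℝ (⊤ : ℕ∞) f)
    {k : ℕ} (hk : 0 < k) {R : ℝ} {h : EuclideanSpace ℝ (Fin n)}
    (hh : ‖h‖ < R) (x : EuclideanSpace ℝ (Fin n)) :
    volume (Metric.ball (0 : EuclideanSpace ℝ (Fin n)) R) * ‖kdiff k f h x‖ₑ ≤
      2 ^ k * (n : ℝ≥0∞) ^ k * ENNReal.ofReal ((k + 1) * R) ^ k *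
        ∑ j ∈ Finset.range (k + 1), scalePotential k ((k + 1) * R) (derivSum k f) (x + j • h) := by
  have hG := measurable_derivSum hf k
  have hR : 0 < R := (norm_nonneg h).trans_lt hh
  have hjh : ∀ j ∈ Finset.range (k + 1), ‖j • h‖ ≤ k * R := by
    intro j hj
    rw [← Nat.cast_smul_eq_nsmul ℝ, norm_smul, Real.norm_natCast]
    have : (j : ℝ) ≤ k := by exact_mod_cast Nat.lt_succ_iff.1 (Finset.mem_range.1 hj)
    gcongr
  have hpt : ∀ y ∈ Metric.ball x R, ‖kdiff k f h x‖ₑ ≤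
      ∑ j ∈ Finset.range (k + 1), 2 ^ k * (n : ℝ≥0∞) ^ k * ENNReal.ofReal ((k + 1) * R) ^ k *
        ∫⁻ u in Ioo (0 : ℝ) 1, ENNReal.ofReal (u ^ (k - 1)) *
          derivSum k f ((x + j • h) + u • (y - (x + j • h))) := by
    intro y hy
    have heq : kdiff k f h x = ∑ j ∈ Finset.range (k + 1), (-1 : ℝ) ^ (k - j) *
        (k.choose j : ℝ) * (f (x + j • h) - taylorPoly k f y (x + j • h)) := by
      rw [← sub_zero (kdiff k f h x), ← kdiff_taylorPoly hf k h x y]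
      unfold kdiff
      rw [← Finset.sum_sub_distrib]
      exact Finset.sum_congr rfl fun j _ => by ring
    rw [heq]
    refine (enorm_sum_le _ _).trans (Finset.sum_le_sum fun j hj => ?_)
    have hc : ‖(-1 : ℝ) ^ (k - j) * (k.choose j : ℝ)‖ₑ ≤ 2 ^ k := by
      have h1 : ‖(-1 : ℝ) ^ (k - j) * (k.choose j : ℝ)‖ₑ = ((k.choose j : ℕ) : ℝ≥0∞) := by
        rw [enorm_mul, enorm_pow, enorm_neg, enorm_one, one_pow, one_mul,
          Real.enorm_natCast]
      rw [h1]
      exact_mod_cast Nat.choose_le_two_pow k j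
    have hd : ‖x + j • h - y‖ₑ ≤ ENNReal.ofReal ((k + 1) * R) := by
      rw [← ofReal_norm]
      refine ENNReal.ofReal_le_ofReal ?_
      have h2 : ‖x - y‖ < R := by rwa [← dist_eq_norm, dist_comm]
      calc ‖x + j • h - y‖ = ‖(x - y) + j • h‖ := by congr 1; abel
        _ ≤ ‖x - y‖ + ‖j • h‖ := norm_add_le _ _
        _ ≤ R + k * R := add_le_add h2.le (hjh j hj)
        _ = _ := by ring
    rw [enorm_mul]
    calc _ ≤ 2 ^ k * ((n : ℝ≥0∞) ^ k * ENNReal.ofReal ((k + 1) * R) ^ k *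
        ∫⁻ u in Ioo (0 : ℝ) 1, ENNReal.ofReal (u ^ (k - 1)) *
          derivSum k f ((x + j • h) + u • (y - (x + j • h)))) := by
          gcongr
          refine (enorm_sub_taylorPoly_le hf hk y _).trans ?_
          gcongr
      _ = _ := by ring
  have hvol : volume (Metric.ball (0 : EuclideanSpace ℝ (Fin n)) R) =
      volume (Metric.ball x R) := (Measure.addHaar_ball_center volume x R).symm
  have hmeas : ∀ z : EuclideanSpace ℝ (Fin n), Measurable fun y : EuclideanSpace ℝ (Fin n) =>
      ∫⁻ u in Ioo (0 : ℝ) 1, ENNReal.ofReal (u ^ (k - 1)) *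
          derivSum k f (z + u • (y - z)) := by
    intro z
    exact Measurable.lintegral_prod_right' (f := fun p : EuclideanSpace ℝ (Fin n) × ℝ =>
      ENNReal.ofReal (p.2 ^ (k - 1)) * derivSum k f (z + p.2 • (p.1 - z)))
      (Measurable.mul (by fun_prop) (hG.comp (by fun_prop)))
  calc _ = ∫⁻ _ in Metric.ball x R, ‖kdiff k f h x‖ₑ := by
        rw [setLIntegral_const, hvol, mul_comm]
    _ ≤ _ := setLIntegral_mono' measurableSet_ball hpt
    _ = ∑ j ∈ Finset.range (k + 1), 2 ^ k * (n : ℝ≥0∞) ^ k * ENNReal.ofReal ((k + 1) * R) ^ k *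
        ∫⁻ y in Metric.ball x R, ∫⁻ u in Ioo (0 : ℝ) 1, ENNReal.ofReal (u ^ (k - 1)) *
          derivSum k f ((x + j • h) + u • (y - (x + j • h))) := by
        rw [lintegral_finsetSum _ fun j _ => (hmeas _).const_mul _]
        exact Finset.sum_congr rfl fun j _ => lintegral_const_mul _ (hmeas _)
    _ ≤ _ := by
        rw [Finset.mul_sum]
        refine Finset.sum_le_sum fun j hj => ?_
        gcongr
        refine setLIntegral_taylor_le hG k ?_
        refine Metric.ball_subset_ball' ?_
        rw [dist_comm, dist_self_add_left]
        have := hjh j hj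
        linarith

/-- The averages of `Ω` over balls are controlled by its values, as for an `A₁`-weight. -/
def BallA1 (Ω : EuclideanSpace ℝ (Fin n) → ℝ≥0∞) (A : ℝ≥0∞) : Prop :=
  ∀ ρ : ℝ, 0 < ρ → ∀ᵐ y, ∫⁻ z in Metric.ball y ρ, Ω z ≤ A * ENNReal.ofReal ρ ^ n * Ω y

lemma setLIntegral_ball_comp_add {F : EuclideanSpace ℝ (Fin n) → ℝ≥0∞} (hF : Measurable F)
    (z : EuclideanSpace ℝ (Fin n)) (ρ : ℝ) :
    ∫⁻ v in Metric.ball 0 ρ, F (z + v) = ∫⁻ y in Metric.ball z ρ, F y := by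
  have hm : Measurable fun v => F (z + v) := hF.comp (by fun_prop)
  rw [← setLIntegral_ball_comp_sub hm z ρ]
  simp

lemma setLIntegral_ball_comp_smul {F : EuclideanSpace ℝ (Fin n) → ℝ≥0∞} (hF : Measurable F)
    {c : ℝ} (hc : c ≠ 0) (ρ : ℝ) :
    ∫⁻ v in Metric.ball (0 : EuclideanSpace ℝ (Fin n)) ρ, F (c • v) =
      (ENNReal.ofReal |c| ^ n)⁻¹ * ∫⁻ w in Metric.ball 0 (|c| * ρ), F w := by
  have hpre : Metric.ball (0 : EuclideanSpace ℝ (Fin n)) ρ =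
      (fun v => c • v) ⁻¹' Metric.ball 0 (|c| * ρ) := by
    ext v
    simp [norm_smul, abs_pos.2 hc]
  have hmeas : Measurable fun v : EuclideanSpace ℝ (Fin n) => c • v := by fun_prop
  rw [hpre, ← setLIntegral_map measurableSet_ball hF hmeas, Measure.map_addHaar_smul _ hc,
    Measure.restrict_smul, lintegral_smul_measure, finrank_euclideanSpace_fin, smul_eq_mul]
  congr 1
  rw [abs_inv, abs_pow, ENNReal.ofReal_inv_of_pos (by positivity), ENNReal.ofReal_pow (abs_nonneg c)]

lemma setLIntegral_ball_comp_add_smul {F : EuclideanSpace ℝ (Fin n) → ℝ≥0∞} (hF : Measurable F)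
    {c : ℝ} (hc : c ≠ 0) (z : EuclideanSpace ℝ (Fin n)) (ρ : ℝ) :
    ∫⁻ v in Metric.ball (0 : EuclideanSpace ℝ (Fin n)) ρ, F (z + c • v) =
      (ENNReal.ofReal |c| ^ n)⁻¹ * ∫⁻ w in Metric.ball z (|c| * ρ), F w := by
  have hm : Measurable fun v => F (z + v) := hF.comp (by fun_prop)
  rw [setLIntegral_ball_comp_smul hm hc, setLIntegral_ball_comp_add hF]

lemma lintegral_mul_average_le {Ω G : EuclideanSpace ℝ (Fin n) → ℝ≥0∞} {A : ℝ≥0∞}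
    (hΩ : Measurable Ω) (hG : Measurable G) (hA : BallA1 Ω A) {u ρ : ℝ} (hu : 0 < u)
    (hρ : 0 < ρ) :
    ∫⁻ x, Ω x * ∫⁻ v in Metric.ball (0 : EuclideanSpace ℝ (Fin n)) ρ, G (x + u • v) ≤
      A * ENNReal.ofReal ρ ^ n * ∫⁻ y, G y * Ω y := by
  have hGm : ∀ x : EuclideanSpace ℝ (Fin n), Measurable fun v : EuclideanSpace ℝ (Fin n) =>
    G (x + u • v) := fun x => hG.comp (by fun_prop)
  have hΩm : ∀ y : EuclideanSpace ℝ (Fin n), Measurable fun v : EuclideanSpace ℝ (Fin n) =>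
    Ω (y + (-u) • v) := fun x => hΩ.comp (by fun_prop)
  have hm1 : Measurable fun p : EuclideanSpace ℝ (Fin n) × EuclideanSpace ℝ (Fin n) =>
      Ω p.1 * G (p.1 + u • p.2) :=
    (hΩ.comp measurable_fst).mul (hG.comp (by fun_prop))
  have hm2 : Measurable fun p : EuclideanSpace ℝ (Fin n) × EuclideanSpace ℝ (Fin n) =>
      G p.2 * Ω (p.2 + (-u) • p.1) :=
    (hG.comp measurable_snd).mul (hΩ.comp (by fun_prop))
  calc _ = ∫⁻ x, ∫⁻ v in Metric.ball (0 : EuclideanSpace ℝ (Fin n)) ρ, Ω x * G (x + u • v) := by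
        simp_rw [lintegral_const_mul _ (hGm _)]
    _ = ∫⁻ v in Metric.ball (0 : EuclideanSpace ℝ (Fin n)) ρ, ∫⁻ x, Ω x * G (x + u • v) :=
        lintegral_lintegral_swap hm1.aemeasurable
    _ = ∫⁻ v in Metric.ball (0 : EuclideanSpace ℝ (Fin n)) ρ,
          ∫⁻ y, G y * Ω (y + (-u) • v) := by
        refine lintegral_congr fun v => ?_
        rw [← lintegral_add_right_eq_self (fun y => G y * Ω (y + (-u) • v)) (u • v)]
        refine lintegral_congr fun x => ?_
        rw [add_assoc, ← add_smul, add_neg_cancel, zero_smul, add_zero, mul_comm]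
    _ = ∫⁻ y, ∫⁻ v in Metric.ball (0 : EuclideanSpace ℝ (Fin n)) ρ,
          G y * Ω (y + (-u) • v) := lintegral_lintegral_swap hm2.aemeasurable
    _ ≤ ∫⁻ y, A * ENNReal.ofReal ρ ^ n * (G y * Ω y) := by
        refine lintegral_mono_ae ?_
        filter_upwards [hA (u * ρ) (by positivity)] with y hy
        rw [lintegral_const_mul _ (hΩm _),
          setLIntegral_ball_comp_add_smul hΩ (neg_ne_zero.2 hu.ne'), abs_neg, abs_of_pos hu]
        have hu0 : ENNReal.ofReal u ^ n ≠ 0 := pow_ne_zero _ (by simpa using hu)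
        have hut : ENNReal.ofReal u ^ n ≠ ⊤ := ENNReal.pow_ne_top ENNReal.ofReal_ne_top
        calc _ ≤ G y * ((ENNReal.ofReal u ^ n)⁻¹ *
              (A * ENNReal.ofReal (u * ρ) ^ n * Ω y)) := by gcongr
          _ = ((ENNReal.ofReal u ^ n)⁻¹ * ENNReal.ofReal u ^ n) *
              (A * ENNReal.ofReal ρ ^ n * (G y * Ω y)) := by
              rw [ENNReal.ofReal_mul hu.le, mul_pow]
              ring
          _ = _ := by rw [ENNReal.inv_mul_cancel hu0 hut, one_mul]
    _ = _ := lintegral_const_mul _ (hG.mul hΩ)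

lemma measurable_setLIntegral_ball_comp_smul {G : EuclideanSpace ℝ (Fin n) → ℝ≥0∞}
    (hG : Measurable G) (ρ : ℝ) :
    Measurable fun p : EuclideanSpace ℝ (Fin n) × ℝ =>
      ∫⁻ v in Metric.ball (0 : EuclideanSpace ℝ (Fin n)) ρ, G (p.1 + p.2 • v) :=
  Measurable.lintegral_prod_right' (f := fun r : (EuclideanSpace ℝ (Fin n) × ℝ) ×
    EuclideanSpace ℝ (Fin n) => G (r.1.1 + r.1.2 • r.2)) (hG.comp (by fun_prop))

lemma measurable_scalePotential {G : EuclideanSpace ℝ (Fin n) → ℝ≥0∞}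
    (hG : Measurable G) (k : ℕ) (ρ : ℝ) : Measurable (scalePotential k ρ G) :=
  Measurable.lintegral_prod_right' (f := fun p : EuclideanSpace ℝ (Fin n) × ℝ =>
    ENNReal.ofReal (p.2 ^ (k - 1)) *
      ∫⁻ v in Metric.ball (0 : EuclideanSpace ℝ (Fin n)) ρ, G (p.1 + p.2 • v))
    (Measurable.mul (by fun_prop) (measurable_setLIntegral_ball_comp_smul hG ρ))

lemma lintegral_mul_scalePotential_le {Ω G : EuclideanSpace ℝ (Fin n) → ℝ≥0∞} {A : ℝ≥0∞}
    (hΩ : Measurable Ω) (hG : Measurable G) (hA : BallA1 Ω A) (k : ℕ) {ρ : ℝ}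
    (hρ : 0 < ρ) :
    ∫⁻ x, Ω x * scalePotential k ρ G x ≤ A * ENNReal.ofReal ρ ^ n * ∫⁻ y, G y * Ω y := by
  have hm := measurable_setLIntegral_ball_comp_smul hG ρ
  have hm1 : ∀ x, Measurable fun u : ℝ => ENNReal.ofReal (u ^ (k - 1)) *
      ∫⁻ v in Metric.ball (0 : EuclideanSpace ℝ (Fin n)) ρ, G (x + u • v) := fun x =>
    Measurable.mul (by fun_prop) (hm.comp (by fun_prop : Measurable fun u : ℝ => (x, u)))
  have hm2 : Measurable fun p : EuclideanSpace ℝ (Fin n) × ℝ =>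
      Ω p.1 * (ENNReal.ofReal (p.2 ^ (k - 1)) *
      ∫⁻ v in Metric.ball (0 : EuclideanSpace ℝ (Fin n)) ρ, G (p.1 + p.2 • v)) :=
    (hΩ.comp measurable_fst).mul (Measurable.mul (by fun_prop) hm)
  unfold scalePotential
  simp_rw [← lintegral_const_mul _ (hm1 _)]
  rw [lintegral_lintegral_swap hm2.aemeasurable]
  calc _ ≤ ∫⁻ _ in Ioo (0 : ℝ) 1, A * ENNReal.ofReal ρ ^ n * ∫⁻ y, G y * Ω y := by
        refine setLIntegral_mono' measurableSet_Ioo fun u hu => ?_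
        refine le_trans (lintegral_mono fun x => ?_) (lintegral_mul_average_le hΩ hG hA hu.1 hρ)
        gcongr
        refine mul_le_of_le_one_left' ?_
        rw [ENNReal.ofReal_le_one]
        exact pow_le_one₀ hu.1.le hu.2.le
    _ = _ := by simp

lemma lintegral_rpow_le_measure_univ_mul {α : Type*} [MeasurableSpace α] (μ : Measure α)
    {F : α → ℝ≥0∞} (hF : Measurable F) {q : ℝ} (hq : 1 ≤ q) :
    (∫⁻ a, F a ∂μ) ^ q ≤ μ univ ^ (q - 1) * ∫⁻ a, F a ^ q ∂μ := by
  have hq0 : 0 < q := by linarith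
  have h := eLpNorm'_le_eLpNorm'_mul_rpow_measure_univ (f := F) (μ := μ) one_pos hq
    hF.aestronglyMeasurable
  simp only [eLpNorm', enorm_eq_self, ENNReal.rpow_one, div_one] at h
  calc _ ≤ ((∫⁻ a, F a ^ q ∂μ) ^ (1 / q) * μ univ ^ (1 - 1 / q)) ^ q := by gcongr
    _ = _ := by
      rw [ENNReal.mul_rpow_of_nonneg _ _ hq0.le, ← ENNReal.rpow_mul, ← ENNReal.rpow_mul,
        one_div_mul_cancel hq0.ne', ENNReal.rpow_one, mul_comm]
      congr 2
      field_simp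

/-- The total mass of `u ^ (c - 1) du` on `(0, 1)`. -/
def powMass (c : ℝ) : ℝ≥0∞ := ∫⁻ u in Ioo (0 : ℝ) 1, ENNReal.ofReal (u ^ (c - 1))

lemma powMass_ne_top {c : ℝ} (hc : 0 < c) : powMass c ≠ ⊤ := by
  have h : IntegrableOn (fun u : ℝ => u ^ (c - 1)) (Ioo 0 1) := by
    rw [intervalIntegral.integrableOn_Ioo_rpow_iff one_pos]
    linarith
  refine (lt_of_le_of_lt (lintegral_mono fun u => ?_) h.hasFiniteIntegral).ne
  exact Real.ofReal_le_enorm _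

lemma lintegral_scalePotential_rpow_le {G : EuclideanSpace ℝ (Fin n) → ℝ≥0∞}
    (hG : Measurable G) {k : ℕ} (hk : 0 < k) {q : ℝ} (hq : 1 ≤ q) {R ρ : ℝ} (hR : 0 < R)
    (hρ : 0 < ρ) {j : ℕ} (hj : 0 < j) (hjk : j ≤ k) (x : EuclideanSpace ℝ (Fin n)) :
    ∫⁻ h in Metric.ball (0 : EuclideanSpace ℝ (Fin n)) R, scalePotential k ρ G (x + j • h) ^ q ≤
      powMass (k - n + n / q) ^ q * volume (Metric.ball (0 : EuclideanSpace ℝ (Fin n)) ρ) *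
        (∫⁻ y in Metric.ball x (ρ + k * R), G y) ^ q := by
  have hq0 : 0 < q := by linarith
  set c : ℝ := k - n + n / q with hc
  set I := ∫⁻ y in Metric.ball x (ρ + k * R), G y with hI
  set V := volume (Metric.ball (0 : EuclideanSpace ℝ (Fin n)) ρ) with hV
  set avg : EuclideanSpace ℝ (Fin n) → ℝ → ℝ≥0∞ := fun z u =>
    ∫⁻ v in Metric.ball (0 : EuclideanSpace ℝ (Fin n)) ρ, G (z + u • v) with havg
  set μ : Measure ℝ := (volume.restrict (Ioo (0 : ℝ) 1)).withDensity
    fun u => ENNReal.ofReal (u ^ (c - 1)) with hμ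
  have hdens : Measurable fun u : ℝ => ENNReal.ofReal (u ^ (c - 1)) := by fun_prop
  have hμuniv : μ univ = powMass c := by
    rw [hμ, withDensity_apply _ MeasurableSet.univ, Measure.restrict_univ]
    rfl
  have hμlint : ∀ F : ℝ → ℝ≥0∞, Measurable F → ∫⁻ u, F u ∂μ =
      ∫⁻ u in Ioo (0 : ℝ) 1, ENNReal.ofReal (u ^ (c - 1)) * F u := fun F hF =>
    lintegral_withDensity_eq_lintegral_mul _ hdens hF
  have hμae : ∀ᵐ u ∂μ, u ∈ Ioo (0 : ℝ) 1 :=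
    (withDensity_absolutelyContinuous _ _).ae_le (ae_restrict_mem measurableSet_Ioo)
  have hmavg2 : Measurable fun p : EuclideanSpace ℝ (Fin n) × ℝ => avg p.1 p.2 :=
    measurable_setLIntegral_ball_comp_smul hG ρ
  have hmavg : ∀ z, Measurable (avg z) := fun z =>
    hmavg2.comp (by fun_prop : Measurable fun u : ℝ => (z, u))
  have hmF : ∀ z, Measurable fun u : ℝ => ENNReal.ofReal u ^ ((n : ℝ) - n / q) * avg z u :=
    fun z => Measurable.mul (by fun_prop) (hmavg z)
  have hpot : ∀ z, scalePotential k ρ G z =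
      ∫⁻ u, ENNReal.ofReal u ^ ((n : ℝ) - n / q) * avg z u ∂μ := by
    intro z
    rw [hμlint _ (hmF z)]
    refine setLIntegral_congr_fun measurableSet_Ioo fun u hu => ?_
    rw [← mul_assoc, ENNReal.ofReal_rpow_of_pos hu.1, ← ENNReal.ofReal_mul
      (Real.rpow_nonneg hu.1.le _), ← Real.rpow_add hu.1, ← Real.rpow_natCast,
      Nat.cast_sub hk, hc]
    congr 3
    push_cast
    ring
  have hlarge : ∀ h ∈ Metric.ball (0 : EuclideanSpace ℝ (Fin n)) R, ∀ u ∈ Ioo (0 : ℝ) 1,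
      avg (x + j • h) u ≤ ENNReal.ofReal u ^ (-(n : ℝ)) * I := by
    intro h hh u hu
    simp only [havg]
    rw [setLIntegral_ball_comp_add_smul hG hu.1.ne', abs_of_pos hu.1, ENNReal.rpow_neg,
      ENNReal.rpow_natCast]
    gcongr
    refine lintegral_mono_set (Metric.ball_subset_ball' ?_)
    rw [dist_self_add_left, ← Nat.cast_smul_eq_nsmul ℝ, norm_smul, Real.norm_natCast]
    have h1 : (j : ℝ) ≤ k := by exact_mod_cast hjk
    have h2 : ‖h‖ ≤ R := by simpa using (mem_ball_zero_iff.1 hh).le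
    have h3 : u * ρ ≤ ρ := mul_le_of_le_one_left hρ.le hu.2.le
    have h4 : (j : ℝ) * ‖h‖ ≤ k * R := by gcongr
    linarith
  have hpow : ∀ h ∈ Metric.ball (0 : EuclideanSpace ℝ (Fin n)) R, ∀ u ∈ Ioo (0 : ℝ) 1,
      (ENNReal.ofReal u ^ ((n : ℝ) - n / q) * avg (x + j • h) u) ^ q ≤
        I ^ (q - 1) * avg (x + j • h) u := by
    intro h hh u hu
    have hu0 : ENNReal.ofReal u ≠ 0 := by simpa using hu.1
    have e : avg (x + j • h) u ^ q = avg (x + j • h) u ^ (q - 1) * avg (x + j • h) u := by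
      conv_lhs => rw [show q = (q - 1) + 1 by ring]
      rw [ENNReal.rpow_add_of_nonneg _ _ (by linarith) zero_le_one, ENNReal.rpow_one]
    rw [ENNReal.mul_rpow_of_nonneg _ _ hq0.le, e, ← mul_assoc]
    gcongr
    calc _ ≤ (ENNReal.ofReal u ^ ((n : ℝ) - n / q)) ^ q *
          (ENNReal.ofReal u ^ (-(n : ℝ)) * I) ^ (q - 1) := by
          gcongr
          exact hlarge h hh u hu
      _ = ENNReal.ofReal u ^ (((n : ℝ) - n / q) * q + (-(n : ℝ)) * (q - 1)) * I ^ (q - 1) := by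
          rw [ENNReal.mul_rpow_of_nonneg _ _ (by linarith : 0 ≤ q - 1), ← ENNReal.rpow_mul,
            ← ENNReal.rpow_mul, ENNReal.rpow_add _ _ hu0 ENNReal.ofReal_ne_top, mul_assoc]
      _ = _ := by
          rw [show ((n : ℝ) - n / q) * q + (-(n : ℝ)) * (q - 1) = 0 by field_simp; ring,
            ENNReal.rpow_zero, one_mul]
  have hpt : ∀ h ∈ Metric.ball (0 : EuclideanSpace ℝ (Fin n)) R,
      scalePotential k ρ G (x + j • h) ^ q ≤
        powMass c ^ (q - 1) * I ^ (q - 1) * ∫⁻ u, avg (x + j • h) u ∂μ := by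
    intro h hh
    rw [hpot, mul_assoc, ← hμuniv]
    refine (lintegral_rpow_le_measure_univ_mul μ
      (hmF _) hq).trans ?_
    gcongr
    rw [← lintegral_const_mul _ (hmavg _)]
    refine lintegral_mono_ae ?_
    filter_upwards [hμae] with u hu using hpow h hh u hu
  have hmj : Measurable fun p : EuclideanSpace ℝ (Fin n) × ℝ => avg (x + j • p.1) p.2 :=
    hmavg2.comp (by fun_prop : Measurable fun p : EuclideanSpace ℝ (Fin n) × ℝ =>
      (x + j • p.1, p.2))
  have hinner : ∀ u ∈ Ioo (0 : ℝ) 1,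
      ∫⁻ h in Metric.ball (0 : EuclideanSpace ℝ (Fin n)) R, avg (x + j • h) u ≤ V * I := by
    intro u hu
    have hj1 : (1 : ℝ) ≤ j := by exact_mod_cast hj
    have hmG : Measurable fun p : EuclideanSpace ℝ (Fin n) × EuclideanSpace ℝ (Fin n) =>
      G (x + j • p.1 + u • p.2) := hG.comp (by fun_prop)
    simp only [havg]
    rw [lintegral_lintegral_swap hmG.aemeasurable]
    calc _ ≤ ∫⁻ _ in Metric.ball (0 : EuclideanSpace ℝ (Fin n)) ρ, I := by
          refine setLIntegral_mono' measurableSet_ball fun v hv => ?_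
          have e : ∀ h : EuclideanSpace ℝ (Fin n),
              x + j • h + u • v = (x + u • v) + (j : ℝ) • h := by
            intro h
            rw [Nat.cast_smul_eq_nsmul]
            abel
          simp_rw [e]
          rw [setLIntegral_ball_comp_add_smul hG (by positivity), abs_of_pos (by positivity)]
          refine (mul_le_of_le_one_left' ?_).trans ?_
          · rw [ENNReal.inv_le_one]
            exact one_le_pow₀ (by rwa [ENNReal.one_le_ofReal])
          · refine lintegral_mono_set (Metric.ball_subset_ball' ?_)
            rw [dist_self_add_left, norm_smul, Real.norm_of_nonneg hu.1.le]
            have h1 : (j : ℝ) ≤ k := by exact_mod_cast hjk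
            have h2 : ‖v‖ ≤ ρ := by simpa using (mem_ball_zero_iff.1 hv).le
            have h3 : u * ‖v‖ ≤ 1 * ρ := by gcongr; exact hu.2.le
            have h4 : (j : ℝ) * R ≤ k * R := by gcongr
            linarith
      _ = V * I := by rw [setLIntegral_const, mul_comm]
  have e : ∀ a : ℝ≥0∞, a ^ (q - 1) * a = a ^ q := by
    intro a
    conv_rhs => rw [show q = (q - 1) + 1 by ring]
    rw [ENNReal.rpow_add_of_nonneg _ _ (by linarith) zero_le_one, ENNReal.rpow_one]
  have hsf : SFinite μ := by infer_instance
  calc _ ≤ ∫⁻ h in Metric.ball (0 : EuclideanSpace ℝ (Fin n)) R,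
        powMass c ^ (q - 1) * I ^ (q - 1) * ∫⁻ u, avg (x + j • h) u ∂μ :=
        setLIntegral_mono' measurableSet_ball hpt
    _ = powMass c ^ (q - 1) * I ^ (q - 1) *
        ∫⁻ u, (∫⁻ h in Metric.ball (0 : EuclideanSpace ℝ (Fin n)) R, avg (x + j • h) u) ∂μ := by
        rw [lintegral_const_mul, lintegral_lintegral_swap hmj.aemeasurable]
        exact hmj.lintegral_prod_right'
    _ ≤ powMass c ^ (q - 1) * I ^ (q - 1) * ∫⁻ _, V * I ∂μ := by
        gcongr 1
        refine lintegral_mono_ae ?_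
        filter_upwards [hμae] with u hu using hinner u hu
    _ = (powMass c ^ (q - 1) * powMass c) * V * (I ^ (q - 1) * I) := by
        rw [lintegral_const, hμuniv]
        ring
    _ = _ := by rw [e, e]

lemma rpow_lintegral_sum_le {α ι : Type*} [MeasurableSpace α] (μ : Measure α) (s : Finset ι)
    {F : ι → α → ℝ≥0∞} (hF : ∀ i ∈ s, Measurable (F i)) {q : ℝ} (hq : 1 ≤ q) :
    (∫⁻ a, (∑ i ∈ s, F i a) ^ q ∂μ) ^ (1 / q) ≤ ∑ i ∈ s, (∫⁻ a, F i a ^ q ∂μ) ^ (1 / q) := by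
  have hq0 : 0 < q := by linarith
  induction s using Finset.induction_on with
  | empty => simp [hq0]
  | insert i s hi ih =>
    simp only [Finset.sum_insert hi]
    have h1 : Measurable fun a => ∑ i ∈ s, F i a :=
      Finset.measurable_fun_sum _ fun j hj => hF j (Finset.mem_insert_of_mem hj)
    refine (ENNReal.lintegral_Lp_add_le (hF i (Finset.mem_insert_self _ _)).aemeasurable
      h1.aemeasurable hq).trans ?_
    gcongr
    exact ih fun j hj => hF j (Finset.mem_insert_of_mem hj)

lemma rpow_lintegral_scalePotential_le {Ω G : EuclideanSpace ℝ (Fin n) → ℝ≥0∞} {A : ℝ≥0∞}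
    (hΩ : Measurable Ω) (hG : Measurable G) (hA : BallA1 Ω A) {k : ℕ} (hk : 0 < k) {q : ℝ}
    (hq : 1 ≤ q) {R : ℝ} (hR : 0 < R) {j : ℕ} (hjk : j ≤ k) :
    ∫⁻ x, (∫⁻ h in Metric.ball (0 : EuclideanSpace ℝ (Fin n)) R,
        scalePotential k ((k + 1) * R) G (x + j • h) ^ q) ^ (1 / q) * Ω x ≤
      (1 + powMass (k - n + n / q)) *
        volume (Metric.ball (0 : EuclideanSpace ℝ (Fin n)) ((2 * k + 1) * R)) ^ (1 / q) *
        (A * ENNReal.ofReal ((2 * k + 1) * R) ^ n * ∫⁻ y, G y * Ω y) := by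
  have hq0 : 0 < q := by linarith
  have hρ : 0 < ((k : ℝ) + 1) * R := by positivity
  have hρ' : 0 < (2 * (k : ℝ) + 1) * R := by positivity
  have hle : ((k : ℝ) + 1) * R ≤ (2 * k + 1) * R := by
    have : (0 : ℝ) ≤ k := by positivity
    nlinarith
  rcases Nat.eq_zero_or_pos j with rfl | hj
  · simp only [zero_smul, add_zero, lintegral_const, Measure.restrict_apply_univ]
    have h1 : ∀ x, (scalePotential k ((k + 1) * R) G x ^ q *
        volume (Metric.ball (0 : EuclideanSpace ℝ (Fin n)) R)) ^ (1 / q) * Ω x =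
        volume (Metric.ball (0 : EuclideanSpace ℝ (Fin n)) R) ^ (1 / q) *
          (Ω x * scalePotential k ((k + 1) * R) G x) := by
      intro x
      rw [ENNReal.mul_rpow_of_nonneg _ _ (by positivity), ← ENNReal.rpow_mul,
        mul_one_div_cancel hq0.ne', ENNReal.rpow_one]
      ring
    simp only [h1]
    rw [lintegral_const_mul _ (hΩ.fun_mul (measurable_scalePotential hG _ _))]
    refine mul_le_mul' ?_ ((lintegral_mul_scalePotential_le hΩ hG hA k hρ).trans ?_)
    · refine le_trans ?_ (le_mul_of_one_le_left' le_self_add)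
      gcongr
      have : (0 : ℝ) ≤ k := by positivity
      nlinarith
    · gcongr
  · have h1 : ∀ x, (∫⁻ h in Metric.ball (0 : EuclideanSpace ℝ (Fin n)) R,
        scalePotential k ((k + 1) * R) G (x + j • h) ^ q) ^ (1 / q) * Ω x ≤
        (1 + powMass (k - n + n / q)) *
          volume (Metric.ball (0 : EuclideanSpace ℝ (Fin n)) ((2 * k + 1) * R)) ^ (1 / q) *
          (Ω x * ∫⁻ v in Metric.ball (0 : EuclideanSpace ℝ (Fin n)) ((2 * k + 1) * R),
            G (x + (1 : ℝ) • v)) := by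
      intro x
      have h2 := ENNReal.rpow_le_rpow
        (lintegral_scalePotential_rpow_le hG hk hq hR hρ hj hjk x)
        (show 0 ≤ 1 / q by positivity)
      rw [ENNReal.mul_rpow_of_nonneg _ _ (by positivity),
        ENNReal.mul_rpow_of_nonneg _ _ (by positivity), ← ENNReal.rpow_mul, ← ENNReal.rpow_mul,
        mul_one_div_cancel hq0.ne', ENNReal.rpow_one, ENNReal.rpow_one] at h2
      simp only [one_smul]
      rw [setLIntegral_ball_comp_add hG]
      have e : ((k : ℝ) + 1) * R + k * R = (2 * k + 1) * R := by ring
      rw [e] at h2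
      calc _ ≤ _ := mul_le_mul_left h2 (Ω x)
        _ = (powMass (k - n + n / q) *
          volume (Metric.ball (0 : EuclideanSpace ℝ (Fin n)) ((k + 1) * R)) ^ (1 / q)) *
          (Ω x * ∫⁻ y in Metric.ball x ((2 * k + 1) * R), G y) := by ring
        _ ≤ _ := by
          gcongr
          exact le_add_self
    refine (lintegral_mono h1).trans ?_
    have hm : Measurable fun x : EuclideanSpace ℝ (Fin n) =>
        ∫⁻ v in Metric.ball (0 : EuclideanSpace ℝ (Fin n)) ((2 * k + 1) * R),
            G (x + (1 : ℝ) • v) :=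
      (measurable_setLIntegral_ball_comp_smul hG _).comp (measurable_id.prodMk measurable_const)
    rw [lintegral_const_mul _ (hΩ.fun_mul hm)]
    gcongr
    exact lintegral_mul_average_le hΩ hG hA one_pos hρ'

/-- The constant in the single-scale estimate `lintegral_kdiff_single_scale_le`. -/
def scaleConst (n k : ℕ) (q : ℝ) : ℝ≥0∞ :=
  (volume (Metric.ball (0 : EuclideanSpace ℝ (Fin n)) 1))⁻¹ *
    (2 ^ k * (n : ℝ≥0∞) ^ k * (k + 1) ^ k) * (k + 1) * (1 + powMass (k - n + n / q)) *
    ((2 * k + 1) ^ n * volume (Metric.ball (0 : EuclideanSpace ℝ (Fin n)) 1)) ^ (1 / q) *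
    (2 * k + 1) ^ n

lemma volume_ball_eq (R : ℝ) (hR : 0 < R) : volume (Metric.ball (0 : EuclideanSpace ℝ (Fin n)) R) =
    ENNReal.ofReal R ^ n * volume (Metric.ball (0 : EuclideanSpace ℝ (Fin n)) 1) := by
  rw [Measure.addHaar_ball_of_pos _ _ hR, ENNReal.ofReal_pow hR.le]
  simp

lemma lintegral_kdiff_single_scale_le {Ω : EuclideanSpace ℝ (Fin n) → ℝ≥0∞} {A : ℝ≥0∞}
    (hΩ : Measurable Ω) (hA : BallA1 Ω A) {k : ℕ} (hk : 0 < k) {q : ℝ}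
    (hq : 1 ≤ q) {f : EuclideanSpace ℝ (Fin n) → ℝ} (hf : ContDiff ℝ (⊤ : ℕ∞) f)
    {R : ℝ} (hR : 0 < R) :
    ∫⁻ x, (∫⁻ h in Metric.ball (0 : EuclideanSpace ℝ (Fin n)) R,
        ‖kdiff k f h x‖ₑ ^ q) ^ (1 / q) * Ω x ≤
      scaleConst n k q * ENNReal.ofReal (R ^ (k + n / q)) * A * ∫⁻ y, derivSum k f y * Ω y := by
  have hq0 : 0 < q := by linarith
  set B := volume (Metric.ball (0 : EuclideanSpace ℝ (Fin n)) R) with hB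
  have hB0 : B ≠ 0 := (Metric.measure_ball_pos _ _ hR).ne'
  have hBt : B ≠ ⊤ := measure_ball_lt_top.ne
  set D := 2 ^ k * (n : ℝ≥0∞) ^ k * ENNReal.ofReal ((k + 1) * R) ^ k with hD
  set N := scalePotential k ((k + 1) * R) (derivSum k f) with hN
  have hG := measurable_derivSum hf k
  have hNm : Measurable N := measurable_scalePotential hG _ _
  have hNx : ∀ (x : EuclideanSpace ℝ (Fin n)) (j : ℕ), Measurable fun h => N (x + j • h) :=
    fun x j => hNm.comp (by fun_prop)
  have key : ∀ x, (∫⁻ h in Metric.ball (0 : EuclideanSpace ℝ (Fin n)) R,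
        ‖kdiff k f h x‖ₑ ^ q) ^ (1 / q) ≤ B⁻¹ * D * ∑ j ∈ Finset.range (k + 1),
        (∫⁻ h in Metric.ball (0 : EuclideanSpace ℝ (Fin n)) R, N (x + j • h) ^ q) ^ (1 / q) := by
    intro x
    have h1 : ∫⁻ h in Metric.ball (0 : EuclideanSpace ℝ (Fin n)) R, ‖kdiff k f h x‖ₑ ^ q ≤
        (B⁻¹ * D) ^ q * ∫⁻ h in Metric.ball (0 : EuclideanSpace ℝ (Fin n)) R,
          (∑ j ∈ Finset.range (k + 1), N (x + j • h)) ^ q := by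
      rw [← lintegral_const_mul _
        ((Finset.measurable_fun_sum _ fun j _ => hNx x j).pow_const q)]
      refine setLIntegral_mono' measurableSet_ball fun h hh => ?_
      rw [← ENNReal.mul_rpow_of_nonneg _ _ hq0.le]
      refine ENNReal.rpow_le_rpow ?_ hq0.le
      have := enorm_kdiff_le hf hk (mem_ball_zero_iff.1 hh) x
      rw [mul_assoc, ← ENNReal.div_eq_inv_mul, ENNReal.le_div_iff_mul_le (.inl hB0) (.inl hBt),
        mul_comm]
      exact this
    refine (ENNReal.rpow_le_rpow h1 (show 0 ≤ 1 / q by positivity)).trans ?_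
    rw [ENNReal.mul_rpow_of_nonneg _ _ (by positivity), ← ENNReal.rpow_mul,
      mul_one_div_cancel hq0.ne', ENNReal.rpow_one]
    gcongr
    exact rpow_lintegral_sum_le _ _ (fun j _ => hNx x j) hq
  have hIm : ∀ j : ℕ, Measurable fun x => (∫⁻ h in Metric.ball (0 : EuclideanSpace ℝ (Fin n)) R,
      N (x + j • h) ^ q) ^ (1 / q) := by
    intro j
    refine Measurable.pow_const (Measurable.lintegral_prod_right' (f := fun p :
      EuclideanSpace ℝ (Fin n) × EuclideanSpace ℝ (Fin n) => N (p.1 + j • p.2) ^ q) ?_) _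
    exact (hNm.comp (by fun_prop)).pow_const _
  calc _ ≤ ∫⁻ x, B⁻¹ * D * ∑ j ∈ Finset.range (k + 1),
        (∫⁻ h in Metric.ball (0 : EuclideanSpace ℝ (Fin n)) R,
          N (x + j • h) ^ q) ^ (1 / q) * Ω x := by
        refine lintegral_mono fun x => ?_
        rw [← Finset.sum_mul, ← mul_assoc]
        exact mul_le_mul_left (key x) _
    _ = B⁻¹ * D * ∑ j ∈ Finset.range (k + 1), ∫⁻ x,
        (∫⁻ h in Metric.ball (0 : EuclideanSpace ℝ (Fin n)) R,
          N (x + j • h) ^ q) ^ (1 / q) * Ω x := by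
        rw [lintegral_const_mul _ (Finset.measurable_fun_sum _ fun j _ => (hIm j).fun_mul hΩ),
          lintegral_finsetSum _ fun j _ => (hIm j).fun_mul hΩ]
    _ ≤ B⁻¹ * D * ∑ j ∈ Finset.range (k + 1), (1 + powMass (k - n + n / q)) *
        volume (Metric.ball (0 : EuclideanSpace ℝ (Fin n)) ((2 * k + 1) * R)) ^ (1 / q) *
        (A * ENNReal.ofReal ((2 * k + 1) * R) ^ n * ∫⁻ y, derivSum k f y * Ω y) := by
        gcongr with j hj
        exact rpow_lintegral_scalePotential_le hΩ hG hA hk hq hR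
          (Nat.lt_succ_iff.1 (Finset.mem_range.1 hj))
    _ = _ := by
        rw [Finset.sum_const, Finset.card_range, nsmul_eq_mul, hB, hD, volume_ball_eq R hR,
          volume_ball_eq ((2 * k + 1) * R) (by positivity), scaleConst]
        have e1 : ENNReal.ofReal ((2 * (k : ℝ) + 1) * R) = (2 * k + 1) * ENNReal.ofReal R := by
          rw [ENNReal.ofReal_mul (by positivity), ENNReal.ofReal_add (by positivity) one_pos.le,
            ENNReal.ofReal_mul (by positivity)]
          simp
        have e2 : ENNReal.ofReal (((k : ℝ) + 1) * R) = (k + 1) * ENNReal.ofReal R := by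
          rw [ENNReal.ofReal_mul (by positivity), ENNReal.ofReal_add (by positivity) one_pos.le]
          simp
        have e3 : ENNReal.ofReal (R ^ (k + n / q)) =
            ENNReal.ofReal R ^ k * (ENNReal.ofReal R ^ n) ^ (1 / q) := by
          rw [Real.rpow_add hR, ENNReal.ofReal_mul (by positivity), Real.rpow_natCast,
            ENNReal.ofReal_pow hR.le, ← ENNReal.ofReal_rpow_of_pos hR, ← ENNReal.rpow_natCast,
            ← ENNReal.rpow_natCast, ← ENNReal.rpow_mul]
          simp [div_eq_mul_inv]
        have ht0 : ENNReal.ofReal R ≠ 0 := by simpa using hR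
        have htt : ENNReal.ofReal R ≠ ⊤ := ENNReal.ofReal_ne_top
        rw [e1, e2, e3]
        generalize ENNReal.ofReal R = t at *
        generalize volume (Metric.ball (0 : EuclideanSpace ℝ (Fin n)) 1) = b
        have e4 : (t ^ n * b)⁻¹ = (t ^ n)⁻¹ * b⁻¹ :=
          ENNReal.mul_inv (.inl (pow_ne_zero _ ht0)) (.inl (ENNReal.pow_ne_top htt))
        have e5 : (((2 * (k : ℝ≥0∞) + 1) * t) ^ n * b) ^ (1 / q) =
            (t ^ n) ^ (1 / q) * ((2 * k + 1) ^ n * b) ^ (1 / q) := by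
          rw [← ENNReal.mul_rpow_of_nonneg _ _ (by positivity)]
          congr 1
          rw [mul_pow]
          ring
        have e6 : (t ^ n)⁻¹ * t ^ n = 1 :=
          ENNReal.inv_mul_cancel (pow_ne_zero _ ht0) (ENNReal.pow_ne_top htt)
        rw [e4, e5, mul_pow _ t k, mul_pow _ t n]
        calc _ = ((t ^ n)⁻¹ * t ^ n) * (b⁻¹ *
              (2 ^ k * (n : ℝ≥0∞) ^ k * (k + 1) ^ k) * (k + 1) * (1 + powMass (k - n + n / q)) *
              ((2 * k + 1) ^ n * b) ^ (1 / q) * (2 * k + 1) ^ n * (t ^ k * (t ^ n) ^ (1 / q)) *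
              A * ∫⁻ y, derivSum k f y * Ω y) := by push_cast; ring
          _ = _ := by rw [e6, one_mul]

lemma scaleConst_ne_top {k : ℕ} {q : ℝ} (hq : 1 ≤ q) (hqk : (n : ℝ) * (1 - 1 / q) < k) :
    scaleConst n k q ≠ ⊤ := by
  have hq0 : 0 < q := by linarith
  have hb0 : volume (Metric.ball (0 : EuclideanSpace ℝ (Fin n)) 1) ≠ 0 :=
    (Metric.measure_ball_pos _ _ one_pos).ne'
  have hbt : volume (Metric.ball (0 : EuclideanSpace ℝ (Fin n)) 1) ≠ ⊤ := measure_ball_lt_top.ne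
  have hp : powMass (k - n + n / q) ≠ ⊤ := by
    refine powMass_ne_top ?_
    have : (n : ℝ) * (1 - 1 / q) = n - n / q := by ring
    linarith
  unfold scaleConst
  have h1 : ((1 : ℝ≥0∞) + powMass (k - n + n / q)) ≠ ⊤ := ENNReal.add_ne_top.2 ⟨by simp, hp⟩
  have h2 : ((2 * (k : ℝ≥0∞) + 1) ^ n) ≠ ⊤ :=
    ENNReal.pow_ne_top (ENNReal.add_ne_top.2
      ⟨ENNReal.mul_ne_top (by simp) (ENNReal.natCast_ne_top k), by simp⟩)
  have h3 : ((2 : ℝ≥0∞) ^ k * (n : ℝ≥0∞) ^ k * (k + 1) ^ k) ≠ ⊤ :=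
    ENNReal.mul_ne_top (ENNReal.mul_ne_top (ENNReal.pow_ne_top (by simp))
      (ENNReal.pow_ne_top (ENNReal.natCast_ne_top n)))
      (ENNReal.pow_ne_top (ENNReal.add_ne_top.2 ⟨ENNReal.natCast_ne_top k, by simp⟩))
  exact ENNReal.mul_ne_top (ENNReal.mul_ne_top (ENNReal.mul_ne_top (ENNReal.mul_ne_top
    (ENNReal.mul_ne_top (ENNReal.inv_ne_top.2 hb0) h3)
    (ENNReal.add_ne_top.2 ⟨ENNReal.natCast_ne_top k, by simp⟩)) h1)
    (ENNReal.rpow_ne_top_of_nonneg (by positivity) (ENNReal.mul_ne_top h2 hbt))) h2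

lemma ennreal_rpow_tsum_le (a : ℕ → ℝ≥0∞) {p : ℝ} (hp : 0 < p) (hp1 : p ≤ 1) :
    (∑' i, a i) ^ p ≤ ∑' i, a i ^ p := by
  have h1 : Filter.Tendsto (fun N => (∑ i ∈ Finset.range N, a i) ^ p) Filter.atTop
      (nhds ((∑' i, a i) ^ p)) :=
    (ENNReal.continuous_rpow_const.tendsto _).comp ENNReal.summable.hasSum.tendsto_sum_nat
  refine le_of_tendsto' h1 fun N => ?_
  refine le_trans ?_ (ENNReal.sum_le_tsum (Finset.range N))
  induction N with
  | zero => simp [hp]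
  | succ N ih =>
    rw [Finset.sum_range_succ, Finset.sum_range_succ]
    exact (ENNReal.rpow_add_le_add_rpow _ _ hp.le hp1).trans (by gcongr)

lemma continuous_kdiff {f : EuclideanSpace ℝ (Fin n) → ℝ} (hf : Continuous f) (k : ℕ) :
    Continuous fun p : EuclideanSpace ℝ (Fin n) × EuclideanSpace ℝ (Fin n) =>
      kdiff k f p.2 p.1 := by
  unfold kdiff
  fun_prop

lemma tsum_dyadic_rpow_le {r c : ℝ} (hr : 0 < r) {k : ℕ} (hk : 0 < k) (hc : 0 < c) (hc1 : c < 1) :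
    ∑' i : ℕ, ENNReal.ofReal ((r * (1 / 2) ^ i) ^ (c * k)) ≤
      2 * ENNReal.ofReal (r ^ (c * k) / c) := by
  have hk1 : (1 : ℝ) ≤ k := by exact_mod_cast hk
  set b : ℝ := (1 / 2 : ℝ) ^ (c * k) with hb
  have hb0 : 0 < b := by positivity
  have hb1 : b ≤ 1 - c / 2 := by
    have h1 : b ≤ (1 / 2 : ℝ) ^ c :=
      Real.rpow_le_rpow_of_exponent_ge (by norm_num) (by norm_num) (by nlinarith)
    have h2 := rpow_one_add_le_one_add_mul_self (s := -1 / 2) (by norm_num) hc.le hc1.le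
    norm_num at h2 h1 ⊢
    linarith
  have hlt : b < 1 := by linarith
  have h3 : ∀ i : ℕ, (r * (1 / 2) ^ i) ^ (c * k) = r ^ (c * k) * b ^ i := by
    intro i
    rw [Real.mul_rpow hr.le (by positivity), hb, ← Real.rpow_natCast, ← Real.rpow_natCast,
      ← Real.rpow_mul (by norm_num), ← Real.rpow_mul (by norm_num), mul_comm (i : ℝ)]
  simp only [h3]
  have hs : Summable fun i : ℕ => r ^ (c * k) * b ^ i :=
    (summable_geometric_of_lt_one hb0.le hlt).mul_left _
  rw [← ENNReal.ofReal_tsum_of_nonneg (fun i => by positivity) hs, tsum_mul_left,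
    tsum_geometric_of_lt_one hb0.le hlt,
    show (2 : ℝ≥0∞) = ENNReal.ofReal 2 by simp, ← ENNReal.ofReal_mul (by norm_num)]
  refine ENNReal.ofReal_le_ofReal ?_
  rw [show 2 * (r ^ (c * k) / c) = r ^ (c * k) * (c / 2)⁻¹ by field_simp]
  gcongr
  linarith

lemma setLIntegral_ball_le_tsum_annuli (F : EuclideanSpace ℝ (Fin n) → ℝ≥0∞) (hF : F 0 = 0)
    {r : ℝ} (hr : 0 < r) :
    ∫⁻ h in Metric.ball 0 r, F h ≤
      ∑' i : ℕ, ∫⁻ h in {h | r * (1 / 2) ^ i / 2 ≤ ‖h‖ ∧ ‖h‖ < r * (1 / 2) ^ i}, F h := by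
  have hsub : Metric.ball (0 : EuclideanSpace ℝ (Fin n)) r ⊆
      {0} ∪ ⋃ i : ℕ, {h | r * (1 / 2) ^ i / 2 ≤ ‖h‖ ∧ ‖h‖ < r * (1 / 2) ^ i} := by
    intro h hh
    rw [mem_ball_zero_iff] at hh
    rcases eq_or_ne h 0 with rfl | h0
    · exact .inl rfl
    refine .inr (mem_iUnion.2 ?_)
    have hex : ∃ i : ℕ, r * (1 / 2) ^ i / 2 ≤ ‖h‖ := by
      obtain ⟨i, hi⟩ := exists_pow_lt_of_lt_one (div_pos (norm_pos_iff.2 h0) hr)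
        (show (1 / 2 : ℝ) < 1 by norm_num)
      rw [lt_div_iff₀ hr] at hi
      exact ⟨i, by nlinarith [norm_nonneg h]⟩
    refine ⟨Nat.find hex, Nat.find_spec hex, ?_⟩
    rcases hN : Nat.find hex with _ | N
    · simpa using hh
    · have := Nat.find_min hex (m := N) (by omega)
      rw [not_le] at this
      rw [pow_succ]
      linarith
  refine (lintegral_mono_set hsub).trans ((lintegral_union_le _ _ _).trans ?_)
  rw [lintegral_singleton, hF, zero_mul, zero_add]
  exact lintegral_iUnion_le _ _

lemma lintegral_slobodeckij_le {Ω : EuclideanSpace ℝ (Fin n) → ℝ≥0∞} {A : ℝ≥0∞}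
    (hΩ : Measurable Ω) (hA : BallA1 Ω A) {k : ℕ} (hk : 0 < k) {q : ℝ}
    (hq : 1 ≤ q) {f : EuclideanSpace ℝ (Fin n) → ℝ} (hf : ContDiff ℝ (⊤ : ℕ∞) f)
    {r s : ℝ} (hr : 0 < r) (hs : s ∈ Ioo (0 : ℝ) 1) :
    ∫⁻ x, (∫⁻ h in Metric.ball (0 : EuclideanSpace ℝ (Fin n)) r,
        ENNReal.ofReal (|kdiff k f h x| ^ q / ‖h‖ ^ ((n : ℝ) + s * k * q))) ^ (1 / q) * Ω x ≤
      2 ^ (n + k) * 2 * scaleConst n k q * ENNReal.ofReal (r ^ ((1 - s) * k) / (1 - s)) * A *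
        ∫⁻ y, derivSum k f y * Ω y := by
  obtain ⟨hs0, hs1⟩ := hs
  have hq0 : 0 < q := by linarith
  have hk0 : (0 : ℝ) < k := by exact_mod_cast hk
  set e : ℝ := (n : ℝ) + s * k * q with he
  have he0 : 0 < e := by positivity
  have hR : ∀ i : ℕ, 0 < r * (1 / 2 : ℝ) ^ i := fun i => by positivity
  have key : ∀ x, (∫⁻ h in Metric.ball (0 : EuclideanSpace ℝ (Fin n)) r,
        ENNReal.ofReal (|kdiff k f h x| ^ q / ‖h‖ ^ e)) ^ (1 / q) ≤
      ∑' i : ℕ, ENNReal.ofReal ((r * (1 / 2) ^ i / 2) ^ (-(e / q))) *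
        (∫⁻ h in Metric.ball (0 : EuclideanSpace ℝ (Fin n)) (r * (1 / 2) ^ i),
          ‖kdiff k f h x‖ₑ ^ q) ^ (1 / q) := by
    intro x
    refine (ENNReal.rpow_le_rpow (setLIntegral_ball_le_tsum_annuli _ ?_ hr)
      (by positivity)).trans ?_
    · simp [Real.zero_rpow he0.ne']
    refine (ennreal_rpow_tsum_le _ (by positivity) ((div_le_one hq0).2 hq)).trans ?_
    refine ENNReal.tsum_le_tsum fun i => ?_
    have h1 : ∫⁻ h in {h : EuclideanSpace ℝ (Fin n) |
          r * (1 / 2) ^ i / 2 ≤ ‖h‖ ∧ ‖h‖ < r * (1 / 2) ^ i},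
          ENNReal.ofReal (|kdiff k f h x| ^ q / ‖h‖ ^ e) ≤
        ENNReal.ofReal ((r * (1 / 2) ^ i / 2) ^ (-e)) *
          ∫⁻ h in Metric.ball (0 : EuclideanSpace ℝ (Fin n)) (r * (1 / 2) ^ i),
            ‖kdiff k f h x‖ₑ ^ q := by
      rw [← lintegral_const_mul' _ _ ENNReal.ofReal_ne_top]
      refine le_trans (setLIntegral_mono' ?_ fun h hh => ?_)
        (lintegral_mono_set fun h hh => mem_ball_zero_iff.2 hh.2)
      · exact (measurableSet_le measurable_const measurable_norm).inter
          (measurableSet_lt measurable_norm measurable_const)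
      · rw [Real.enorm_eq_ofReal_abs, ENNReal.ofReal_rpow_of_nonneg (abs_nonneg _) hq0.le,
          ← ENNReal.ofReal_mul (by positivity)]
        refine ENNReal.ofReal_le_ofReal ?_
        rw [div_eq_inv_mul, Real.rpow_neg (by positivity)]
        have := hR i
        gcongr
        exact hh.1
    refine (ENNReal.rpow_le_rpow h1 (by positivity)).trans_eq ?_
    rw [ENNReal.mul_rpow_of_nonneg _ _ (by positivity),
      ENNReal.ofReal_rpow_of_nonneg (by positivity) (by positivity),
      ← Real.rpow_mul (by have := hR i; positivity)]
    congr 4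
    field_simp
  have hm : ∀ i : ℕ, Measurable fun x =>
      (∫⁻ h in Metric.ball (0 : EuclideanSpace ℝ (Fin n)) (r * (1 / 2) ^ i),
        ‖kdiff k f h x‖ₑ ^ q) ^ (1 / q) * Ω x := fun i =>
    (Measurable.pow_const (Measurable.lintegral_prod_right' (f := fun p :
      EuclideanSpace ℝ (Fin n) × EuclideanSpace ℝ (Fin n) => ‖kdiff k f p.2 p.1‖ₑ ^ q)
      ((continuous_kdiff hf.continuous k).measurable.enorm.pow_const q)) _).fun_mul hΩ
  calc _ ≤ ∫⁻ x, ∑' i : ℕ, ENNReal.ofReal ((r * (1 / 2) ^ i / 2) ^ (-(e / q))) *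
        ((∫⁻ h in Metric.ball (0 : EuclideanSpace ℝ (Fin n)) (r * (1 / 2) ^ i),
          ‖kdiff k f h x‖ₑ ^ q) ^ (1 / q) * Ω x) := by
        refine lintegral_mono fun x => ?_
        simp only [← mul_assoc]
        rw [ENNReal.tsum_mul_right]
        exact mul_le_mul_left (key x) _
    _ = ∑' i : ℕ, ENNReal.ofReal ((r * (1 / 2) ^ i / 2) ^ (-(e / q))) *
        ∫⁻ x, (∫⁻ h in Metric.ball (0 : EuclideanSpace ℝ (Fin n)) (r * (1 / 2) ^ i),
          ‖kdiff k f h x‖ₑ ^ q) ^ (1 / q) * Ω x := by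
        rw [lintegral_tsum fun i => ((hm i).const_mul _).aemeasurable]
        simp only [lintegral_const_mul _ (hm _)]
    _ ≤ ∑' i : ℕ, ENNReal.ofReal ((r * (1 / 2) ^ i) ^ ((1 - s) * k)) *
        (2 ^ (n + k) * scaleConst n k q * A * ∫⁻ y, derivSum k f y * Ω y) := by
        refine ENNReal.tsum_le_tsum fun i => ?_
        refine (mul_le_mul_right (lintegral_kdiff_single_scale_le hΩ hA hk hq hf (hR i)) _).trans ?_
        have h2 : ENNReal.ofReal ((r * (1 / 2) ^ i / 2) ^ (-(e / q))) *
            ENNReal.ofReal ((r * (1 / 2) ^ i) ^ ((k : ℝ) + n / q)) ≤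
            ENNReal.ofReal ((r * (1 / 2) ^ i) ^ ((1 - s) * k)) * 2 ^ (n + k) := by
          have hRi := hR i
          generalize r * (1 / 2 : ℝ) ^ i = R at hRi ⊢
          have h3 : (2 : ℝ≥0∞) ^ (n + k) = ENNReal.ofReal (2 ^ (n + k)) := by
            rw [ENNReal.ofReal_pow (by norm_num)]; simp
          rw [h3, ← ENNReal.ofReal_mul (by positivity), ← ENNReal.ofReal_mul (by positivity)]
          refine ENNReal.ofReal_le_ofReal ?_
          have h4 : (R / 2) ^ (-(e / q)) * R ^ ((k : ℝ) + n / q) =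
              R ^ ((1 - s) * k) * 2 ^ (e / q) := by
            rw [Real.div_rpow hRi.le (by norm_num), Real.rpow_neg (by norm_num : (0 : ℝ) ≤ 2),
              div_inv_eq_mul, mul_right_comm, ← Real.rpow_add hRi]
            congr 2
            rw [he]
            field_simp
            ring
          rw [h4, ← Real.rpow_natCast]
          gcongr
          · norm_num
          · rw [he, add_div, mul_div_cancel_right₀ _ hq0.ne']
            push_cast
            have h5 : (n : ℝ) / q ≤ n := div_le_self (by positivity) hq
            nlinarith
        calc _ = (ENNReal.ofReal ((r * (1 / 2) ^ i / 2) ^ (-(e / q))) *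
            ENNReal.ofReal ((r * (1 / 2) ^ i) ^ ((k : ℝ) + n / q))) *
              (scaleConst n k q * A * ∫⁻ y, derivSum k f y * Ω y) := by ring
          _ ≤ _ := mul_le_mul_left h2 _
          _ = _ := by ring
    _ ≤ _ := by
        rw [ENNReal.tsum_mul_right]
        refine (mul_le_mul_left
          (tsum_dyadic_rpow_le hr hk (c := 1 - s) (by linarith) (by linarith)) _).trans_eq ?_
        ring

lemma memA1_A1const {ω : EuclideanSpace ℝ (Fin n) → ℝ} (hω : IsA1 ω) : MemA1 ω (A1const ω) := by
  obtain ⟨h0, -, C, hC⟩ := hω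
  have hmem : ∀ C, MemAp 1 ω C ↔ MemA1 ω C := fun C => by simp [MemAp]
  have hne : {C : ℝ | 0 ≤ C ∧ MemAp 1 ω C}.Nonempty := by
    refine ⟨max C 0, le_max_right _ _, (hmem _).2 fun Q hQ => ?_⟩
    filter_upwards [(hmem _).1 hC Q hQ] with y hy
    exact hy.trans (mul_le_mul_of_nonneg_right (le_max_left _ _) (h0 y))
  intro Q hQ
  have h1 : ∀ m : ℕ, ∀ᵐ y ∂(volume.restrict Q),
      (⨍ x in Q, ω x) ≤ (A1const ω + 1 / ((m : ℝ) + 1)) * ω y := by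
    intro m
    obtain ⟨D, ⟨-, hD⟩, hD2⟩ := exists_lt_of_csInf_lt hne
      (show sInf _ < A1const ω + 1 / ((m : ℝ) + 1) from lt_add_of_pos_right _ (by positivity))
    filter_upwards [(hmem _).1 hD Q hQ] with y hy
    exact hy.trans (mul_le_mul_of_nonneg_right hD2.le (h0 y))
  filter_upwards [ae_all_iff.2 h1] with y hy
  have h2 : Filter.Tendsto (fun m : ℕ => (A1const ω + 1 / ((m : ℝ) + 1)) * ω y) Filter.atTop
      (nhds ((A1const ω + 0) * ω y)) :=
    (tendsto_const_nhds.add tendsto_one_div_add_atTop_nhds_zero_nat).mul_const _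
  rw [add_zero] at h2
  exact ge_of_tendsto' h2 hy

lemma A1const_nonneg (ω : EuclideanSpace ℝ (Fin n) → ℝ) : 0 ≤ A1const ω :=
  Real.sInf_nonneg fun _ h => h.1

lemma cube_eq_preimage (a : EuclideanSpace ℝ (Fin n)) (l : ℝ) :
    {x : EuclideanSpace ℝ (Fin n) | ∀ i, x i ∈ Ico (a i) (a i + l)} =
      (WithLp.ofLp) ⁻¹' (univ.pi fun i => Ico (a i) (a i + l)) := by
  ext x
  simp

lemma measurableSet_cube (a : EuclideanSpace ℝ (Fin n)) (l : ℝ) :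
    MeasurableSet {x : EuclideanSpace ℝ (Fin n) | ∀ i, x i ∈ Ico (a i) (a i + l)} := by
  rw [cube_eq_preimage]
  exact (PiLp.volume_preserving_ofLp (Fin n)).measurable
    (MeasurableSet.univ_pi fun i => measurableSet_Ico)

lemma volume_cube (a : EuclideanSpace ℝ (Fin n)) (l : ℝ) :
    volume {x : EuclideanSpace ℝ (Fin n) | ∀ i, x i ∈ Ico (a i) (a i + l)} =
      ENNReal.ofReal l ^ n := by
  rw [cube_eq_preimage, (PiLp.volume_preserving_ofLp (Fin n)).measure_preimage
    (MeasurableSet.univ_pi fun i => measurableSet_Ico).nullMeasurableSet, Real.volume_pi_Ico]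
  simp

lemma integrableOn_cube {ω : EuclideanSpace ℝ (Fin n) → ℝ} (hω : LocallyIntegrable ω volume)
    (a : EuclideanSpace ℝ (Fin n)) (l : ℝ) :
    IntegrableOn ω {x : EuclideanSpace ℝ (Fin n) | ∀ i, x i ∈ Ico (a i) (a i + l)} := by
  have hK : IsCompact ((EuclideanSpace.equiv (Fin n) ℝ).symm ''
      (univ.pi fun i => Icc (a i) (a i + l))) :=
    (isCompact_univ_pi fun i => isCompact_Icc).image
      (EuclideanSpace.equiv (Fin n) ℝ).symm.continuous
  refine (hω.integrableOn_isCompact hK).mono_set fun x hx => ?_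
  refine ⟨WithLp.ofLp x, fun i _ => Ico_subset_Icc_self (hx i), ?_⟩
  rfl

lemma setLIntegral_cube_le {ω : EuclideanSpace ℝ (Fin n) → ℝ} (hω : IsA1 ω)
    (a : EuclideanSpace ℝ (Fin n)) {l : ℝ} (hl : 0 < l) :
    ∀ᵐ y, y ∈ {x : EuclideanSpace ℝ (Fin n) | ∀ i, x i ∈ Ico (a i) (a i + l)} →
      ∫⁻ z in {x : EuclideanSpace ℝ (Fin n) | ∀ i, x i ∈ Ico (a i) (a i + l)},
        ENNReal.ofReal (ω z) ≤
          ENNReal.ofReal (A1const ω) * ENNReal.ofReal l ^ n * ENNReal.ofReal (ω y) := by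
  have h1 := memA1_A1const hω _ ⟨a, l, hl, rfl⟩
  rw [ae_restrict_iff' (measurableSet_cube a l)] at h1
  filter_upwards [h1] with y hy hyQ
  have h2 := hy hyQ
  rw [← ofReal_integral_eq_lintegral_ofReal (integrableOn_cube hω.2.1 a l)
    (Filter.Eventually.of_forall hω.1), ← ENNReal.ofReal_pow hl.le,
    ← ENNReal.ofReal_mul (A1const_nonneg ω), ← ENNReal.ofReal_mul (by
      have := A1const_nonneg ω; positivity)]
  refine ENNReal.ofReal_le_ofReal ?_
  rw [setAverage_eq, measureReal_def, volume_cube a l, ENNReal.toReal_pow,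
    ENNReal.toReal_ofReal hl.le, smul_eq_mul, inv_mul_le_iff₀ (by positivity)] at h2
  linarith

lemma ballA1_of_isA1 {ω : EuclideanSpace ℝ (Fin n) → ℝ} (hω : IsA1 ω)
    {Ω : EuclideanSpace ℝ (Fin n) → ℝ≥0∞} (hΩ : Ω =ᵐ[volume] fun x => ENNReal.ofReal (ω x)) :
    BallA1 Ω (3 ^ n * ENNReal.ofReal (A1const ω)) := by
  intro ρ hρ
  have h1 : ∀ᵐ y, ∀ m : Fin n → ℤ, _ := ae_all_iff.2 fun m : Fin n → ℤ =>
    setLIntegral_cube_le hω (WithLp.toLp 2 fun i => ((m i : ℝ) - 1) * ρ)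
      (show 0 < 3 * ρ by positivity)
  filter_upwards [h1, hΩ] with y hy hΩy
  have hfl : ∀ i, (⌊y i / ρ⌋ : ℝ) * ρ ≤ y i ∧ y i < (⌊y i / ρ⌋ + 1) * ρ := fun i =>
    ⟨(le_div_iff₀ hρ).1 (Int.floor_le _), (div_lt_iff₀ hρ).1 (Int.lt_floor_add_one _)⟩
  have h2 := hy (fun i => ⌊y i / ρ⌋) (fun i => by
    have := hfl i
    constructor <;> simp only <;> nlinarith)
  have hsub : Metric.ball y ρ ⊆ {x : EuclideanSpace ℝ (Fin n) | ∀ i, x i ∈ Ico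
      ((WithLp.toLp 2 fun i => ((⌊y i / ρ⌋ : ℝ) - 1) * ρ : EuclideanSpace ℝ (Fin n)) i)
      ((WithLp.toLp 2 fun i => ((⌊y i / ρ⌋ : ℝ) - 1) * ρ : EuclideanSpace ℝ (Fin n)) i +
        3 * ρ)} := by
    intro z hz i
    rw [mem_ball_iff_norm] at hz
    have h3 := (PiLp.norm_apply_le (z - y) i).trans_lt hz
    rw [PiLp.sub_apply, Real.norm_eq_abs, abs_lt] at h3
    have := hfl i
    constructor <;> simp only <;> nlinarith
  rw [lintegral_congr_ae (ae_restrict_of_ae hΩ), hΩy]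
  refine (lintegral_mono_set hsub).trans (h2.trans_eq ?_)
  rw [ENNReal.ofReal_mul (by norm_num), mul_pow]
  simp only [ENNReal.ofReal_ofNat]
  ring

/-- The convolution `φ ⋆ f` of two real functions. -/
def conv (φ f : EuclideanSpace ℝ (Fin n) → ℝ) : EuclideanSpace ℝ (Fin n) → ℝ :=
  MeasureTheory.convolution φ f (ContinuousLinearMap.lsmul ℝ ℝ) volume

lemma conv_apply (φ f : EuclideanSpace ℝ (Fin n) → ℝ) (x : EuclideanSpace ℝ (Fin n)) :
    conv φ f x = ∫ t, f t * φ (x - t) := by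
  rw [conv, convolution_lsmul_swap]
  simp [mul_comm]

lemma contDiff_conv {φ f : EuclideanSpace ℝ (Fin n) → ℝ} (hφ : ContDiff ℝ (⊤ : ℕ∞) φ)
    (hφc : HasCompactSupport φ) (hf : LocallyIntegrable f volume) :
    ContDiff ℝ (⊤ : ℕ∞) (conv φ f) :=
  hφc.contDiff_convolution_left _ hφ hf

lemma pd_conv (i : Fin n) {φ f : EuclideanSpace ℝ (Fin n) → ℝ} (hφ : ContDiff ℝ (⊤ : ℕ∞) φ)
    (hφc : HasCompactSupport φ) (hf : LocallyIntegrable f volume) :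
    pd i (conv φ f) = conv (pd i φ) f := by
  funext x
  have h1 : ContDiff ℝ 1 φ := hφ.of_le (by exact_mod_cast le_top)
  have h2 := hφc.hasFDerivAt_convolution_left (ContinuousLinearMap.lsmul ℝ ℝ : ℝ →L[ℝ] ℝ →L[ℝ] ℝ)
    h1 hf x
  have h3 := (hφc.fderiv ℝ).convolutionExists_left
    ((ContinuousLinearMap.lsmul ℝ ℝ : ℝ →L[ℝ] ℝ →L[ℝ] ℝ).precompL (EuclideanSpace ℝ (Fin n)))
    (h1.continuous_fderiv one_ne_zero) hf x
  have h4 := h2.fderiv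
  rw [pd]
  unfold conv
  rw [h4, convolution_def, ContinuousLinearMap.integral_apply h3, convolution_def]
  rfl

lemma hasCompactSupport_listD {φ : EuclideanSpace ℝ (Fin n) → ℝ} (hφc : HasCompactSupport φ)
    (L : List (Fin n)) : HasCompactSupport (listD L φ) := by
  induction L with
  | nil => exact hφc
  | cons i L ih => exact ih.fderiv_apply ℝ _

lemma listD_conv (L : List (Fin n)) {φ f : EuclideanSpace ℝ (Fin n) → ℝ}
    (hφ : ContDiff ℝ (⊤ : ℕ∞) φ) (hφc : HasCompactSupport φ) (hf : LocallyIntegrable f volume) :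
    listD L (conv φ f) = conv (listD L φ) f := by
  induction L with
  | nil => rfl
  | cons i L ih =>
    change pd i (listD L (conv φ f)) = conv (pd i (listD L φ)) f
    rw [ih, pd_conv i (contDiff_listD hφ L) (hasCompactSupport_listD hφc L) hf]

lemma listD_comp_sub (L : List (Fin n)) {φ : EuclideanSpace ℝ (Fin n) → ℝ}
    (hφ : ContDiff ℝ (⊤ : ℕ∞) φ) (x : EuclideanSpace ℝ (Fin n)) :
    listD L (fun t => φ (x - t)) = fun t => (-1) ^ L.length * listD L φ (x - t) := by
  induction L with
  | nil => simp [listD]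
  | cons i L ih =>
    change pd i (listD L fun t => φ (x - t)) = fun t =>
      (-1) ^ (L.length + 1) * pd i (listD L φ) (x - t)
    rw [ih]
    funext t
    have h1 : HasFDerivAt (listD L φ) (fderiv ℝ (listD L φ) (x - t)) (x - t) :=
      ((contDiff_listD hφ L).differentiable (by simp) _).hasFDerivAt
    have h2 : HasFDerivAt (fun t : EuclideanSpace ℝ (Fin n) => x - t)
        (-ContinuousLinearMap.id ℝ _) t := (hasFDerivAt_id t).const_sub x
    have h3 := ((h1.comp t h2).const_mul ((-1) ^ L.length)).fderiv
    simp only [Function.comp_def] at h3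
    rw [pd, h3, pd]
    simp [pow_succ]

lemma pdMulti_conv {α : Fin n → ℕ} {φ f g : EuclideanSpace ℝ (Fin n) → ℝ}
    (hφ : ContDiff ℝ (⊤ : ℕ∞) φ) (hφc : HasCompactSupport φ) (hf : LocallyIntegrable f volume)
    (hg : HasWeakPD α f g) (x : EuclideanSpace ℝ (Fin n)) :
    pdMulti α (conv φ f) x = ∫ t, g t * φ (x - t) := by
  have hlen : ((List.finRange n).flatMap fun i => List.replicate (α i) i).length = ∑ i, α i := by
    rw [List.length_flatMap, Fin.sum_univ_def]
    simp
  have hψ : ContDiff ℝ (⊤ : ℕ∞) fun t => φ (x - t) := hφ.comp (by fun_prop)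
  have hψc : HasCompactSupport fun t => φ (x - t) :=
    hφc.comp_homeomorph (Homeomorph.subLeft x)
  have h1 := hg _ hψ hψc
  rw [pdMulti_eq_listD, listD_comp_sub _ hφ, hlen] at h1
  rw [pdMulti_eq_listD, listD_conv _ hφ hφc hf, conv_apply]
  have h2 : ((-1 : ℝ) ^ (∑ i, α i)) ≠ 0 := by positivity
  apply mul_left_cancel₀ h2
  rw [← h1, ← integral_const_mul]
  congr 1
  funext t
  ring

lemma enorm_pdMulti_conv_le {α : Fin n → ℕ} {φ f g : EuclideanSpace ℝ (Fin n) → ℝ}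
    (hφ : ContDiff ℝ (⊤ : ℕ∞) φ) (hφc : HasCompactSupport φ) (hf : LocallyIntegrable f volume)
    (hg : HasWeakPD α f g) (x : EuclideanSpace ℝ (Fin n)) :
    ‖pdMulti α (conv φ f) x‖ₑ ≤ ∫⁻ t, ‖g t‖ₑ * ‖φ (x - t)‖ₑ := by
  rw [pdMulti_conv hφ hφc hf hg]
  refine (enorm_integral_le_lintegral_enorm _).trans_eq ?_
  simp [enorm_mul]

lemma ae_eq_zero_or_ae_ne_zero {Ω : EuclideanSpace ℝ (Fin n) → ℝ≥0∞} {A : ℝ≥0∞}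
    (hΩ : Measurable Ω) (hA : BallA1 Ω A) : Ω =ᵐ[volume] 0 ∨ ∀ᵐ y, Ω y ≠ 0 := by
  by_cases h : ∀ᵐ y, Ω y ≠ 0
  · exact .inr h
  · refine .inl ?_
    have h1 : ∀ᵐ y, ∀ m : ℕ, _ := ae_all_iff.2 fun m : ℕ => hA ((m : ℝ) + 1) (by positivity)
    obtain ⟨y, hy, hym⟩ := ((Filter.not_eventually.1 h).and_eventually h1).exists
    rw [not_not] at hy
    have h2 : ∀ m : ℕ, ∀ᵐ z ∂volume.restrict (Metric.ball y ((m : ℝ) + 1)), Ω z = 0 := by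
      intro m
      have := hym m
      rw [hy, mul_zero, nonpos_iff_eq_zero, lintegral_eq_zero_iff hΩ] at this
      exact this
    rw [← ae_restrict_iUnion_iff] at h2
    have h3 : ⋃ m : ℕ, Metric.ball y ((m : ℝ) + 1) = univ := by
      refine eq_univ_of_forall fun z => mem_iUnion.2 ?_
      obtain ⟨m, hm⟩ := exists_nat_gt (dist z y)
      exact ⟨m, Metric.mem_ball.2 (by linarith)⟩
    rwa [h3, Measure.restrict_univ] at h2

/-- The standard mollifier of radius `2 / (m + 1)`. -/
def mollifierBump (n m : ℕ) : ContDiffBump (0 : EuclideanSpace ℝ (Fin n)) where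
  rIn := 1 / ((m : ℝ) + 1)
  rOut := 2 / ((m : ℝ) + 1)
  rIn_pos := by positivity
  rIn_lt_rOut := by gcongr; norm_num

/-- The `L¹`-normalized standard mollifier of radius `2 / (m + 1)`. -/
def mollifier (n m : ℕ) : EuclideanSpace ℝ (Fin n) → ℝ := (mollifierBump n m).normed volume

lemma contDiff_mollifier (m : ℕ) : ContDiff ℝ (⊤ : ℕ∞) (mollifier n m) :=
  (mollifierBump n m).contDiff_normed

lemma hasCompactSupport_mollifier (m : ℕ) : HasCompactSupport (mollifier n m) :=
  (mollifierBump n m).hasCompactSupport_normed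

lemma ae_tendsto_conv_mollifier {f : EuclideanSpace ℝ (Fin n) → ℝ}
    (hf : LocallyIntegrable f volume) :
    ∀ᵐ x, Filter.Tendsto (fun m => conv (mollifier n m) f x) Filter.atTop (nhds (f x)) := by
  refine ContDiffBump.ae_convolution_tendsto_right_of_locallyIntegrable (K := 2)
    (φ := mollifierBump n) ?_ (Filter.Eventually.of_forall fun m => ?_) hf
  · have := tendsto_one_div_add_atTop_nhds_zero_nat.const_mul (2 : ℝ)
    simpa [mollifierBump, div_eq_mul_inv] using this
  · simp only [mollifierBump]
    rw [← mul_div_assoc, mul_one]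

lemma lintegral_mollifier_mul_eq {ω : EuclideanSpace ℝ (Fin n) → ℝ} (h0 : ∀ x, 0 ≤ ω x)
    (hω : LocallyIntegrable ω volume) (m : ℕ) (t : EuclideanSpace ℝ (Fin n)) :
    ∫⁻ x, ‖mollifier n m (x - t)‖ₑ * ENNReal.ofReal (ω x) =
      ENNReal.ofReal (conv (mollifier n m) ω t) := by
  have hint : Integrable fun x => ω x * mollifier n m (t - x) := by
    have := ((hasCompactSupport_mollifier (n := n) m).convolutionExists_left
      (ContinuousLinearMap.lsmul ℝ ℝ : ℝ →L[ℝ] ℝ →L[ℝ] ℝ) (contDiff_mollifier m).continuous hω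
      t).integrable_swap
    simpa [mul_comm] using this
  have hpos : ∀ x, 0 ≤ mollifier n m x := fun x => (mollifierBump n m).nonneg_normed x
  rw [conv_apply, ofReal_integral_eq_lintegral_ofReal hint
    (Filter.Eventually.of_forall fun x => mul_nonneg (h0 x) (hpos _))]
  refine lintegral_congr fun x => ?_
  have h1 : mollifier n m (x - t) = mollifier n m (t - x) := by
    rw [← neg_sub]
    exact (mollifierBump n m).normed_neg _
  rw [h1, Real.enorm_of_nonneg (hpos _), mul_comm, ENNReal.ofReal_mul (h0 x)]

lemma lintegral_mollifier_mul_le {Ω : EuclideanSpace ℝ (Fin n) → ℝ≥0∞} {A : ℝ≥0∞}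
    (hA : BallA1 Ω A) (m : ℕ) :
    ∀ᵐ t, ∫⁻ x, ‖mollifier n m (x - t)‖ₑ * Ω x ≤
      2 ^ n * (volume (Metric.ball (0 : EuclideanSpace ℝ (Fin n)) 1))⁻¹ * A * Ω t := by
  set ρ : ℝ := 2 / ((m : ℝ) + 1) with hρ
  have hρ0 : 0 < ρ := by positivity
  filter_upwards [hA ρ hρ0] with t ht
  set V := volume.real (Metric.closedBall (0 : EuclideanSpace ℝ (Fin n)) ρ) with hV
  have hV' : ENNReal.ofReal V =
      ENNReal.ofReal ρ ^ n * volume (Metric.ball (0 : EuclideanSpace ℝ (Fin n)) 1) := by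
    rw [hV, ofReal_measureReal measure_closedBall_lt_top.ne,
      Measure.addHaar_closedBall _ _ hρ0.le, ENNReal.ofReal_pow hρ0.le]
    simp
  have hVpos : 0 < V := ENNReal.toReal_pos (Metric.measure_closedBall_pos _ _ hρ0).ne'
    measure_closedBall_lt_top.ne
  have h1 : ∀ x, ‖mollifier n m (x - t)‖ₑ * Ω x ≤
      (Metric.ball t ρ).indicator (fun x => ENNReal.ofReal (2 ^ n / V) * Ω x) x := by
    intro x
    by_cases hx : x ∈ Metric.ball t ρ
    · have hpos : 0 ≤ mollifier n m (x - t) := (mollifierBump n m).nonneg_normed _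
      rw [indicator_of_mem hx, Real.enorm_of_nonneg hpos]
      gcongr
      have := (mollifierBump n m).normed_le_div_measure_closedBall_rOut volume 2
        (by simp only [mollifierBump]; rw [← mul_div_assoc, mul_one]) (x - t)
      rwa [finrank_euclideanSpace, Fintype.card_fin] at this
    · rw [indicator_of_notMem hx]
      have : mollifier n m (x - t) = 0 := by
        rw [← Function.notMem_support, mollifier, ContDiffBump.support_normed_eq,
          mem_ball_zero_iff, ← dist_eq_norm]
        exact hx
      simp [this]
  refine (lintegral_mono h1).trans ?_
  rw [lintegral_indicator measurableSet_ball, lintegral_const_mul' _ _ ENNReal.ofReal_ne_top]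
  refine (mul_le_mul_right ht _).trans_eq ?_
  have ht0 : ENNReal.ofReal ρ ≠ 0 := by simpa using hρ0
  rw [ENNReal.ofReal_div_of_pos hVpos, hV', ENNReal.ofReal_pow (by norm_num),
    div_eq_mul_inv, ENNReal.mul_inv (.inl (pow_ne_zero _ ht0))
      (.inl (ENNReal.pow_ne_top ENNReal.ofReal_ne_top)), ENNReal.ofReal_ofNat]
  have h3 : (ENNReal.ofReal ρ ^ n)⁻¹ * ENNReal.ofReal ρ ^ n = 1 :=
    ENNReal.inv_mul_cancel (pow_ne_zero _ ht0) (ENNReal.pow_ne_top ENNReal.ofReal_ne_top)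
  generalize ENNReal.ofReal ρ ^ n = s at h3 ⊢
  generalize (volume (Metric.ball (0 : EuclideanSpace ℝ (Fin n)) 1))⁻¹ = b
  calc _ = (s⁻¹ * s) * (2 ^ n * b * A * Ω t) := by ring
    _ = _ := by rw [h3, one_mul]

lemma measurable_lintegral_mollifier_mul {Ω : EuclideanSpace ℝ (Fin n) → ℝ≥0∞}
    (hΩ : Measurable Ω) (m : ℕ) : Measurable fun t => ∫⁻ x, ‖mollifier n m (x - t)‖ₑ * Ω x := by
  refine Measurable.lintegral_prod_right' (f := fun p : EuclideanSpace ℝ (Fin n) ×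
    EuclideanSpace ℝ (Fin n) => ‖mollifier n m (p.2 - p.1)‖ₑ * Ω p.2) ?_
  have : Continuous fun p : EuclideanSpace ℝ (Fin n) × EuclideanSpace ℝ (Fin n) =>
      mollifier n m (p.2 - p.1) := (contDiff_mollifier m).continuous.comp (by fun_prop)
  exact this.measurable.enorm.mul (hΩ.comp measurable_snd)

lemma tendsto_lintegral_mul_mollifier {ω : EuclideanSpace ℝ (Fin n) → ℝ} (h0 : ∀ x, 0 ≤ ω x)
    (hω : LocallyIntegrable ω volume) {Ω G : EuclideanSpace ℝ (Fin n) → ℝ≥0∞} {A : ℝ≥0∞}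
    (hΩ : Measurable Ω) (hΩω : Ω =ᵐ[volume] fun x => ENNReal.ofReal (ω x)) (hA : BallA1 Ω A)
    (hAt : A ≠ ⊤) (hG : AEMeasurable G) (hGΩ : ∫⁻ t, G t * Ω t ≠ ⊤) :
    Filter.Tendsto (fun m => ∫⁻ t, G t * ∫⁻ x, ‖mollifier n m (x - t)‖ₑ * Ω x) Filter.atTop
      (nhds (∫⁻ t, G t * Ω t)) := by
  set D : ℝ≥0∞ := 2 ^ n * (volume (Metric.ball (0 : EuclideanSpace ℝ (Fin n)) 1))⁻¹ * A with hD
  have hDt : D ≠ ⊤ := ENNReal.mul_ne_top (ENNReal.mul_ne_top (ENNReal.pow_ne_top (by simp))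
    (ENNReal.inv_ne_top.2 (Metric.measure_ball_pos _ _ one_pos).ne')) hAt
  have hGt : ∀ᵐ t, G t * Ω t < ⊤ := ae_lt_top' (hG.mul hΩ.aemeasurable) hGΩ
  refine tendsto_lintegral_of_dominated_convergence' (fun t => D * (G t * Ω t))
    (fun m => hG.mul (measurable_lintegral_mollifier_mul hΩ m).aemeasurable) (fun m => ?_) ?_ ?_
  · filter_upwards [lintegral_mollifier_mul_le hA m] with t ht
    calc _ ≤ G t * (D * Ω t) := mul_le_mul_right ht _
      _ = _ := by ring
  · rw [lintegral_const_mul' _ _ hDt]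
    exact ENNReal.mul_ne_top hDt hGΩ
  · filter_upwards [ae_tendsto_conv_mollifier hω, hΩω, hGt,
      ae_all_iff.2 fun m => lintegral_mollifier_mul_le hA m] with t h1 h2 h3 h4
    by_cases h5 : Ω t = 0
    · have h6 : ∀ m, ∫⁻ x, ‖mollifier n m (x - t)‖ₑ * Ω x = 0 := fun m => by
        simpa [h5] using h4 m
      simp only [h6, h5]
      exact tendsto_const_nhds
    · have h6 : G t ≠ ⊤ := fun h => by
        rw [h, ENNReal.top_mul h5] at h3
        exact lt_irrefl _ h3
      refine ENNReal.Tendsto.const_mul ?_ (.inr h6)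
      have h7 : ∀ m, ∫⁻ x, ‖mollifier n m (x - t)‖ₑ * Ω x =
          ENNReal.ofReal (conv (mollifier n m) ω t) := fun m => by
        rw [← lintegral_mollifier_mul_eq h0 hω]
        refine lintegral_congr_ae ?_
        filter_upwards [hΩω] with x hx
        rw [hx]
      simp only [h7, h2]
      exact ENNReal.tendsto_ofReal h1

lemma lintegral_derivSum_conv_le {Ω : EuclideanSpace ℝ (Fin n) → ℝ≥0∞} (hΩ : Measurable Ω)
    {k : ℕ} {f : EuclideanSpace ℝ (Fin n) → ℝ}
    {g : (Fin n → ℕ) → EuclideanSpace ℝ (Fin n) → ℝ} (hf : LocallyIntegrable f volume)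
    (hg : ∀ α ∈ multiIdx n k, HasWeakPD α f (g α))
    (hgm : ∀ α ∈ multiIdx n k, AEMeasurable fun t => ‖g α t‖ₑ) (m : ℕ) :
    ∫⁻ x, derivSum k (conv (mollifier n m) f) x * Ω x ≤
      ∑ α ∈ multiIdx n k, ∫⁻ t, ‖g α t‖ₑ * ∫⁻ x, ‖mollifier n m (x - t)‖ₑ * Ω x := by
  have hmeas : Continuous fun p : EuclideanSpace ℝ (Fin n) × EuclideanSpace ℝ (Fin n) =>
      mollifier n m (p.1 - p.2) := (contDiff_mollifier m).continuous.comp (by fun_prop)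
  have hjoint : ∀ α ∈ multiIdx n k, AEMeasurable
      (fun p : EuclideanSpace ℝ (Fin n) × EuclideanSpace ℝ (Fin n) =>
        ‖g α p.2‖ₑ * ‖mollifier n m (p.1 - p.2)‖ₑ) (volume.prod volume) := fun α hα =>
    ((hgm α hα).comp_quasiMeasurePreserving Measure.quasiMeasurePreserving_snd).mul
      hmeas.measurable.enorm.aemeasurable
  calc ∫⁻ x, derivSum k (conv (mollifier n m) f) x * Ω x
      ≤ ∫⁻ x, ∑ α ∈ multiIdx n k, (∫⁻ t, ‖g α t‖ₑ * ‖mollifier n m (x - t)‖ₑ) * Ω x := by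
        refine lintegral_mono fun x => ?_
        rw [derivSum, Finset.sum_mul]
        exact Finset.sum_le_sum fun α hα => mul_le_mul_left (enorm_pdMulti_conv_le
          (contDiff_mollifier m) (hasCompactSupport_mollifier m) hf (hg α hα) x) _
    _ = ∑ α ∈ multiIdx n k, ∫⁻ x, (∫⁻ t, ‖g α t‖ₑ * ‖mollifier n m (x - t)‖ₑ) * Ω x :=
        lintegral_finsetSum' _ fun α hα =>
          (hjoint α hα).lintegral_prod_right'.mul hΩ.aemeasurable
    _ = ∑ α ∈ multiIdx n k, ∫⁻ t, ‖g α t‖ₑ * ∫⁻ x, ‖mollifier n m (x - t)‖ₑ * Ω x := by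
        refine Finset.sum_congr rfl fun α hα => ?_
        have h1 : ∀ x, (∫⁻ t, ‖g α t‖ₑ * ‖mollifier n m (x - t)‖ₑ) * Ω x =
            ∫⁻ t, ‖g α t‖ₑ * ‖mollifier n m (x - t)‖ₑ * Ω x := fun x => by
          refine (lintegral_mul_const'' _ ((hgm α hα).mul ?_)).symm
          exact (hmeas.comp (by fun_prop : Continuous fun t => (x, t))).measurable.enorm.aemeasurable
        simp only [h1]
        rw [lintegral_lintegral_swap]
        · refine lintegral_congr fun t => ?_
          simp only [mul_assoc]
          refine lintegral_const_mul _ ?_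
          exact (hmeas.comp (by fun_prop : Continuous fun x => (x, t))).measurable.enorm.mul hΩ
        · exact (hjoint α hα).mul (hΩ.comp measurable_fst).aemeasurable

lemma ae_ae_add_nsmul {p : EuclideanSpace ℝ (Fin n) → Prop} (hp : ∀ᵐ x, p x) :
    ∀ᵐ x, ∀ᵐ h, ∀ j : ℕ, p (x + j • h) := by
  filter_upwards [hp] with x hx
  refine ae_all_iff.2 fun j => ?_
  rcases Nat.eq_zero_or_pos j with rfl | hj
  · simpa using hx
  · have hj' : (j : ℝ) ≠ 0 := by exact_mod_cast hj.ne'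
    have h1 : ∀ᵐ y, p (x + y) := (measurePreserving_add_left volume x).quasiMeasurePreserving.ae hp
    have h2 : ∀ᵐ h, p (x + (j : ℝ) • h) := by
      rw [ae_iff] at h1 ⊢
      have := Measure.addHaar_preimage_smul volume hj' {y | ¬ p (x + y)}
      rw [h1, mul_zero] at this
      exact this
    filter_upwards [h2] with h hh
    rwa [← Nat.cast_smul_eq_nsmul ℝ]

lemma lintegral_kdiff_le_liminf {f : EuclideanSpace ℝ (Fin n) → ℝ}
    {F : ℕ → EuclideanSpace ℝ (Fin n) → ℝ} (hF : ∀ m, Continuous (F m))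
    (hlim : ∀ᵐ x, Filter.Tendsto (fun m => F m x) Filter.atTop (nhds (f x)))
    {Ω : EuclideanSpace ℝ (Fin n) → ℝ≥0∞} (hΩ : Measurable Ω) (hΩt : ∀ᵐ x, Ω x ≠ ⊤)
    (k : ℕ) {q : ℝ} (hq : 1 ≤ q) (r c : ℝ) :
    ∫⁻ x, (∫⁻ h in Metric.ball (0 : EuclideanSpace ℝ (Fin n)) r,
        ENNReal.ofReal (|kdiff k f h x| ^ q / ‖h‖ ^ c)) ^ (1 / q) * Ω x ≤
      Filter.liminf (fun m => ∫⁻ x, (∫⁻ h in Metric.ball (0 : EuclideanSpace ℝ (Fin n)) r,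
        ENNReal.ofReal (|kdiff k (F m) h x| ^ q / ‖h‖ ^ c)) ^ (1 / q) * Ω x) Filter.atTop := by
  have hq0 : 0 < q := by linarith
  have hm : ∀ m, Measurable fun p : EuclideanSpace ℝ (Fin n) × EuclideanSpace ℝ (Fin n) =>
      ENNReal.ofReal (|kdiff k (F m) p.2 p.1| ^ q / ‖p.2‖ ^ c) := fun m =>
    ENNReal.measurable_ofReal.comp
      (((continuous_kdiff (hF m) k).measurable.norm.pow_const q).div
        (measurable_snd.norm.pow_const c))
  refine le_trans ?_ (lintegral_liminf_le fun m =>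
    ((Measurable.lintegral_prod_right' (hm m)).pow_const _).mul hΩ)
  refine lintegral_mono_ae ?_
  filter_upwards [ae_ae_add_nsmul hlim, hΩt] with x hx hxt
  have hmono : Monotone fun a : ℝ≥0∞ => a ^ (1 / q) * Ω x := fun a b hab => by
    dsimp only
    gcongr
  have hcont : Continuous fun a : ℝ≥0∞ => a ^ (1 / q) * Ω x :=
    (ENNReal.continuous_mul_const hxt).comp ENNReal.continuous_rpow_const
  have h1 : ∫⁻ h in Metric.ball (0 : EuclideanSpace ℝ (Fin n)) r,
        ENNReal.ofReal (|kdiff k f h x| ^ q / ‖h‖ ^ c) ≤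
      Filter.liminf (fun m => ∫⁻ h in Metric.ball (0 : EuclideanSpace ℝ (Fin n)) r,
        ENNReal.ofReal (|kdiff k (F m) h x| ^ q / ‖h‖ ^ c)) Filter.atTop := by
    have h2 : ∀ m, Measurable fun h : EuclideanSpace ℝ (Fin n) =>
        ENNReal.ofReal (|kdiff k (F m) h x| ^ q / ‖h‖ ^ c) := fun m => by
      have : Continuous fun h => kdiff k (F m) h x :=
        (continuous_kdiff (hF m) k).comp (Continuous.prodMk_right x)
      exact ENNReal.measurable_ofReal.comp
        ((this.measurable.norm.pow_const q).div (measurable_norm.pow_const c))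
    refine le_trans (le_of_eq ?_) (lintegral_liminf_le h2)
    refine lintegral_congr_ae (ae_restrict_of_ae ?_)
    filter_upwards [hx] with h hh
    refine (Filter.Tendsto.liminf_eq ?_).symm
    refine ENNReal.tendsto_ofReal (Filter.Tendsto.div_const ?_ _)
    refine Filter.Tendsto.rpow_const ?_ (.inr hq0.le)
    refine Filter.Tendsto.abs ?_
    exact tendsto_finsetSum _ fun j _ => (hh j).const_mul _
  refine (hmono h1).trans_eq ?_
  exact hmono.map_liminf_of_continuousAt _ hcont.continuousAt

lemma lintegral_slobodeckij_le_of_weak {ω : EuclideanSpace ℝ (Fin n) → ℝ} (h0 : ∀ x, 0 ≤ ω x)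
    (hω : LocallyIntegrable ω volume) {Ω : EuclideanSpace ℝ (Fin n) → ℝ≥0∞} {A : ℝ≥0∞}
    (hΩ : Measurable Ω) (hΩω : Ω =ᵐ[volume] fun x => ENNReal.ofReal (ω x)) (hA : BallA1 Ω A)
    (hAt : A ≠ ⊤) {k : ℕ} (hk : 0 < k) {q : ℝ} (hq : 1 ≤ q)
    (hqk : (n : ℝ) * (1 - 1 / q) < k) {f : EuclideanSpace ℝ (Fin n) → ℝ}
    {g : (Fin n → ℕ) → EuclideanSpace ℝ (Fin n) → ℝ} (hf : LocallyIntegrable f volume)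
    (hg : ∀ α ∈ multiIdx n k, HasWeakPD α f (g α))
    (hgm : ∀ α ∈ multiIdx n k, AEMeasurable fun t => ‖g α t‖ₑ)
    (hgΩ : ∀ α ∈ multiIdx n k, ∫⁻ t, ‖g α t‖ₑ * Ω t ≠ ⊤)
    {r s : ℝ} (hr : 0 < r) (hs : s ∈ Ioo (0 : ℝ) 1) :
    ∫⁻ x, (∫⁻ h in Metric.ball (0 : EuclideanSpace ℝ (Fin n)) r,
        ENNReal.ofReal (|kdiff k f h x| ^ q / ‖h‖ ^ ((n : ℝ) + s * k * q))) ^ (1 / q) * Ω x ≤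
      2 ^ (n + k) * 2 * scaleConst n k q * ENNReal.ofReal (r ^ ((1 - s) * k) / (1 - s)) * A *
        ∑ α ∈ multiIdx n k, ∫⁻ t, ‖g α t‖ₑ * Ω t := by
  set D : ℝ≥0∞ := 2 ^ (n + k) * 2 * scaleConst n k q *
    ENNReal.ofReal (r ^ ((1 - s) * k) / (1 - s)) * A with hD
  have hDt : D ≠ ⊤ := ENNReal.mul_ne_top (ENNReal.mul_ne_top (ENNReal.mul_ne_top
    (ENNReal.mul_ne_top (ENNReal.pow_ne_top (by simp)) (by simp)) (scaleConst_ne_top hq hqk))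
    ENNReal.ofReal_ne_top) hAt
  have hsm : ∀ m, ContDiff ℝ (⊤ : ℕ∞) (conv (mollifier n m) f) := fun m =>
    contDiff_conv (contDiff_mollifier m) (hasCompactSupport_mollifier m) hf
  have hlim : Filter.Tendsto (fun m => D * ∑ α ∈ multiIdx n k,
      ∫⁻ t, ‖g α t‖ₑ * ∫⁻ x, ‖mollifier n m (x - t)‖ₑ * Ω x) Filter.atTop
      (nhds (D * ∑ α ∈ multiIdx n k, ∫⁻ t, ‖g α t‖ₑ * Ω t)) :=
    ENNReal.Tendsto.const_mul (tendsto_finsetSum _ fun α hα =>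
      tendsto_lintegral_mul_mollifier h0 hω hΩ hΩω hA hAt (hgm α hα) (hgΩ α hα)) (.inr hDt)
  rw [← hlim.liminf_eq]
  refine (lintegral_kdiff_le_liminf (fun m => (hsm m).continuous) (ae_tendsto_conv_mollifier hf)
    hΩ (hΩω.mono fun x hx => by rw [hx]; exact ENNReal.ofReal_ne_top) k hq r _).trans ?_
  refine Filter.liminf_le_liminf (Filter.Eventually.of_forall fun m => ?_)
  exact (lintegral_slobodeckij_le hΩ hA hk hq (hsm m) hr hs).trans
    (mul_le_mul_right (lintegral_derivSum_conv_le hΩ hf hg hgm m) _)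

lemma ofReal_integral_rpow_mul_le {a b : Type*} [MeasurableSpace a] [MeasurableSpace b]
    (μ : Measure a) (ν : Measure b) {F : a → b → ℝ} (hF : ∀ x h, 0 ≤ F x h) {ω : a → ℝ}
    (hω : ∀ x, 0 ≤ ω x) {p : ℝ} (hp : 0 ≤ p) :
    ENNReal.ofReal (∫ x, (∫ h, F x h ∂ν) ^ p * ω x ∂μ) ≤
      ∫⁻ x, (∫⁻ h, ENNReal.ofReal (F x h) ∂ν) ^ p * ENNReal.ofReal (ω x) ∂μ := by
  have h1 : ∀ x, 0 ≤ ∫ h, F x h ∂ν := fun x => integral_nonneg (hF x)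
  have h2 : 0 ≤ ∫ x, (∫ h, F x h ∂ν) ^ p * ω x ∂μ :=
    integral_nonneg fun x => mul_nonneg (rpow_nonneg (h1 x) _) (hω x)
  rw [← Real.enorm_of_nonneg h2]
  refine (enorm_integral_le_lintegral_enorm _).trans (lintegral_mono fun x => ?_)
  rw [enorm_mul, Real.enorm_of_nonneg (hω x), Real.enorm_of_nonneg (rpow_nonneg (h1 x) _),
    ← ENNReal.ofReal_rpow_of_nonneg (h1 x) hp]
  gcongr
  rw [← Real.enorm_of_nonneg (h1 x)]
  refine (enorm_integral_le_lintegral_enorm _).trans_eq (lintegral_congr fun h => ?_)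
  rw [Real.enorm_of_nonneg (hF x h)]

lemma abs_le_gradNorm {k : ℕ} (g : (Fin n → ℕ) → EuclideanSpace ℝ (Fin n) → ℝ)
    {α : Fin n → ℕ} (hα : α ∈ multiIdx n k) (x : EuclideanSpace ℝ (Fin n)) :
    |g α x| ≤ gradNorm n k g x := by
  rw [gradNorm, ← sqrt_sq_eq_abs]
  exact sqrt_le_sqrt (Finset.single_le_sum (f := fun α => g α x ^ 2)
    (fun β _ => sq_nonneg _) hα)

lemma gradNorm_nonneg (k : ℕ) (g : (Fin n → ℕ) → EuclideanSpace ℝ (Fin n) → ℝ)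
    (x : EuclideanSpace ℝ (Fin n)) : 0 ≤ gradNorm n k g x := sqrt_nonneg _

lemma gradNorm_mul_eq (k : ℕ) (g : (Fin n → ℕ) → EuclideanSpace ℝ (Fin n) → ℝ)
    {w : ℝ} (hw : 0 ≤ w) (x : EuclideanSpace ℝ (Fin n)) :
    gradNorm n k g x * w = sqrt (∑ α ∈ multiIdx n k, (|g α x| * w) ^ 2) := by
  simp only [mul_pow, sq_abs]
  rw [← Finset.sum_mul, sqrt_mul (Finset.sum_nonneg fun _ _ => sq_nonneg _), sqrt_sq hw, gradNorm]

lemma integrable_gradNorm_mul {k : ℕ} {g : (Fin n → ℕ) → EuclideanSpace ℝ (Fin n) → ℝ}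
    {ω : EuclideanSpace ℝ (Fin n) → ℝ} (h0 : ∀ x, 0 ≤ ω x)
    (hg : ∀ α ∈ multiIdx n k, Integrable fun x => |g α x| * ω x) :
    Integrable fun x => gradNorm n k g x * ω x := by
  refine (integrable_finsetSum _ hg).mono' ?_ (Filter.Eventually.of_forall fun x => ?_)
  · simp only [fun x => gradNorm_mul_eq k g (h0 x) x]
    exact continuous_sqrt.comp_aestronglyMeasurable
      (Finset.aestronglyMeasurable_fun_sum _ fun α hα => (hg α hα).1.pow 2)
  · rw [gradNorm_mul_eq k g (h0 x) x, Real.norm_of_nonneg (sqrt_nonneg _)]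
    refine sqrt_le_iff.2 ⟨Finset.sum_nonneg fun α _ => mul_nonneg (abs_nonneg _) (h0 x), ?_⟩
    exact Finset.sum_sq_le_sq_sum_of_nonneg fun α _ => mul_nonneg (abs_nonneg _) (h0 x)

/-- The constant in the localized weighted inequality, before conversion to a real number. -/
def slobodeckijConst (n k : ℕ) (q : ℝ) : ℝ≥0∞ :=
  2 ^ (n + k) * 2 * scaleConst n k q * 3 ^ n * (multiIdx n k).card

lemma slobodeckijConst_ne_top {k : ℕ} {q : ℝ} (hq : 1 ≤ q) (hqk : (n : ℝ) * (1 - 1 / q) < k) :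
    slobodeckijConst n k q ≠ ⊤ :=
  ENNReal.mul_ne_top (ENNReal.mul_ne_top (ENNReal.mul_ne_top (ENNReal.mul_ne_top
    (ENNReal.pow_ne_top (by simp)) (by simp)) (scaleConst_ne_top hq hqk))
    (ENNReal.pow_ne_top (by simp))) (by simp)

lemma slobodeckij_le {k : ℕ} (hk : 0 < k) {q : ℝ} (hq : 1 ≤ q)
    (hqk : (n : ℝ) * (1 - 1 / q) < k) {ω : EuclideanSpace ℝ (Fin n) → ℝ} (hω : IsA1 ω)
    {r s : ℝ} (hs : s ∈ Ioo (0 : ℝ) 1) (hr : 0 < r) {f : EuclideanSpace ℝ (Fin n) → ℝ}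
    {g : (Fin n → ℕ) → EuclideanSpace ℝ (Fin n) → ℝ} (hf : LocallyIntegrable f volume)
    (hg : ∀ α ∈ multiIdx n k, HasWeakPD α f (g α))
    (hgi : ∀ α ∈ multiIdx n k, Integrable fun x => |g α x| * ω x) :
    (1 - s) * ∫ x, (∫ h in Metric.ball (0 : EuclideanSpace ℝ (Fin n)) r,
        |kdiff k f h x| ^ q / ‖h‖ ^ ((n : ℝ) + s * k * q)) ^ (1 / q) * ω x ≤
      (slobodeckijConst n k q).toReal * A1const ω * r ^ ((1 - s) * (k : ℝ)) *
        ∫ x, gradNorm n k g x * ω x := by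
  have h0 := hω.1
  have hs1 : 0 < 1 - s := sub_pos.2 hs.2
  have hm : AEMeasurable fun x => ENNReal.ofReal (ω x) :=
    hω.2.1.aestronglyMeasurable.aemeasurable.ennreal_ofReal
  set Ω := hm.mk with hΩdef
  have hΩ : Measurable Ω := hm.measurable_mk
  have hΩω : Ω =ᵐ[volume] fun x => ENNReal.ofReal (ω x) := hm.ae_eq_mk.symm
  have hA := ballA1_of_isA1 hω hΩω
  set J := ∫ x, gradNorm n k g x * ω x with hJ
  have hJ0 : 0 ≤ J := integral_nonneg fun x => mul_nonneg (gradNorm_nonneg k g x) (h0 x)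
  have hR : 0 ≤ (slobodeckijConst n k q).toReal * A1const ω * r ^ ((1 - s) * (k : ℝ)) * J :=
    mul_nonneg (mul_nonneg (mul_nonneg ENNReal.toReal_nonneg (A1const_nonneg ω))
      (rpow_nonneg hr.le _)) hJ0
  rcases ae_eq_zero_or_ae_ne_zero hΩ hA with hz | hnz
  · refine le_trans (le_of_eq ?_) hR
    rw [integral_eq_zero_of_ae, mul_zero]
    filter_upwards [hz, hΩω] with x h1 h2
    have : ω x = 0 := le_antisymm (ENNReal.ofReal_eq_zero.1 (h2.symm.trans h1)) (h0 x)
    simp [this]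
  have hgm : ∀ α ∈ multiIdx n k, AEMeasurable fun t => ‖g α t‖ₑ := fun α hα => by
    have h1 : AEMeasurable fun x => (|g α x| * ω x) / ω x :=
      (hgi α hα).1.aemeasurable.div hω.2.1.aestronglyMeasurable.aemeasurable
    refine h1.ennreal_ofReal.congr ?_
    filter_upwards [hnz, hΩω] with x h2 h3
    have h4 : ω x ≠ 0 := fun h => h2 (by simpa [h] using h3)
    rw [mul_div_cancel_right₀ _ h4, Real.enorm_eq_ofReal_abs]
  have hgJ : ∀ α ∈ multiIdx n k, ∫⁻ t, ‖g α t‖ₑ * Ω t ≤ ENNReal.ofReal J := fun α hα => by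
    rw [hJ, ofReal_integral_eq_lintegral_ofReal (integrable_gradNorm_mul h0 hgi)
      (Filter.Eventually.of_forall fun x => mul_nonneg (gradNorm_nonneg k g x) (h0 x))]
    refine lintegral_mono_ae ?_
    filter_upwards [hΩω] with x hx
    rw [hx, Real.enorm_eq_ofReal_abs, ENNReal.ofReal_mul (gradNorm_nonneg k g x)]
    gcongr
    exact abs_le_gradNorm g hα x
  have hmain := lintegral_slobodeckij_le_of_weak h0 hω.2.1 hΩ hΩω hA
    (ENNReal.mul_ne_top (ENNReal.pow_ne_top (by simp)) ENNReal.ofReal_ne_top) hk hq hqk hf hg hgm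
    (fun α hα => ((hgJ α hα).trans_lt ENNReal.ofReal_lt_top).ne) hr hs
  have hsum : ∑ α ∈ multiIdx n k, ∫⁻ t, ‖g α t‖ₑ * Ω t ≤
      (multiIdx n k).card * ENNReal.ofReal J := by
    simpa using Finset.sum_le_card_nsmul _ _ _ hgJ
  have hle : ENNReal.ofReal (∫ x, (∫ h in Metric.ball (0 : EuclideanSpace ℝ (Fin n)) r,
      |kdiff k f h x| ^ q / ‖h‖ ^ ((n : ℝ) + s * k * q)) ^ (1 / q) * ω x) ≤
      ENNReal.ofReal ((slobodeckijConst n k q).toReal * A1const ω *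
        (r ^ ((1 - s) * (k : ℝ)) / (1 - s)) * J) := by
    refine (ofReal_integral_rpow_mul_le _ _ (fun x h => by positivity) h0 (by positivity)).trans ?_
    rw [lintegral_congr_ae (g := fun x => (∫⁻ h in Metric.ball (0 : EuclideanSpace ℝ (Fin n)) r,
      ENNReal.ofReal (|kdiff k f h x| ^ q / ‖h‖ ^ ((n : ℝ) + s * k * q))) ^ (1 / q) * Ω x)
      (hΩω.mono fun x hx => by simp only [hx])]
    refine (hmain.trans (mul_le_mul_right hsum _)).trans_eq ?_
    rw [ENNReal.ofReal_mul' hJ0, ENNReal.ofReal_mul' (by positivity),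
      ENNReal.ofReal_mul' (A1const_nonneg ω),
      ENNReal.ofReal_toReal (slobodeckijConst_ne_top hq hqk), slobodeckijConst]
    ring
  have hfin := (ENNReal.ofReal_le_ofReal_iff (mul_nonneg (mul_nonneg (mul_nonneg
    ENNReal.toReal_nonneg (A1const_nonneg ω)) (by positivity)) hJ0)).1 hle
  refine (mul_le_mul_of_nonneg_left hfin hs1.le).trans_eq ?_
  field_simp

end Paper

/-- Theorem 1.1(i) (case `p = 1`): localized weighted inequality with sharp `A₁` constant. -/
theorem statement3 (n k : ℕ) (hn : 0 < n) (hk : 0 < k) (q : ℝ) (hq : 1 ≤ q)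
    (hqk : (n : ℝ) * (1 - 1 / q) < (k : ℝ)) :
    ∃ C : ℝ, 0 < C ∧ ∀ ω : EuclideanSpace ℝ (Fin n) → ℝ, IsA1 ω →
      ∀ s ∈ Set.Ioo (0 : ℝ) 1, ∀ r : ℝ, 0 < r →
      ∀ f : EuclideanSpace ℝ (Fin n) → ℝ,
      ∀ g : (Fin n → ℕ) → EuclideanSpace ℝ (Fin n) → ℝ,
        LocallyIntegrable f volume →
        (∀ α ∈ multiIdx n k, HasWeakPD α f (g α)) →
        (∀ α ∈ multiIdx n k, Integrable (fun x => |g α x| * ω x)) →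
        (1 - s) * ∫ x, (∫ h in Metric.ball (0 : EuclideanSpace ℝ (Fin n)) r,
              |kdiff k f h x| ^ q / ‖h‖ ^ ((n : ℝ) + s * k * q)) ^ (1 / q) * ω x ≤
          C * A1const ω * r ^ ((1 - s) * (k : ℝ)) *
            ∫ x, gradNorm n k g x * ω x := by
  refine ⟨(slobodeckijConst n k q).toReal + 1, by positivity, ?_⟩
  intro ω hω s hs r hr f g hf hg hgi
  refine (slobodeckij_le hk hq hqk hω hs hr hf hg hgi).trans ?_
  have h1 : 0 ≤ ∫ x, gradNorm n k g x * ω x :=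
    integral_nonneg fun x => mul_nonneg (gradNorm_nonneg k g x) (hω.1 x)
  have h2 := A1const_nonneg ω
  have h3 : 0 ≤ r ^ ((1 - s) * (k : ℝ)) := by positivity
  gcongr
  linarith

end
end
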